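/- Let w be a cyclically reduced word over {x,y,z} of even length in which all three letters x, y, z occur, and suppose w is imprimitive, i.e. as a cyclic word w is a k-fold concatenation of a shorter word for some k ≥ 2. Then I(w) − 2·L(w) ≥ −3. -/

import Mathlib

open scoped Classical

abbrev SL2Z := Matrix.SpecialLinearGroup (Fin 2) ℤ

def Amat : SL2Z := ⟨!![1, 2; 0, 1], by norm_num [Matrix.det_fin_two_of]⟩
def Bmat : SL2Z := ⟨!![1, 0; -2, 1], by norm_num [Matrix.det_fin_two_of]⟩
def Cmat : SL2Z := (Amat * Bmat)⁻¹

def Gamma : Subgroup SL2Z := Subgroup.closure {Amat, Bmat}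

/-- The real entry `i j` of a matrix in `SL₂(ℤ)`. -/
def entry (g : SL2Z) (i j : Fin 2) : ℝ := ((g : Matrix (Fin 2) (Fin 2) ℤ) i j : ℤ)

/-- The Möbius action of `SL₂(ℤ)` on the circle `ℝ ∪ {∞}`. -/
noncomputable def mobius (g : SL2Z) (p : OnePoint ℝ) : OnePoint ℝ :=
  Option.rec (motive := fun _ => OnePoint ℝ)
    (if entry g 1 0 = 0 then OnePoint.infty
     else OnePoint.some (entry g 0 0 / entry g 1 0))
    (fun x => if entry g 1 0 * x + entry g 1 1 = 0 then OnePoint.infty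
      else OnePoint.some ((entry g 0 0 * x + entry g 0 1) / (entry g 1 0 * x + entry g 1 1)))
    p

/-- The fixed-point set of `g` acting on the circle `ℝ ∪ {∞}`. -/
noncomputable def fixedSet (g : SL2Z) : Set (OnePoint ℝ) := {p | mobius g p = p}

/-- `g` is hyperbolic if `|trace g| > 2`. -/
def Hyperbolic (g : SL2Z) : Prop := 2 < |Matrix.trace (g : Matrix (Fin 2) (Fin 2) ℤ)|

/-- Two two-element subsets of the circle are linked if the two points of `Q` lie in
different connected components of the complement of `P`. -/
def Linked (P Q : Set (OnePoint ℝ)) : Prop :=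
  ∃ q₁ q₂ : OnePoint ℝ, q₁ ≠ q₂ ∧ Q = {q₁, q₂} ∧
    connectedComponentIn Pᶜ q₁ ≠ connectedComponentIn Pᶜ q₂

/-- `h` contributes to the count `s(v)`: `v` and `h * v * h⁻¹` are hyperbolic with
linked fixed-point sets. -/
def GoodConj (v h : Gamma) : Prop :=
  Hyperbolic (v : SL2Z) ∧ Hyperbolic ((h * v * h⁻¹ : Gamma) : SL2Z) ∧
    Linked (fixedSet (v : SL2Z)) (fixedSet ((h * v * h⁻¹ : Gamma) : SL2Z))

/-- Twice `s(v)`: the number of double cosets `⟨v⟩ h ⟨v⟩` in `Γ` such that `v` and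
`h * v * h⁻¹` are hyperbolic with linked fixed-point sets. -/
noncomputable def sTwo (v : Gamma) : ℕ :=
  Nat.card (Quot (fun h h' : {h : Gamma // GoodConj v h} =>
    ∃ m k : ℤ, (h' : Gamma) = v ^ m * (h : Gamma) * v ^ k))

/-- `v` is not a proper power in `Γ`. -/
def NotProperPower (v : Gamma) : Prop := ¬ ∃ u : Gamma, ∃ k : ℕ, 2 ≤ k ∧ v = u ^ k

/-- The self-intersection number `I(g) = n² s(v) + n - 1`, where `g = vⁿ` with `v` not a
proper power and `n ≥ 1`, and `s(v)` is half the number of good double cosets. -/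
noncomputable def Iγ (g : Gamma) : ℤ :=
  if h : ∃ p : Gamma × ℕ, 1 ≤ p.2 ∧ NotProperPower p.1 ∧ g = p.1 ^ p.2 then
    (h.choose.2 : ℤ) ^ 2 * ((sTwo h.choose.1 / 2 : ℕ) : ℤ) + (h.choose.2 : ℤ) - 1
  else 0
/-- The three-letter alphabet `{x, y, z}`. -/
inductive Letter | x | y | z
deriving DecidableEq

/-- The letter of `w` at cyclic position `i`. -/
def cget (w : List Letter) (i : ℕ) : Letter := w.getD (i % w.length) Letter.x

/-- `w` is cyclically reduced: nonempty, and any two cyclically consecutive letters differ. -/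
def CyclRed (w : List Letter) : Prop :=
  w ≠ [] ∧ ∀ i : ℕ, i < w.length → cget w i ≠ cget w (i + 1)

/-- The matrix assigned to a consecutive pair of letters:
`xy ↦ A`, `yx ↦ A⁻¹`, `yz ↦ B`, `zy ↦ B⁻¹`, `zx ↦ C`, `xz ↦ C⁻¹`. -/
def pairM : Letter → Letter → SL2Z
  | .x, .y => Amat
  | .y, .x => Amat⁻¹
  | .y, .z => Bmat
  | .z, .y => Bmat⁻¹
  | .z, .x => Cmat
  | .x, .z => Cmat⁻¹
  | _, _ => 1

/-- `φ(w)`: group the letters of `w` into consecutive pairs and multiply the matrices. -/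
def phiM : List Letter → SL2Z
  | [] => 1
  | [_] => 1
  | a :: b :: t => pairM a b * phiM t

lemma pairM_mem (a b : Letter) : pairM a b ∈ Gamma := by
  have hA : Amat ∈ Gamma := Subgroup.subset_closure (by simp)
  have hB : Bmat ∈ Gamma := Subgroup.subset_closure (by simp)
  have hC : Cmat ∈ Gamma := inv_mem (mul_mem hA hB)
  cases a <;> cases b <;>
    simp only [pairM] <;>
    first
      | exact hA | exact hB | exact hC
      | exact inv_mem hA | exact inv_mem hB | exact inv_mem hC
      | exact one_mem _

lemma phiM_mem : ∀ w : List Letter, phiM w ∈ Gamma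
  | [] => one_mem _
  | [_] => one_mem _
  | _ :: b :: t => mul_mem (pairM_mem _ b) (phiM_mem t)

/-- The self-intersection number of the word `w`. -/
noncomputable def Iw (w : List Letter) : ℤ := Iγ ⟨phiM w, phiM_mem w⟩

/-- The combinatorial length `L(w)` (half the number of letters). -/
def Lw (w : List Letter) : ℤ := (w.length : ℤ) / 2
/-- `w` is primitive: as a cyclic word it is not a `k`-fold concatenation of a
shorter word for any `k ≥ 2`. -/
def Primitive (w : List Letter) : Prop :=
  ¬ ∃ u : List Letter, ∃ k : ℕ, 2 ≤ k ∧ u.length < w.length ∧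
      ∃ j : ℕ, w.rotate j = (List.replicate k u).flatten

/-- `w` represents a class of `𝒢`: primitive, cyclically reduced, of even length at least 4. -/
def InG (w : List Letter) : Prop :=
  CyclRed w ∧ Primitive w ∧ 2 ∣ w.length ∧ 4 ≤ w.length

/-- Words representing classes of `𝒢`. -/
def GWord := {w : List Letter // InG w}

/-- `v` is obtained from `u`, or from its reversal, by a cyclic rotation through an
even number of places. -/
def WordEquiv (u v : List Letter) : Prop :=
  ∃ k : ℕ, 2 ∣ k ∧ (v = u.rotate k ∨ v = u.reverse.rotate k)

def GEquiv (u v : GWord) : Prop := WordEquiv u.1 v.1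

/-- The set `𝒢` of equivalence classes. -/
def GClass := Quot GEquiv

/-- The defect `δ(w) = I(w) - L(w)`. -/
noncomputable def deltaW (w : List Letter) : ℤ := Iw w - Lw w

/-- `N_δ(L)`: the number of classes `[w] ∈ 𝒢` with `L(w) = L` and `δ(w) = δ`. -/
noncomputable def Ncount (d L : ℤ) : ℕ :=
  Nat.card {c : GClass // ∃ w : GWord, Quot.mk GEquiv w = c ∧ Lw w.1 = L ∧ deltaW w.1 = d}

namespace Ranks

variable {S : Type*}

/-- The number of elements of `V` strictly below `a` for the key `f`. -/
noncomputable def rk (V : Finset S) (f : S → ℤ) (a : S) : ℕ := (V.filter (fun b => f b < f a)).card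

/-- The number of elements of `V` which pass from rank at most `k` for `f` to rank above `k`
for `g`. -/
noncomputable def spn (V : Finset S) (f g : S → ℤ) (k : ℕ) : ℕ :=
  (V.filter (fun a => rk V f a ≤ k ∧ k < rk V g a)).card

lemma rk_lt_card {V : Finset S} (f : S → ℤ) {a : S} (ha : a ∈ V) : rk V f a < V.card := by
  apply Finset.card_lt_card
  refine ⟨Finset.filter_subset _ _, fun h => ?_⟩
  have := h ha
  simp at this

lemma rk_mono {V : Finset S} {f : S → ℤ} {a b : S} (h : f a ≤ f b) : rk V f a ≤ rk V f b :=
  Finset.card_le_card (fun c hc => by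
    simp only [Finset.mem_filter] at hc ⊢
    exact ⟨hc.1, hc.2.trans_le h⟩)

lemma rk_strictMono {V : Finset S} {f : S → ℤ} {a b : S} (ha : a ∈ V) (h : f a < f b) :
    rk V f a < rk V f b := by
  apply Finset.card_lt_card
  refine ⟨fun c hc => ?_, fun hs => ?_⟩
  · simp only [Finset.mem_filter] at hc ⊢
    exact ⟨hc.1, hc.2.trans h⟩
  · have : a ∈ V.filter (fun b => f b < f a) := hs (by simp [ha, h])
    simp at this

lemma rk_injOn {V : Finset S} {f : S → ℤ} (hf : Set.InjOn f V) : Set.InjOn (rk V f) V := by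
  intro a ha b hb h
  by_contra hne
  have hab : f a ≠ f b := fun h' => hne (hf ha hb h')
  rcases lt_or_gt_of_ne hab with h1 | h1
  · exact absurd h (rk_strictMono ha h1).ne
  · exact absurd h (rk_strictMono hb h1).ne'

lemma image_rk {V : Finset S} {f : S → ℤ} (hf : Set.InjOn f V) :
    V.image (rk V f) = Finset.range V.card := by
  apply Finset.eq_of_subset_of_card_le
  · intro k hk
    obtain ⟨a, ha, rfl⟩ := Finset.mem_image.1 hk
    exact Finset.mem_range.2 (rk_lt_card f ha)
  · rw [Finset.card_image_of_injOn (rk_injOn hf), Finset.card_range]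

lemma card_rk_le {V : Finset S} {f : S → ℤ} (hf : Set.InjOn f V) {k : ℕ} (hk : k < V.card) :
    (V.filter (fun a => rk V f a ≤ k)).card = k + 1 := by
  rw [← Finset.card_image_of_injOn ((rk_injOn hf).mono (Finset.coe_subset.2 (Finset.filter_subset _ _)))]
  rw [← Finset.card_range (k + 1)]
  congr 1
  ext j
  simp only [Finset.mem_image, Finset.mem_filter, Finset.mem_range]
  constructor
  · rintro ⟨a, ⟨_, h⟩, rfl⟩
    omega
  · intro hj
    have : j ∈ V.image (rk V f) := by
      rw [image_rk hf]
      exact Finset.mem_range.2 (by omega)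
    obtain ⟨a, ha, rfl⟩ := Finset.mem_image.1 this
    exact ⟨a, ⟨ha, by omega⟩, rfl⟩

lemma rk_neg {V : Finset S} {f : S → ℤ} (hf : Set.InjOn f V) {a : S} (ha : a ∈ V) :
    rk V f a + rk V (fun b => -f b) a + 1 = V.card := by
  have h1 : V = V.filter (fun b => f b < f a) ∪ (V.filter (fun b => -f b < -f a) ∪ {a}) := by
    ext b
    simp only [Finset.mem_union, Finset.mem_filter, Finset.mem_singleton, neg_lt_neg_iff]
    constructor
    · intro hb
      rcases lt_trichotomy (f b) (f a) with h | h | h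
      · exact Or.inl ⟨hb, h⟩
      · exact Or.inr (Or.inr (hf hb ha h))
      · exact Or.inr (Or.inl ⟨hb, h⟩)
    · rintro (h | h | h)
      · exact h.1
      · exact h.1
      · exact h ▸ ha
  have h2 : Disjoint (V.filter (fun b => -f b < -f a)) {a} := by simp
  have h3 : Disjoint (V.filter (fun b => f b < f a)) (V.filter (fun b => -f b < -f a) ∪ {a}) := by
    rw [Finset.disjoint_left]
    intro b
    simp only [Finset.mem_union, Finset.mem_filter, Finset.mem_singleton, neg_lt_neg_iff]
    rintro ⟨_, h⟩ (h' | rfl)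
    · exact absurd h'.2 h.le.not_gt
    · exact lt_irrefl _ h
  conv_rhs => rw [h1]
  rw [Finset.card_union_of_disjoint h3, Finset.card_union_of_disjoint h2, Finset.card_singleton]
  simp only [rk]; omega


lemma sum_spn_le {V : Finset S} {f g : S → ℤ} (hf : Set.InjOn f V) (n : ℕ) :
    ∑ k ∈ Finset.range n, spn V f g k ≤
      ((V ×ˢ V).filter (fun p => f p.1 < f p.2 ∧ g p.2 < g p.1)).card := by
  have h1 : ∀ k, spn V f g k = ∑ a ∈ V, if rk V f a ≤ k ∧ k < rk V g a then 1 else 0 := by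
    intro k
    rw [spn, Finset.card_filter]
  have h2 : ((V ×ˢ V).filter (fun p => f p.1 < f p.2 ∧ g p.2 < g p.1)).card =
      ∑ a ∈ V, (V.filter (fun b => f a < f b ∧ g b < g a)).card := by
    rw [Finset.card_filter, Finset.sum_product]
    simp_rw [Finset.card_filter]
  rw [Finset.sum_congr rfl (fun k _ => h1 k), Finset.sum_comm, h2]
  refine Finset.sum_le_sum (fun a ha => ?_)
  rw [← Finset.card_filter]
  have h3 : ((Finset.range n).filter (fun k => rk V f a ≤ k ∧ k < rk V g a)).card ≤
      rk V g a - rk V f a := by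
    rw [← Nat.card_Ico]
    apply Finset.card_le_card
    intro k hk
    simp only [Finset.mem_filter, Finset.mem_Ico] at hk ⊢
    exact hk.2
  have h4 : rk V g a ≤ rk V f a + (V.filter (fun b => f a < f b ∧ g b < g a)).card := by
    refine le_trans (Finset.card_le_card ?_) (Finset.card_union_le _ _)
    intro b hb
    simp only [Finset.mem_filter, Finset.mem_union] at hb ⊢
    rcases lt_trichotomy (f b) (f a) with h | h | h
    · exact Or.inl ⟨hb.1, h⟩
    · have := hf hb.1 ha h
      subst this
      exact absurd hb.2 (lt_irrefl _)
    · exact Or.inr ⟨hb.1, h, hb.2⟩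
  omega

lemma rk_le_iff_of_spn_eq_zero {V : Finset S} {f g : S → ℤ} (hf : Set.InjOn f V)
    (hg : Set.InjOn g V) {k : ℕ} (hk : k < V.card) (h : spn V f g k = 0) {a : S} (ha : a ∈ V) :
    rk V f a ≤ k ↔ rk V g a ≤ k := by
  have h0 : ∀ b ∈ V, rk V f b ≤ k → rk V g b ≤ k := by
    intro b hb hbk
    by_contra hcon
    have := Finset.card_eq_zero.1 h
    have hmem : b ∈ V.filter (fun a => rk V f a ≤ k ∧ k < rk V g a) := by
      simp only [Finset.mem_filter]
      exact ⟨hb, hbk, by omega⟩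
    rw [this] at hmem
    simp at hmem
  refine ⟨h0 a ha, fun hga => ?_⟩
  have h1 : V.filter (fun a => rk V f a ≤ k) = V.filter (fun a => rk V g a ≤ k) := by
    apply Finset.eq_of_subset_of_card_le
    · intro b hb
      simp only [Finset.mem_filter] at hb ⊢
      exact ⟨hb.1, h0 b hb.1 hb.2⟩
    · rw [card_rk_le hf hk, card_rk_le hg hk]
  have : a ∈ V.filter (fun a => rk V g a ≤ k) := by simp [ha, hga]
  rw [← h1] at this
  exact (Finset.mem_filter.1 this).2

lemma spn_neg {V : Finset S} {f g : S → ℤ} (hf : Set.InjOn f V) (hg : Set.InjOn g V) {k : ℕ}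
    (hk : k + 2 ≤ V.card) :
    spn V (fun a => -g a) (fun a => -f a) k = spn V f g (V.card - 2 - k) := by
  unfold spn
  congr 1
  apply Finset.filter_congr
  intro a ha
  have h1 := rk_neg hf ha
  have h2 := rk_neg hg ha
  omega

lemma spn_eq_zero {V : Finset S} {f g : S → ℤ} {k : ℕ} (hk : V.card ≤ k + 1) :
    spn V f g k = 0 := by
  rw [spn, Finset.card_eq_zero, Finset.filter_eq_empty_iff]
  intro a ha h
  have := rk_lt_card g ha
  omega

lemma neg_injOn {V : Finset S} {f : S → ℤ} (hf : Set.InjOn f V) :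
    Set.InjOn (fun a => -f a) V := fun _ ha _ hb h => hf ha hb (neg_injective h)

/-- A matching of the boundary points of ideal triangles along corner arcs. -/
structure TriSys (side : S → ZMod 3) (f : S → ℤ) (d : S → Prop) (M : S → S) : Prop where
  inj : ∀ a b, side a = side b → f a = f b → a = b
  mono : ∀ a b, side a = side b → d a → ¬ d b → f a < f b
  invol : ∀ a, M (M a) = a
  up : ∀ a, d a → side (M a) = side a + 1 ∧ ¬ d (M a)
  down : ∀ a, ¬ d a → side (M a) = side a - 1 ∧ d (M a)

lemma TriSys.M_inj {side : S → ZMod 3} {f : S → ℤ} {d : S → Prop} {M : S → S}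
    (h : TriSys side f d M) {a b : S} (hab : M a = M b) : a = b := by
  rw [← h.invol a, hab, h.invol]

section

variable [Fintype S]

/-- The points on the side `c`. -/
noncomputable def onSide (side : S → ZMod 3) (c : ZMod 3) : Finset S :=
  Finset.univ.filter (fun a => side a = c)

/-- The points on the side `c` whose corner arc goes to the side `c + 1`. -/
noncomputable def cornerSet (side : S → ZMod 3) (d : S → Prop) (c : ZMod 3) : Finset S :=
  Finset.univ.filter (fun a => side a = c ∧ d a)

/-- The points among the first `k + 1` on side `c` or the last `k + 1` on side `c + 1`. -/
def Low (side : S → ZMod 3) (f : S → ℤ) (c : ZMod 3) (k : ℕ) (a : S) : Prop :=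
  (side a = c ∧ rk (onSide side c) f a ≤ k) ∨
    (side a = c + 1 ∧ rk (onSide side (c + 1)) (fun b => -f b) a ≤ k)

variable {side : S → ZMod 3} {f : S → ℤ} {d : S → Prop} {M : S → S}

@[simp] lemma mem_onSide {c : ZMod 3} {a : S} : a ∈ onSide side c ↔ side a = c := by
  simp [onSide]

@[simp] lemma mem_cornerSet {c : ZMod 3} {a : S} :
    a ∈ cornerSet side d c ↔ side a = c ∧ d a := by
  simp [cornerSet]

lemma TriSys.injOn (h : TriSys side f d M) (c : ZMod 3) : Set.InjOn f (onSide side c) := by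
  intro a ha b hb hab
  rw [Finset.mem_coe, mem_onSide] at ha hb
  exact h.inj a b (ha.trans hb.symm) hab

lemma TriSys.injOn_corner (h : TriSys side f d M) (c : ZMod 3) :
    Set.InjOn f (cornerSet side d c) := by
  intro a ha b hb hab
  rw [Finset.mem_coe, mem_cornerSet] at ha hb
  exact h.inj a b (ha.1.trans hb.1.symm) hab

lemma TriSys.injOn_corner' (h : TriSys side f d M) (c : ZMod 3) :
    Set.InjOn (fun a => -f (M a)) (cornerSet side d c) := by
  intro a ha b hb hab
  rw [Finset.mem_coe, mem_cornerSet] at ha hb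
  have h1 := (h.up a ha.2).1
  have h2 := (h.up b hb.2).1
  apply h.M_inj
  apply h.inj _ _ _ (neg_injective hab)
  rw [h1, h2, ha.1, hb.1]

lemma TriSys.card_onSide (h : TriSys side f d M) (c : ZMod 3) :
    (onSide side c).card = (cornerSet side d c).card + (cornerSet side d (c - 1)).card := by
  have h1 : onSide side c = cornerSet side d c ∪ (cornerSet side d (c - 1)).image M := by
    ext a
    simp only [mem_onSide, Finset.mem_union, mem_cornerSet, Finset.mem_image]
    constructor
    · intro ha
      by_cases hd : d a
      · exact Or.inl ⟨ha, hd⟩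
      · refine Or.inr ⟨M a, ⟨?_, (h.down a hd).2⟩, h.invol a⟩
        rw [(h.down a hd).1, ha]
    · rintro (ha | ⟨b, ⟨hb, hdb⟩, rfl⟩)
      · exact ha.1
      · rw [(h.up b hdb).1, hb]; ring
  rw [h1, Finset.card_union_of_disjoint, Finset.card_image_of_injective _ (fun _ _ => h.M_inj)]
  rw [Finset.disjoint_left]
  intro a ha hb
  simp only [mem_cornerSet, Finset.mem_image] at ha hb
  obtain ⟨b, ⟨hb, hdb⟩, rfl⟩ := hb
  exact (h.up b hdb).2 ha.2

lemma TriSys.rk_of_d (h : TriSys side f d M) {c : ZMod 3} {a : S} (ha : side a = c) (hd : d a) :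
    rk (onSide side c) f a = rk (cornerSet side d c) f a := by
  unfold rk
  congr 1
  ext b
  simp only [Finset.mem_filter, mem_onSide, mem_cornerSet]
  constructor
  · rintro ⟨hb, hlt⟩
    refine ⟨⟨hb, ?_⟩, hlt⟩
    by_contra hdb
    exact absurd (h.mono a b (ha.trans hb.symm) hd hdb) hlt.le.not_gt
  · rintro ⟨⟨hb, _⟩, hlt⟩
    exact ⟨hb, hlt⟩

lemma TriSys.rk_neg_M (h : TriSys side f d M) {c : ZMod 3} {a : S} (ha : side a = c) (hd : d a) :
    rk (onSide side (c + 1)) (fun b => -f b) (M a) =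
      rk (cornerSet side d c) (fun b => -f (M b)) a := by
  unfold rk
  symm
  rw [← Finset.card_image_of_injective _ (fun _ _ => h.M_inj : Function.Injective M)]
  congr 1
  ext b
  simp only [Finset.mem_filter, mem_onSide, mem_cornerSet, Finset.mem_image, neg_lt_neg_iff]
  obtain ⟨ha1, ha2⟩ := h.up a hd
  constructor
  · rintro ⟨b', ⟨⟨hb, hdb⟩, hlt⟩, rfl⟩
    exact ⟨by rw [(h.up b' hdb).1, hb], hlt⟩
  · rintro ⟨hb, hlt⟩
    have hdb : ¬ d b := by
      intro hdb
      exact absurd (h.mono b (M a) (by rw [hb, ha1, ha]) hdb ha2) hlt.le.not_gt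
    refine ⟨M b, ⟨⟨?_, (h.down b hdb).2⟩, ?_⟩, h.invol b⟩
    · rw [(h.down b hdb).1, hb]; ring
    · rwa [h.invol]

lemma TriSys.d_of_rk_lt (h : TriSys side f d M) {c : ZMod 3} {a : S} (ha : side a = c)
    (hk : rk (onSide side c) f a < (cornerSet side d c).card) : d a := by
  by_contra hd
  refine absurd (Finset.card_le_card ?_) hk.not_ge
  intro b hb
  rw [mem_cornerSet] at hb
  simp only [Finset.mem_filter, mem_onSide]
  exact ⟨hb.1, h.mono b a (hb.1.trans ha.symm) hb.2 hd⟩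

lemma TriSys.not_d_of_rk_lt (h : TriSys side f d M) {c : ZMod 3} {a : S} (ha : side a = c + 1)
    (hk : rk (onSide side (c + 1)) (fun b => -f b) a < (cornerSet side d c).card) : ¬ d a := by
  intro hd
  refine absurd ?_ hk.not_ge
  rw [← Finset.card_image_of_injective (cornerSet side d c)
    (fun _ _ => h.M_inj : Function.Injective M)]
  apply Finset.card_le_card
  intro b hb
  obtain ⟨b', hb', rfl⟩ := Finset.mem_image.1 hb
  rw [mem_cornerSet] at hb'
  obtain ⟨h1, h2⟩ := h.up b' hb'.2
  simp only [Finset.mem_filter, mem_onSide, neg_lt_neg_iff]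
  refine ⟨by rw [h1, hb'.1], h.mono a (M b') ?_ hd h2⟩
  rw [ha, h1, hb'.1]

lemma TriSys.low_M (h : TriSys side f d M) {c : ZMod 3} {k : ℕ}
    (hk : k < (cornerSet side d c).card)
    (h0 : spn (cornerSet side d c) f (fun a => -f (M a)) k = 0) {a : S}
    (ha : Low side f c k a) : Low side f c k (M a) := by
  rcases ha with ⟨ha, hr⟩ | ⟨ha, hr⟩
  · have hd := h.d_of_rk_lt ha (by omega)
    refine Or.inr ⟨by rw [(h.up a hd).1, ha], ?_⟩
    rw [h.rk_neg_M ha hd, ← rk_le_iff_of_spn_eq_zero (h.injOn_corner c) (h.injOn_corner' c) hk h0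
      (mem_cornerSet.2 ⟨ha, hd⟩), ← h.rk_of_d ha hd]
    exact hr
  · have hd := h.not_d_of_rk_lt ha (by omega)
    obtain ⟨h1, h2⟩ := h.down a hd
    have h1' : side (M a) = c := by rw [h1, ha]; ring
    refine Or.inl ⟨h1', ?_⟩
    rw [h.rk_of_d h1' h2, rk_le_iff_of_spn_eq_zero (h.injOn_corner c) (h.injOn_corner' c) hk h0
      (mem_cornerSet.2 ⟨h1', h2⟩), ← h.rk_neg_M h1' h2, h.invol]
    exact hr

end

end Ranks

namespace Ranks

section

variable {S : Type*} [Fintype S]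

/-- A pair of triangle matchings gluing to a connected pattern. -/
structure DblSys (side : S → ZMod 3) (f₁ f₂ : S → ℤ) (d₁ d₂ : S → Prop) (M₁ M₂ : S → S) :
    Prop where
  t₁ : TriSys side f₁ d₁ M₁
  t₂ : TriSys side f₂ d₂ M₂
  trans : ∀ Y : Set S, Y.Nonempty → (∀ a ∈ Y, M₁ a ∈ Y) → (∀ a ∈ Y, M₂ a ∈ Y) → Y = Set.univ
  surj : Function.Surjective side

/-- Pairs crossing along a side. -/
noncomputable def sideCross (side : S → ZMod 3) (f₁ f₂ : S → ℤ) : Finset (S × S) :=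
  Finset.univ.filter (fun p => side p.1 = side p.2 ∧ f₁ p.1 < f₁ p.2 ∧ f₂ p.2 < f₂ p.1)

/-- Pairs crossing inside a triangle at one corner. -/
noncomputable def cornerCross (side : S → ZMod 3) (f : S → ℤ) (d : S → Prop) (M : S → S) :
    Finset (S × S) :=
  Finset.univ.filter (fun p => side p.1 = side p.2 ∧ d p.1 ∧ d p.2 ∧ f p.1 < f p.2 ∧
    f (M p.1) < f (M p.2))

variable {side : S → ZMod 3} {f f₁ f₂ : S → ℤ} {d d₁ d₂ : S → Prop} {M M₁ M₂ : S → S}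

lemma sum_zmod3 (F : ZMod 3 → ℕ) : ∑ c, F c = F 0 + F 1 + F 2 := by
  have : (Finset.univ : Finset (ZMod 3)) = {0, 1, 2} := by decide
  rw [this, Finset.sum_insert (by decide), Finset.sum_insert (by decide), Finset.sum_singleton,
    add_assoc]

lemma sum_sideCross_le (hf : ∀ c, Set.InjOn f₁ (onSide side c)) :
    ∑ c, ∑ k ∈ Finset.range (onSide side c).card, spn (onSide side c) f₁ f₂ k ≤
      (sideCross side f₁ f₂).card := by
  rw [Finset.card_eq_sum_card_fiberwise (f := fun p : S × S => side p.1)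
    (t := (Finset.univ : Finset (ZMod 3))) (fun _ _ => Finset.mem_univ _)]
  refine Finset.sum_le_sum (fun c _ => (sum_spn_le (hf c) _).trans (Finset.card_le_card ?_))
  rintro ⟨a, b⟩ h
  simp only [Finset.mem_filter, Finset.mem_product, mem_onSide, sideCross, Finset.mem_univ,
    true_and] at h ⊢
  exact ⟨⟨h.1.1.trans h.1.2.symm, h.2⟩, h.1.1⟩

lemma sum_cornerCross_le (h : TriSys side f d M) :
    ∑ c, ∑ k ∈ Finset.range (cornerSet side d c).card,
        spn (cornerSet side d c) f (fun a => -f (M a)) k ≤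
      (cornerCross side f d M).card := by
  rw [Finset.card_eq_sum_card_fiberwise (f := fun p : S × S => side p.1)
    (t := (Finset.univ : Finset (ZMod 3))) (fun _ _ => Finset.mem_univ _)]
  refine Finset.sum_le_sum (fun c _ => (sum_spn_le (h.injOn_corner c) _).trans
    (Finset.card_le_card ?_))
  rintro ⟨a, b⟩ hab
  simp only [Finset.mem_filter, Finset.mem_product, mem_cornerSet, cornerCross, Finset.mem_univ,
    true_and, neg_lt_neg_iff] at hab ⊢
  exact ⟨⟨hab.1.1.1.trans hab.1.2.1.symm, hab.1.1.2, hab.1.2.2, hab.2⟩, hab.1.1.1⟩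

lemma DblSys.corner_card_eq (h : DblSys side f₁ f₂ d₁ d₂ M₁ M₂) (c : ZMod 3) :
    (cornerSet side d₁ c).card = (cornerSet side d₂ c).card := by
  have a0 := h.t₁.card_onSide 0
  have a1 := h.t₁.card_onSide 1
  have a2 := h.t₁.card_onSide 2
  have b0 := h.t₂.card_onSide 0
  have b1 := h.t₂.card_onSide 1
  have b2 := h.t₂.card_onSide 2
  rw [show (0 - 1 : ZMod 3) = 2 by decide] at a0 b0
  rw [show (1 - 1 : ZMod 3) = 0 by decide] at a1 b1
  rw [show (2 - 1 : ZMod 3) = 1 by decide] at a2 b2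
  fin_cases c
  · show (cornerSet side d₁ 0).card = (cornerSet side d₂ 0).card
    omega
  · show (cornerSet side d₁ 1).card = (cornerSet side d₂ 1).card
    omega
  · show (cornerSet side d₁ 2).card = (cornerSet side d₂ 2).card
    omega

lemma DblSys.one_le (h : DblSys side f₁ f₂ d₁ d₂ M₁ M₂) (c : ZMod 3) {k : ℕ}
    (hk : k < (cornerSet side d₁ c).card) :
    1 ≤ spn (cornerSet side d₁ c) f₁ (fun a => -f₁ (M₁ a)) k +
      spn (cornerSet side d₂ c) f₂ (fun a => -f₂ (M₂ a)) k +
      spn (onSide side c) f₁ f₂ k +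
      spn (onSide side (c + 1)) (fun a => -f₂ a) (fun a => -f₁ a) k := by
  by_contra hcon
  have hk2 : k < (cornerSet side d₂ c).card := by rw [← h.corner_card_eq]; exact hk
  have hn1 : k < (onSide side c).card := by
    rw [h.t₁.card_onSide c]; omega
  have hn2 : k < (onSide side (c + 1)).card := by
    rw [h.t₁.card_onSide (c + 1), add_sub_cancel_right]; omega
  have e1 : spn (cornerSet side d₁ c) f₁ (fun a => -f₁ (M₁ a)) k = 0 := by omega
  have e2 : spn (cornerSet side d₂ c) f₂ (fun a => -f₂ (M₂ a)) k = 0 := by omega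
  have e3 : spn (onSide side c) f₁ f₂ k = 0 := by omega
  have e4 : spn (onSide side (c + 1)) (fun a => -f₂ a) (fun a => -f₁ a) k = 0 := by omega
  have hlow : ∀ a, Low side f₁ c k a ↔ Low side f₂ c k a := by
    intro a
    unfold Low
    refine or_congr (and_congr_right fun ha => ?_) (and_congr_right fun ha => ?_)
    · exact rk_le_iff_of_spn_eq_zero (h.t₁.injOn c) (h.t₂.injOn c) hn1 e3 (mem_onSide.2 ha)
    · exact (rk_le_iff_of_spn_eq_zero (neg_injOn (h.t₂.injOn (c + 1)))
        (neg_injOn (h.t₁.injOn (c + 1))) hn2 e4 (mem_onSide.2 ha)).symm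
  have hne : {a | Low side f₁ c k a}.Nonempty := by
    have := card_rk_le (h.t₁.injOn c) hn1
    obtain ⟨a, ha⟩ := Finset.card_pos.1 (by rw [this]; omega :
      0 < ((onSide side c).filter (fun a => rk (onSide side c) f₁ a ≤ k)).card)
    simp only [Finset.mem_filter, mem_onSide] at ha
    exact ⟨a, Or.inl ha⟩
  have huniv := h.trans _ hne (fun a ha => h.t₁.low_M hk e1 ha)
    (fun a ha => (hlow _).2 (h.t₂.low_M hk2 e2 ((hlow a).1 ha)))
  obtain ⟨a, ha⟩ := h.surj (c + 2)
  have : a ∈ {a | Low side f₁ c k a} := huniv ▸ Set.mem_univ a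
  have h3 : ∀ c : ZMod 3, c + 2 ≠ c := by decide
  have h4 : ∀ c : ZMod 3, c + 2 ≠ c + 1 := by decide
  rcases this with ⟨h1, _⟩ | ⟨h1, _⟩
  · exact h3 c (ha ▸ h1)
  · exact h4 c (ha ▸ h1)

/-- The part of the crossing count attributed to the corner `c`. -/
noncomputable def part (side : S → ZMod 3) (f₁ f₂ : S → ℤ) (d₁ d₂ : S → Prop) (M₁ M₂ : S → S)
    (c : ZMod 3) : ℕ :=
  ∑ k ∈ Finset.range ((cornerSet side d₁ c).card - 1),
    (spn (cornerSet side d₁ c) f₁ (fun a => -f₁ (M₁ a)) k +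
      spn (cornerSet side d₂ c) f₂ (fun a => -f₂ (M₂ a)) k +
      spn (onSide side c) f₁ f₂ k +
      spn (onSide side (c + 1)) (fun a => -f₂ a) (fun a => -f₁ a) k)

/-- The crossings on a side which separate its two corners. -/
noncomputable def mid (side : S → ZMod 3) (f₁ f₂ : S → ℤ) (d₁ : S → Prop) (c : ZMod 3) : ℕ :=
  if (cornerSet side d₁ c).card = 0 then 0
  else spn (onSide side c) f₁ f₂ ((cornerSet side d₁ c).card - 1)

lemma DblSys.side_split (h : DblSys side f₁ f₂ d₁ d₂ M₁ M₂) (c : ZMod 3) :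
    ∑ k ∈ Finset.range ((cornerSet side d₁ c).card - 1), spn (onSide side c) f₁ f₂ k +
      mid side f₁ f₂ d₁ c +
      ∑ k ∈ Finset.range ((cornerSet side d₁ (c - 1)).card - 1),
        spn (onSide side c) (fun a => -f₂ a) (fun a => -f₁ a) k ≤
      ∑ k ∈ Finset.range (onSide side c).card, spn (onSide side c) f₁ f₂ k := by
  set m := (cornerSet side d₁ c).card with hm
  set m' := (cornerSet side d₁ (c - 1)).card with hm'
  have hn : (onSide side c).card = m + m' := h.t₁.card_onSide c
  have e1 : ∑ k ∈ Finset.range (m - 1), spn (onSide side c) f₁ f₂ k + mid side f₁ f₂ d₁ c =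
      ∑ k ∈ Finset.range m, spn (onSide side c) f₁ f₂ k := by
    unfold mid
    rw [← hm]
    rcases Nat.eq_zero_or_pos m with h0 | h0
    · simp [h0]
    · obtain ⟨r, hr⟩ : ∃ r, m = r + 1 := ⟨m - 1, by omega⟩
      rw [hr, Finset.sum_range_succ]
      simp
  have e2 : ∑ k ∈ Finset.range (m' - 1),
        spn (onSide side c) (fun a => -f₂ a) (fun a => -f₁ a) k ≤
      ∑ k ∈ Finset.range m', spn (onSide side c) f₁ f₂ (m + k) := by
    rw [← Finset.sum_range_reflect]
    refine le_trans (le_of_eq (Finset.sum_congr rfl ?_))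
      (Finset.sum_le_sum_of_subset (Finset.range_subset_range.2 (Nat.sub_le m' 1)))
    intro k hk
    rw [Finset.mem_range] at hk
    rw [spn_neg (h.t₁.injOn c) (h.t₂.injOn c) (by omega)]
    congr 1
    omega
  rw [e1, hn, Finset.sum_range_add]
  omega

lemma DblSys.parts_le (h : DblSys side f₁ f₂ d₁ d₂ M₁ M₂) :
    ∑ c, (part side f₁ f₂ d₁ d₂ M₁ M₂ c + mid side f₁ f₂ d₁ c) ≤
      (sideCross side f₁ f₂).card + (cornerCross side f₁ d₁ M₁).card +
        (cornerCross side f₂ d₂ M₂).card := by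
  have hE := sum_sideCross_le (f₂ := f₂) h.t₁.injOn
  have hC1 := sum_cornerCross_le h.t₁
  have hC2 := sum_cornerCross_le h.t₂
  have hsplit := Finset.sum_le_sum (fun c (_ : c ∈ (Finset.univ : Finset (ZMod 3))) =>
    h.side_split c)
  have hx1 : ∑ c, ∑ k ∈ Finset.range ((cornerSet side d₁ c).card - 1),
        spn (cornerSet side d₁ c) f₁ (fun a => -f₁ (M₁ a)) k ≤
      ∑ c, ∑ k ∈ Finset.range (cornerSet side d₁ c).card,
        spn (cornerSet side d₁ c) f₁ (fun a => -f₁ (M₁ a)) k :=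
    Finset.sum_le_sum (fun c _ =>
      Finset.sum_le_sum_of_subset (Finset.range_subset_range.2 (Nat.sub_le _ 1)))
  have hx2 : ∑ c, ∑ k ∈ Finset.range ((cornerSet side d₁ c).card - 1),
        spn (cornerSet side d₂ c) f₂ (fun a => -f₂ (M₂ a)) k ≤
      ∑ c, ∑ k ∈ Finset.range (cornerSet side d₂ c).card,
        spn (cornerSet side d₂ c) f₂ (fun a => -f₂ (M₂ a)) k :=
    Finset.sum_le_sum (fun c _ => by
      rw [h.corner_card_eq]
      exact Finset.sum_le_sum_of_subset (Finset.range_subset_range.2 (Nat.sub_le _ 1)))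
  have hshift : ∑ c, ∑ k ∈ Finset.range ((cornerSet side d₁ (c - 1)).card - 1),
        spn (onSide side c) (fun a => -f₂ a) (fun a => -f₁ a) k =
      ∑ c, ∑ k ∈ Finset.range ((cornerSet side d₁ c).card - 1),
        spn (onSide side (c + 1)) (fun a => -f₂ a) (fun a => -f₁ a) k := by
    refine (Fintype.sum_equiv (Equiv.addRight (1 : ZMod 3)) _ _ (fun c => ?_)).symm
    simp only [Equiv.coe_addRight, add_sub_cancel_right]
  simp only [part, Finset.sum_add_distrib] at *
  omega

lemma DblSys.mid_add_mid (h : DblSys side f₁ f₂ d₁ d₂ M₁ M₂) {c : ZMod 3}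
    (hc : 0 < (cornerSet side d₁ c).card) :
    1 ≤ mid side f₁ f₂ d₁ c + mid side f₁ f₂ d₁ (c + 1) := by
  have h1 := h.one_le c (k := (cornerSet side d₁ c).card - 1) (by omega)
  rw [spn_eq_zero (V := cornerSet side d₁ c) (by omega), spn_eq_zero (V := cornerSet side d₂ c)
    (by rw [← h.corner_card_eq]; omega)] at h1
  have hn : (onSide side (c + 1)).card =
      (cornerSet side d₁ (c + 1)).card + (cornerSet side d₁ c).card := by
    rw [h.t₁.card_onSide (c + 1), add_sub_cancel_right]
  have h2 : mid side f₁ f₂ d₁ c =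
      spn (onSide side c) f₁ f₂ ((cornerSet side d₁ c).card - 1) := by
    rw [mid, if_neg (by omega)]
  rcases Nat.eq_zero_or_pos (cornerSet side d₁ (c + 1)).card with h0 | h0
  · rw [spn_eq_zero (V := onSide side (c + 1)) (by omega)] at h1
    omega
  · rw [spn_neg (h.t₁.injOn _) (h.t₂.injOn _) (by omega)] at h1
    have h3 : mid side f₁ f₂ d₁ (c + 1) =
        spn (onSide side (c + 1)) f₁ f₂ ((cornerSet side d₁ (c + 1)).card - 1) := by
      rw [mid, if_neg (by omega)]
    rw [h2, h3]
    rw [show (onSide side (c + 1)).card - 2 - ((cornerSet side d₁ c).card - 1) =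
      (cornerSet side d₁ (c + 1)).card - 1 by omega] at h1
    omega

lemma DblSys.le_part (h : DblSys side f₁ f₂ d₁ d₂ M₁ M₂) (c : ZMod 3) :
    (cornerSet side d₁ c).card - 1 ≤ part side f₁ f₂ d₁ d₂ M₁ M₂ c := by
  have : ∑ k ∈ Finset.range ((cornerSet side d₁ c).card - 1), 1 ≤
      part side f₁ f₂ d₁ d₂ M₁ M₂ c :=
    Finset.sum_le_sum (fun k hk => h.one_le c (by rw [Finset.mem_range] at hk; omega))
  simpa using this

lemma card_eq_sum_onSide (side : S → ZMod 3) : Fintype.card S = ∑ c, (onSide side c).card := by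
  rw [← Finset.card_univ, Finset.card_eq_sum_card_fiberwise (f := side)
    (t := (Finset.univ : Finset (ZMod 3))) (fun _ _ => Finset.mem_univ _)]
  rfl

lemma DblSys.onSide_pos (h : DblSys side f₁ f₂ d₁ d₂ M₁ M₂) (c : ZMod 3) :
    0 < (onSide side c).card := by
  obtain ⟨a, ha⟩ := h.surj c
  exact Finset.card_pos.2 ⟨a, mem_onSide.2 ha⟩

theorem DblSys.crossings_ge (h : DblSys side f₁ f₂ d₁ d₂ M₁ M₂) {l : ℕ}
    (hl : Fintype.card S = 2 * l) :
    l ≤ (sideCross side f₁ f₂).card + (cornerCross side f₁ d₁ M₁).card +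
        (cornerCross side f₂ d₂ M₂).card + 1 := by
  have hp := h.parts_le
  have hcard := card_eq_sum_onSide side
  rw [sum_zmod3] at hp hcard
  have a0 := h.t₁.card_onSide 0
  have a1 := h.t₁.card_onSide 1
  have a2 := h.t₁.card_onSide 2
  rw [show (0 - 1 : ZMod 3) = 2 by decide] at a0
  rw [show (1 - 1 : ZMod 3) = 0 by decide] at a1
  rw [show (2 - 1 : ZMod 3) = 1 by decide] at a2
  have p0 := h.onSide_pos 0
  have p1 := h.onSide_pos 1
  have p2 := h.onSide_pos 2
  have q0 := h.le_part 0
  have q1 := h.le_part 1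
  have q2 := h.le_part 2
  have r0 := h.mid_add_mid (c := 0)
  have r1 := h.mid_add_mid (c := 1)
  have r2 := h.mid_add_mid (c := 2)
  rw [show (0 + 1 : ZMod 3) = 1 by decide] at r0
  rw [show (1 + 1 : ZMod 3) = 2 by decide] at r1
  rw [show (2 + 1 : ZMod 3) = 0 by decide] at r2
  omega

omit [Fintype S] in
lemma even_card_of_involution {A : Finset S} (τ : S → S) (hmem : ∀ a ∈ A, τ a ∈ A)
    (hne : ∀ a, τ a ≠ a) (hinv : ∀ a, τ (τ a) = a) : Even A.card := by
  have : ∑ _a ∈ A, (1 : ZMod 2) = 0 :=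
    Finset.sum_involution (fun a _ => τ a) (fun _ _ => by decide) (fun a _ _ => hne a) hmem
      (fun a _ => hinv a)
  rw [Finset.sum_const, nsmul_eq_mul, mul_one] at this
  exact (ZMod.natCast_eq_zero_iff_even).1 this

/-- A symmetry exchanging the two sides of the pattern. -/
structure Flip (side : S → ZMod 3) (f₁ f₂ : S → ℤ) (d₁ d₂ : S → Prop) (M₁ M₂ : S → S)
    (τ : S → S) : Prop where
  invol : ∀ a, τ (τ a) = a
  ne : ∀ a, τ a ≠ a
  side_eq : ∀ a, side (τ a) = side a
  key : ∀ a, f₂ (τ a) = f₁ a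
  dir : ∀ a, d₂ (τ a) ↔ d₁ a
  corner : ∀ a, M₂ (τ a) = τ (M₁ a)

omit [Fintype S] in
lemma Flip.key' {τ : S → S} (ht : Flip side f₁ f₂ d₁ d₂ M₁ M₂ τ) (a : S) :
    f₁ (τ a) = f₂ a := by
  rw [← ht.key, ht.invol]

omit [Fintype S] in
lemma Flip.inj {τ : S → S} (ht : Flip side f₁ f₂ d₁ d₂ M₁ M₂ τ) : Function.Injective τ :=
  fun a b hab => by rw [← ht.invol a, hab, ht.invol]

lemma Flip.even_onSide {τ : S → S} (ht : Flip side f₁ f₂ d₁ d₂ M₁ M₂ τ) (c : ZMod 3) :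
    Even (onSide side c).card :=
  even_card_of_involution τ (fun a ha => by
    rw [mem_onSide] at ha ⊢
    rw [ht.side_eq, ha]) ht.ne ht.invol

omit [Fintype S] in
lemma rk_comp {V V' : Finset S} {f g : S → ℤ} {τ : S → S} (hτ : Function.Injective τ)
    (hV : V.image τ = V') (hfg : ∀ a, g (τ a) = f a) (a : S) : rk V' g (τ a) = rk V f a := by
  unfold rk
  rw [← Finset.card_image_of_injective (V.filter _) hτ, ← hV, Finset.filter_image]
  simp only [hfg]

lemma Flip.image_onSide {τ : S → S} (ht : Flip side f₁ f₂ d₁ d₂ M₁ M₂ τ) (c : ZMod 3) :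
    (onSide side c).image τ = onSide side c := by
  ext a
  simp only [Finset.mem_image, mem_onSide]
  constructor
  · rintro ⟨b, hb, rfl⟩
    rw [ht.side_eq, hb]
  · intro ha
    exact ⟨τ a, by rw [ht.side_eq, ha], ht.invol a⟩

lemma Flip.image_cornerSet {τ : S → S} (ht : Flip side f₁ f₂ d₁ d₂ M₁ M₂ τ) (c : ZMod 3) :
    (cornerSet side d₁ c).image τ = cornerSet side d₂ c := by
  ext a
  simp only [Finset.mem_image, mem_cornerSet]
  constructor
  · rintro ⟨b, hb, rfl⟩
    rw [ht.side_eq, ht.dir]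
    exact hb
  · intro ha
    refine ⟨τ a, ⟨by rw [ht.side_eq, ha.1], ?_⟩, ht.invol a⟩
    rw [← ht.dir, ht.invol]
    exact ha.2

lemma Flip.spn_parity {τ : S → S} (ht : Flip side f₁ f₂ d₁ d₂ M₁ M₂ τ) {c : ZMod 3}
    (hf : Set.InjOn f₁ (onSide side c)) {k : ℕ} (hk : k < (onSide side c).card) :
    spn (onSide side c) f₁ f₂ k % 2 = (k + 1) % 2 := by
  have h1 := card_rk_le hf hk
  rw [← Finset.card_filter_add_card_filter_not (fun a => k < rk (onSide side c) f₂ a),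
    Finset.filter_filter, Finset.filter_filter] at h1
  have h2 : Even ((onSide side c).filter (fun a => rk (onSide side c) f₁ a ≤ k ∧
      ¬ k < rk (onSide side c) f₂ a)).card := by
    refine even_card_of_involution τ (fun a ha => ?_) ht.ne ht.invol
    simp only [Finset.mem_filter, mem_onSide] at ha ⊢
    rw [ht.side_eq, rk_comp ht.inj (ht.image_onSide c) ht.key,
      rk_comp ht.inj (ht.image_onSide c) ht.key']
    exact ⟨ha.1, by omega, by omega⟩
  have h3 : spn (onSide side c) f₁ f₂ k = ((onSide side c).filter
      (fun a => rk (onSide side c) f₁ a ≤ k ∧ k < rk (onSide side c) f₂ a)).card := rfl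
  rw [Nat.even_iff] at h2
  omega

lemma Flip.spn_corner {τ : S → S} (ht : Flip side f₁ f₂ d₁ d₂ M₁ M₂ τ) (c : ZMod 3) (k : ℕ) :
    spn (cornerSet side d₂ c) f₂ (fun a => -f₂ (M₂ a)) k =
      spn (cornerSet side d₁ c) f₁ (fun a => -f₁ (M₁ a)) k := by
  unfold spn
  rw [← Finset.card_image_of_injective (Finset.filter _ (cornerSet side d₁ c)) ht.inj]
  conv_lhs => rw [← ht.image_cornerSet c, Finset.filter_image, ht.image_cornerSet c]
  congr 2
  refine Finset.filter_congr (fun a _ => ?_)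
  rw [rk_comp ht.inj (ht.image_cornerSet c) ht.key,
    rk_comp (g := fun a => -f₂ (M₂ a)) (f := fun a => -f₁ (M₁ a)) ht.inj (ht.image_cornerSet c)
      (fun a => by rw [ht.corner, ht.key])]

theorem DblSys.crossings_ge_of_flip (h : DblSys side f₁ f₂ d₁ d₂ M₁ M₂) {l : ℕ}
    (hl : Fintype.card S = 2 * l) (hodd : Odd l) {τ : S → S}
    (ht : Flip side f₁ f₂ d₁ d₂ M₁ M₂ τ) :
    2 * l ≤ (sideCross side f₁ f₂).card + (cornerCross side f₁ d₁ M₁).card +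
        (cornerCross side f₂ d₂ M₂).card + 3 := by
  have hp := h.parts_le
  have hcard := card_eq_sum_onSide side
  rw [sum_zmod3] at hp hcard
  have a0 := h.t₁.card_onSide 0
  have a1 := h.t₁.card_onSide 1
  have a2 := h.t₁.card_onSide 2
  rw [show (0 - 1 : ZMod 3) = 2 by decide] at a0
  rw [show (1 - 1 : ZMod 3) = 0 by decide] at a1
  rw [show (2 - 1 : ZMod 3) = 1 by decide] at a2
  have p0 := Nat.even_iff.1 (ht.even_onSide 0)
  have p1 := Nat.even_iff.1 (ht.even_onSide 1)
  have p2 := Nat.even_iff.1 (ht.even_onSide 2)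
  rw [Nat.odd_iff] at hodd
  have hm : ∀ c, (cornerSet side d₁ c).card % 2 = 1 := by
    intro c
    fin_cases c
    · show (cornerSet side d₁ 0).card % 2 = 1
      omega
    · show (cornerSet side d₁ 1).card % 2 = 1
      omega
    · show (cornerSet side d₁ 2).card % 2 = 1
      omega
  have hpart : ∀ c, 2 * ((cornerSet side d₁ c).card - 1) ≤ part side f₁ f₂ d₁ d₂ M₁ M₂ c := by
    intro c
    have : ∑ k ∈ Finset.range ((cornerSet side d₁ c).card - 1), 2 ≤
        part side f₁ f₂ d₁ d₂ M₁ M₂ c := by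
      refine Finset.sum_le_sum (fun k hk => ?_)
      rw [Finset.mem_range] at hk
      have h1 := h.one_le c (k := k) (by omega)
      rw [ht.spn_corner] at h1 ⊢
      have hn1 := h.t₁.card_onSide c
      have hn2 := h.t₁.card_onSide (c + 1)
      rw [add_sub_cancel_right] at hn2
      have hev := Nat.even_iff.1 (ht.even_onSide (c + 1))
      have y1 := ht.spn_parity (h.t₁.injOn c) (k := k) (by omega)
      have y2 := ht.spn_parity (h.t₁.injOn (c + 1)) (k := (onSide side (c + 1)).card - 2 - k)
        (by omega)
      rw [spn_neg (h.t₁.injOn _) (h.t₂.injOn _) (by omega)] at h1 ⊢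
      omega
    simpa [mul_comm] using this
  have hmid : ∀ c, 1 ≤ mid side f₁ f₂ d₁ c := by
    intro c
    have hmc := hm c
    rw [mid, if_neg (by omega)]
    have hn1 := h.t₁.card_onSide c
    have := ht.spn_parity (h.t₁.injOn c) (k := (cornerSet side d₁ c).card - 1) (by omega)
    omega
  have := hpart 0
  have := hpart 1
  have := hpart 2
  have := hmid 0
  have := hmid 1
  have := hmid 2
  have := hm 0
  have := hm 1
  have := hm 2
  omega

end

end Ranks

namespace Strip

/-- The cyclic direction of a step between two distinct sides. -/
def turn (a b : ZMod 3) : ℤ := if b = a + 1 then 1 else -1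

lemma turn_cases (a b : ZMod 3) : turn a b = 1 ∨ turn a b = -1 := by
  unfold turn; split_ifs <;> simp

lemma eq_of_turn_eq : ∀ {a b c : ZMod 3}, a ≠ b → a ≠ c → turn a b = turn a c → b = c := by
  decide

lemma turn_swap : ∀ {a b : ZMod 3}, a ≠ b → turn b a = -turn a b := by decide

lemma turn_neg_of_ne : ∀ {a b c : ZMod 3}, a ≠ b → a ≠ c → b ≠ c → turn a c = -turn a b := by
  decide

/-- The oriented digit of step `k` of the sequence `U`. -/
def dig (U : ℤ → ZMod 3) (k : ℕ) : ℤ := -(-1) ^ k * turn (U k) (U (k + 1))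

lemma dig_cases (U : ℤ → ZMod 3) (k : ℕ) : dig U k = 1 ∨ dig U k = -1 := by
  unfold dig
  rcases neg_one_pow_eq_or ℤ k with h | h <;> rcases turn_cases (U k) (U (k + 1)) with h' | h' <;>
    simp [h, h']

lemma dig_eq_iff {U V : ℤ → ZMod 3} {k : ℕ} :
    dig U k = dig V k ↔ turn (U k) (U (k + 1)) = turn (V k) (V (k + 1)) := by
  unfold dig
  rcases neg_one_pow_eq_or ℤ k with h | h <;> simp [h]

lemma agree_of_dig {U V : ℤ → ZMod 3} (hU : ∀ k : ℕ, U k ≠ U (k + 1))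
    (hV : ∀ k : ℕ, V k ≠ V (k + 1)) (h0 : U 0 = V 0) {n : ℕ}
    (h : ∀ k < n, dig U k = dig V k) : ∀ k : ℕ, k ≤ n → U k = V k := by
  intro k
  induction k with
  | zero => intro _; simpa using h0
  | succ k ih =>
    intro hk
    have h1 := ih (by omega)
    have h2 := dig_eq_iff.1 (h k (by omega))
    rw [h1] at h2
    have := eq_of_turn_eq (h1 ▸ hU k) (hV k) h2
    push_cast
    exact this

/-- A reduced sequence with least even period `N` in which all sides occur. -/
structure PerSeq (s : ℤ → ZMod 3) (N : ℕ) : Prop where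
  pos : 0 < N
  even : Even N
  per : ∀ i, s (i + N) = s i
  red : ∀ i, s i ≠ s (i + 1)
  minimal : ∀ m : ℤ, Even m → (∀ i, s (i + m) = s i) → (N : ℤ) ∣ m
  surj : Function.Surjective s

/-- The sequence of sides seen from slot `i`, read towards the positive side. -/
def W (s : ℤ → ZMod 3) (i k : ℤ) : ZMod 3 := if Even i then s (i - k) else s (i + k)

/-- The digits of the view from slot `i` on the positive side. -/
def Fp (s : ℤ → ZMod 3) (i : ℤ) (k : ℕ) : ℤ := dig (W s i) k

/-- The digits of the view from slot `i` on the negative side. -/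
def Fm (s : ℤ → ZMod 3) (i : ℤ) (k : ℕ) : ℤ := dig (fun j => W s i (-j)) k

/-- The neighbouring slot on the positive side. -/
def mp (i : ℤ) : ℤ := if Even i then i - 1 else i + 1

/-- The neighbouring slot on the negative side. -/
def mm (i : ℤ) : ℤ := if Even i then i + 1 else i - 1

lemma even_mp (i : ℤ) : Even (mp i) ↔ ¬ Even i := by
  unfold mp; split_ifs with h <;> simp [h, parity_simps, Int.not_even_iff_odd.1]

lemma even_mm (i : ℤ) : Even (mm i) ↔ ¬ Even i := by
  unfold mm; split_ifs with h <;> simp [h, parity_simps, Int.not_even_iff_odd.1]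

lemma mp_mp (i : ℤ) : mp (mp i) = i := by
  have h := even_mp i
  by_cases hi : Even i
  · rw [mp, if_neg (by simp [h, hi]), mp, if_pos hi]; ring
  · rw [mp, if_pos (by simp [h, hi]), mp, if_neg hi]; ring

lemma mm_mm (i : ℤ) : mm (mm i) = i := by
  have h := even_mm i
  by_cases hi : Even i
  · rw [mm, if_neg (by simp [h, hi]), mm, if_pos hi]; ring
  · rw [mm, if_pos (by simp [h, hi]), mm, if_neg hi]; ring

variable {s : ℤ → ZMod 3} {N : ℕ}

@[simp] lemma W_zero (i : ℤ) : W s i 0 = s i := by simp [W]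

lemma W_mp (i k : ℤ) : W s (mp i) k = W s i (1 - k) := by
  have h := even_mp i
  unfold W
  by_cases hi : Even i
  · rw [if_neg (by simp [h, hi]), if_pos hi, mp, if_pos hi]; congr 1; ring
  · rw [if_pos (by simp [h, hi]), if_neg hi, mp, if_neg hi]; congr 1; ring

lemma W_mm (i k : ℤ) : W s (mm i) k = W s i (-1 - k) := by
  have h := even_mm i
  unfold W
  by_cases hi : Even i
  · rw [if_neg (by simp [h, hi]), if_pos hi, mm, if_pos hi]; congr 1; ring
  · rw [if_pos (by simp [h, hi]), if_neg hi, mm, if_neg hi]; congr 1; ring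

namespace PerSeq

variable (h : PerSeq s N)

include h

lemma W_red (i k : ℤ) : W s i k ≠ W s i (k + 1) := by
  unfold W
  split_ifs
  · have := h.red (i - (k + 1))
    rw [show i - (k + 1) + 1 = i - k by ring] at this
    exact this.symm
  · rw [← add_assoc]
    exact h.red _

lemma W_red' (i k : ℤ) : W s i (-k) ≠ W s i (-(k + 1)) := by
  have := h.W_red i (-(k + 1))
  rw [show -(k + 1) + 1 = -k by ring] at this
  exact this.symm

lemma Fp_mp_zero (i : ℤ) : Fp s (mp i) 0 = -Fp s i 0 := by
  have := turn_swap (h.W_red i 0)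
  simp only [Fp, dig, W_mp]
  norm_num at this ⊢
  rw [this, neg_neg]

omit h in
lemma Fp_mp_succ (i : ℤ) (k : ℕ) : Fp s (mp i) (k + 1) = -Fm s i k := by
  simp only [Fp, Fm, dig, W_mp]
  push_cast
  rw [show (1 : ℤ) - (k + 1) = -k by ring, show (1 : ℤ) - (k + 1 + 1) = -(k + 1) by ring]
  ring

omit h in
lemma Fm_mp (i : ℤ) (k : ℕ) : Fm s (mp i) k = -Fp s i (k + 1) := by
  simp only [Fp, Fm, dig, W_mp]
  push_cast
  rw [show (1 : ℤ) - -(k : ℤ) = k + 1 by ring, show (1 : ℤ) - -((k : ℤ) + 1) = k + 1 + 1 by ring]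
  ring

lemma Fm_mm_zero (i : ℤ) : Fm s (mm i) 0 = -Fm s i 0 := by
  have := turn_swap (h.W_red' i 0)
  simp only [Fm, dig, W_mm]
  norm_num at this ⊢
  rw [this, neg_neg]

omit h in
lemma Fm_mm_succ (i : ℤ) (k : ℕ) : Fm s (mm i) (k + 1) = -Fp s i k := by
  simp only [Fp, Fm, dig, W_mm]
  push_cast
  rw [show (-1 : ℤ) - -((k : ℤ) + 1) = k by ring, show (-1 : ℤ) - -((k : ℤ) + 1 + 1) = k + 1 by ring]
  ring

omit h in
lemma Fp_mm (i : ℤ) (k : ℕ) : Fp s (mm i) k = -Fm s i (k + 1) := by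
  simp only [Fp, Fm, dig, W_mm]
  push_cast
  rw [show (-1 : ℤ) - (k : ℤ) = -(k + 1) by ring, show (-1 : ℤ) - ((k : ℤ) + 1) = -(k + 1 + 1) by ring]
  ring

omit h in
lemma Fp_cases (i : ℤ) (k : ℕ) : Fp s i k = 1 ∨ Fp s i k = -1 := dig_cases _ _

omit h in
lemma Fm_cases (i : ℤ) (k : ℕ) : Fm s i k = 1 ∨ Fm s i k = -1 := dig_cases _ _

lemma agree {i j : ℤ} (h0 : s i = s j) {b f : ℕ} (hf : ∀ k < f, Fp s i k = Fp s j k)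
    (hb : ∀ k < b, Fm s i k = Fm s j k) {k : ℤ} (hk : -(b : ℤ) ≤ k) (hk' : k ≤ f) :
    W s i k = W s j k := by
  rcases le_total 0 k with h1 | h1
  · lift k to ℕ using h1
    exact agree_of_dig (fun k => h.W_red i k) (fun k => h.W_red j k) (by simpa using h0) hf k
      (by exact_mod_cast hk')
  · obtain ⟨m, hm⟩ : ∃ m : ℕ, k = -(m : ℤ) := ⟨k.natAbs, by omega⟩
    subst hm
    exact agree_of_dig (U := fun j => W s i (-j)) (V := fun k => W s j (-k))
      (fun k => h.W_red' i k) (fun k => h.W_red' j k) (by simpa using h0) hb m (by omega)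

lemma eq_mod_of_W_eq {i j : ℤ} (hW : ∀ k, W s i k = W s j k) : (N : ℤ) ∣ i - j := by
  by_cases hi : Even i <;> by_cases hj : Even j
  · apply h.minimal _ (hi.sub hj)
    intro k
    have := hW (j - k)
    rw [W, W, if_pos hi, if_pos hj] at this
    rw [show k + (i - j) = i - (j - k) by ring, this]
    congr 1; ring
  · exfalso
    obtain ⟨a, ha⟩ := hi
    obtain ⟨b, hb⟩ := Int.not_even_iff_odd.1 hj
    have := hW (a - b - 1)
    rw [W, W, if_pos ⟨a, ha⟩, if_neg hj, ha, hb] at this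
    apply h.red (a + b)
    rw [show a + a - (a - b - 1) = a + b + 1 by ring,
      show 2 * b + 1 + (a - b - 1) = a + b by ring] at this
    exact this.symm
  · exfalso
    obtain ⟨a, ha⟩ := hj
    obtain ⟨b, hb⟩ := Int.not_even_iff_odd.1 hi
    have := hW (a - b - 1)
    rw [W, W, if_neg hi, if_pos ⟨a, ha⟩, ha, hb] at this
    apply h.red (a + b)
    rw [show a + a - (a - b - 1) = a + b + 1 by ring,
      show 2 * b + 1 + (a - b - 1) = a + b by ring] at this
    exact this
  · apply h.minimal
    · rw [Int.not_even_iff_odd] at hi hj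
      exact hi.sub_odd hj
    intro k
    have := hW (k - j)
    rw [W, W, if_neg hi, if_neg hj] at this
    rw [show k + (i - j) = i + (k - j) by ring, this]
    congr 1; ring

end PerSeq

/-- The ordering key along a side, with the positive side dominant. -/
def key₁ (s : ℤ → ZMod 3) (i : ℤ) : Lex (ℕ → ℤ) := toLex (fun k => 3 * Fp s i k + Fm s i k)

/-- The ordering key along a side, with the negative side dominant. -/
def key₂ (s : ℤ → ZMod 3) (i : ℤ) : Lex (ℕ → ℤ) := toLex (fun k => 3 * Fm s i k + Fp s i k)

/-- The views from slots `i` and `j` agree exactly on `[-b, f]`, and the two strips cross. -/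
structure Conf (s : ℤ → ZMod 3) (i j : ℤ) (b f : ℕ) : Prop where
  agree : ∀ k : ℤ, -(b : ℤ) ≤ k → k ≤ f → W s i k = W s j k
  ne_f : W s i (f + 1) ≠ W s j (f + 1)
  ne_b : W s i (-(b + 1)) ≠ W s j (-(b + 1))
  sign : Fp s i f * Fm s i b = -1

lemma lex_lt {a b : Lex (ℕ → ℤ)} (hab : a < b) :
    ∃ k, (∀ j < k, ofLex a j = ofLex b j) ∧ ofLex a k < ofLex b k := hab

lemma lex_side {p p' m m' : ℕ → ℤ} (hp : ∀ k, p k = 1 ∨ p k = -1)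
    (hp' : ∀ k, p' k = 1 ∨ p' k = -1) (hm : ∀ k, m k = 1 ∨ m k = -1)
    (hm' : ∀ k, m' k = 1 ∨ m' k = -1)
    (h1 : toLex (fun k => 3 * p k + m k) < toLex (fun k => 3 * p' k + m' k))
    (h2 : toLex (fun k => 3 * m' k + p' k) < toLex (fun k => 3 * m k + p k)) :
    ∃ k, (∀ j < k, p j = p' j ∧ m j = m' j) ∧ p k < p' k ∧ m' k < m k := by
  obtain ⟨k, hk, hk'⟩ := lex_lt h1
  obtain ⟨l, hl, hl'⟩ := lex_lt h2
  simp only [ofLex_toLex] at hk hk' hl hl'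
  have a1 := hp k
  have a2 := hp' k
  have a3 := hm k
  have a4 := hm' k
  have b1 := hp l
  have b2 := hp' l
  have b3 := hm l
  have b4 := hm' l
  have hkl : k = l := by
    rcases lt_trichotomy k l with h | h | h
    · have := hl k h; omega
    · exact h
    · have := hk l h; omega
  subst hkl
  refine ⟨k, fun j hj => ?_, by omega, by omega⟩
  have := hk j hj
  have := hp j
  have := hp' j
  have := hm j
  have := hm' j
  omega

lemma lex_corner {p p' m m' q q' n n' : ℕ → ℤ} (hp : ∀ k, p k = 1 ∨ p k = -1)
    (hp' : ∀ k, p' k = 1 ∨ p' k = -1) (hm : ∀ k, m k = 1 ∨ m k = -1)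
    (hm' : ∀ k, m' k = 1 ∨ m' k = -1) (h0 : p 0 = p' 0)
    (hq0 : q 0 = -p 0) (hq0' : q' 0 = -p' 0) (hq : ∀ k, q (k + 1) = -m k)
    (hq' : ∀ k, q' (k + 1) = -m' k) (hn : ∀ k, n k = -p (k + 1)) (hn' : ∀ k, n' k = -p' (k + 1))
    (h1 : toLex (fun k => 3 * p k + m k) < toLex (fun k => 3 * p' k + m' k))
    (h2 : toLex (fun k => 3 * q k + n k) < toLex (fun k => 3 * q' k + n' k)) :
    ∃ k, (∀ j < k + 1, p j = p' j) ∧ (∀ j < k, m j = m' j) ∧ p' (k + 1) < p (k + 1) ∧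
      m k < m' k := by
  obtain ⟨k, hk, hk'⟩ := lex_lt h1
  obtain ⟨l, hl, hl'⟩ := lex_lt h2
  simp only [ofLex_toLex] at hk hk' hl hl'
  have agr : ∀ j < k, p j = p' j ∧ m j = m' j := by
    intro j hj
    have := hk j hj
    have := hp j
    have := hp' j
    have := hm j
    have := hm' j
    omega
  have agr2 : ∀ j, j < l + 1 → p j = p' j := by
    intro j hj
    rcases j with _ | j
    · exact h0
    · have e := hl j (by omega)
      rw [hn, hn'] at e
      have := hp (j + 1)
      have := hp' (j + 1)
      rcases j with _ | j
      · rw [hq0, hq0'] at e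
        omega
      · rw [hq, hq'] at e
        have := hm j
        have := hm' j
        omega
  have agr3 : ∀ j, j + 1 < l → m j = m' j := by
    intro j hj
    have e := hl (j + 1) (by omega)
    rw [hn, hn', hq, hq'] at e
    have := hp (j + 1 + 1)
    have := hp' (j + 1 + 1)
    have := hm j
    have := hm' j
    omega
  have a1 := hp k
  have a2 := hp' k
  have a3 := hm k
  have a4 := hm' k
  have b1 := hp (l + 1)
  have b2 := hp' (l + 1)
  rw [hn, hn'] at hl'
  have key : p' (l + 1) < p (l + 1) ∧ l ≤ k := by
    rcases l with _ | l
    · rw [hq0, hq0'] at hl'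
      exact ⟨by omega, by omega⟩
    · rw [hq, hq'] at hl'
      have c3 := hm l
      have c4 := hm' l
      rcases lt_trichotomy k l with h | h | h
      · have := agr2 k (by omega)
        have := agr3 k (by omega)
        omega
      · subst h
        have := agr2 k (by omega)
        omega
      · have := agr l h
        exact ⟨by omega, by omega⟩
  have hkl : k = l := by
    rcases lt_trichotomy k (l + 1) with h | h | h
    · omega
    · subst h
      omega
    · have := agr (l + 1) h
      omega
  subst hkl
  have := agr2 k (by omega)
  exact ⟨k, agr2, fun j hj => (agr j hj).2, key.1, by omega⟩

namespace PerSeq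

variable (h : PerSeq s N)

include h

omit h in
lemma ne_of_dig_ne {i j : ℤ} {f : ℕ} (ha : W s i f = W s j f) (hd : Fp s i f ≠ Fp s j f) :
    W s i (f + 1) ≠ W s j (f + 1) := by
  intro hne
  apply hd
  rw [Fp, Fp, dig_eq_iff, ha, hne]

omit h in
lemma ne_of_dig_ne' {i j : ℤ} {b : ℕ} (ha : W s i (-b) = W s j (-b)) (hd : Fm s i b ≠ Fm s j b) :
    W s i (-(b + 1)) ≠ W s j (-(b + 1)) := by
  intro hne
  apply hd
  rw [Fm, Fm, dig_eq_iff]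
  simp only [ha, hne]

lemma conf_mk {i j : ℤ} {b f : ℕ} (h0 : s i = s j) (hf : ∀ k < f, Fp s i k = Fp s j k)
    (hb : ∀ k < b, Fm s i k = Fm s j k) (hfd : Fp s i f ≠ Fp s j f) (hbd : Fm s i b ≠ Fm s j b)
    (hs : Fp s i f * Fm s i b = -1) : Conf s i j b f where
  agree := fun k hk hk' => h.agree h0 hf hb hk hk'
  ne_f := ne_of_dig_ne (h.agree h0 hf hb (by omega) le_rfl) hfd
  ne_b := ne_of_dig_ne' (h.agree h0 hf hb le_rfl (by omega)) hbd
  sign := hs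

lemma conf_symm {i j : ℤ} {b f : ℕ} (hc : Conf s i j b f) : Conf s j i b f where
  agree := fun k hk hk' => (hc.agree k hk hk').symm
  ne_f := hc.ne_f.symm
  ne_b := hc.ne_b.symm
  sign := by
    have h1 : Fp s j f = -Fp s i f := by
      have e := hc.agree f (by omega) le_rfl
      have := turn_neg_of_ne (h.W_red i f) (e ▸ h.W_red j f) hc.ne_f
      rw [Fp, Fp, dig, dig, ← e, this]; ring
    have h2 : Fm s j b = -Fm s i b := by
      have e := hc.agree (-b) le_rfl (by omega)
      have := turn_neg_of_ne (h.W_red' i b) (e ▸ h.W_red' j b) hc.ne_b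
      rw [Fm, Fm, dig, dig, ← e, this]; ring
    rw [h1, h2, neg_mul_neg, hc.sign]

omit h in
lemma conf_unique {i j : ℤ} {b f b' f' : ℕ} (hc : Conf s i j b f) (hc' : Conf s i j b' f') :
    b = b' ∧ f = f' := by
  constructor
  · rcases lt_trichotomy b b' with hl | hl | hl
    · exact absurd (hc'.agree (-(b + 1)) (by omega) (by omega)) hc.ne_b
    · exact hl
    · exact absurd (hc.agree (-(b' + 1)) (by omega) (by omega)) hc'.ne_b
  · rcases lt_trichotomy f f' with hl | hl | hl
    · exact absurd (hc'.agree (f + 1) (by omega) (by omega)) hc.ne_f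
    · exact hl
    · exact absurd (hc.agree (f' + 1) (by omega) (by omega)) hc'.ne_f

lemma conf_of_side {i j : ℤ} (h0 : s i = s j) (h1 : key₁ s i < key₁ s j)
    (h2 : key₂ s j < key₂ s i) : ∃ k, Conf s i j k k := by
  obtain ⟨k, hk, hp, hm⟩ := lex_side (Fp_cases i) (Fp_cases j) (Fm_cases i) (Fm_cases j) h1 h2
  refine ⟨k, h.conf_mk h0 (fun j hj => (hk j hj).1) (fun j hj => (hk j hj).2) hp.ne hm.ne' ?_⟩
  have a1 := Fp_cases (s := s) i k
  have a2 := Fp_cases (s := s) j k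
  have a3 := Fm_cases (s := s) i k
  have a4 := Fm_cases (s := s) j k
  rw [show Fp s i k = -1 by omega, show Fm s i k = 1 by omega]; norm_num

lemma conf_of_corner₁ {i j : ℤ} (h0 : s i = s j) (hd : Fp s i 0 = Fp s j 0)
    (h1 : key₁ s i < key₁ s j) (h2 : key₁ s (mp i) < key₁ s (mp j)) :
    ∃ k, Conf s i j k (k + 1) := by
  obtain ⟨k, hk, hk', hp, hm⟩ := lex_corner (Fp_cases i) (Fp_cases j) (Fm_cases i) (Fm_cases j)
    hd (h.Fp_mp_zero i) (h.Fp_mp_zero j) (Fp_mp_succ i) (Fp_mp_succ j) (Fm_mp i) (Fm_mp j)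
    h1 h2
  refine ⟨k, h.conf_mk h0 hk hk' hp.ne' hm.ne ?_⟩
  have a1 := Fp_cases (s := s) i (k + 1)
  have a2 := Fp_cases (s := s) j (k + 1)
  have a3 := Fm_cases (s := s) i k
  have a4 := Fm_cases (s := s) j k
  rw [show Fp s i (k + 1) = 1 by omega, show Fm s i k = -1 by omega]; norm_num

lemma conf_of_corner₂ {i j : ℤ} (h0 : s i = s j) (hd : Fm s i 0 = Fm s j 0)
    (h1 : key₂ s i < key₂ s j) (h2 : key₂ s (mm i) < key₂ s (mm j)) :
    ∃ k, Conf s i j (k + 1) k := by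
  obtain ⟨k, hk, hk', hp, hm⟩ := lex_corner (Fm_cases i) (Fm_cases j) (Fp_cases i) (Fp_cases j)
    hd (h.Fm_mm_zero i) (h.Fm_mm_zero j) (Fm_mm_succ i) (Fm_mm_succ j) (Fp_mm i) (Fp_mm j)
    h1 h2
  refine ⟨k, h.conf_mk h0 hk' hk hm.ne hp.ne' ?_⟩
  have a1 := Fm_cases (s := s) i (k + 1)
  have a2 := Fm_cases (s := s) j (k + 1)
  have a3 := Fp_cases (s := s) i k
  have a4 := Fp_cases (s := s) j k
  rw [show Fm s i (k + 1) = 1 by omega, show Fp s i k = -1 by omega]; norm_num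

end PerSeq

end Strip

namespace Strip

open Ranks

/-- The representative of a residue class. -/
def rep {N : ℕ} (a : ZMod N) : ℤ := (a.val : ℤ)

lemma rep_cast {N : ℕ} [NeZero N] (a : ZMod N) : ((rep a : ℤ) : ZMod N) = a := by
  simp [rep]

lemma dvd_rep_cast {N : ℕ} [NeZero N] (i : ℤ) : (N : ℤ) ∣ rep ((i : ℤ) : ZMod N) - i := by
  rw [← ZMod.intCast_eq_intCast_iff_dvd_sub, rep_cast]

lemma eq_of_dvd_rep {N : ℕ} [NeZero N] {a b : ZMod N} (h : (N : ℤ) ∣ rep a - rep b) : a = b := by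
  rw [← ZMod.intCast_eq_intCast_iff_dvd_sub, rep_cast, rep_cast] at h
  exact h.symm

/-- The integer rank of a slot for a key. -/
noncomputable def rankOf {N : ℕ} [NeZero N] {L : Type*} [LinearOrder L] (key : ℤ → L)
    (a : ZMod N) : ℤ :=
  ((Finset.univ.filter (fun b : ZMod N => key (rep b) < key (rep a))).card : ℤ)

lemma rankOf_lt {N : ℕ} [NeZero N] {L : Type*} [LinearOrder L] {key : ℤ → L} {a b : ZMod N} :
    rankOf key a < rankOf key b ↔ key (rep a) < key (rep b) := by
  have hle : ∀ {a b : ZMod N}, key (rep a) ≤ key (rep b) → rankOf key a ≤ rankOf key b := by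
    intro a b hab
    unfold rankOf
    exact_mod_cast Finset.card_le_card (Finset.monotone_filter_right _
      (fun c _ hc => lt_of_lt_of_le hc hab))
  constructor
  · intro h
    by_contra hn
    exact absurd (hle (not_lt.1 hn)) (not_le.2 h)
  · intro h
    unfold rankOf
    have : (Finset.univ.filter (fun c : ZMod N => key (rep c) < key (rep a))).card <
        (Finset.univ.filter (fun c : ZMod N => key (rep c) < key (rep b))).card := by
      apply Finset.card_lt_card
      refine ⟨Finset.monotone_filter_right _ (fun c _ hc => hc.trans h), fun hs => ?_⟩
      have : a ∈ Finset.univ.filter (fun c : ZMod N => key (rep c) < key (rep a)) :=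
        hs (by simp [h])
      simp at this
    exact_mod_cast this

lemma key_eq_of_rankOf_eq {N : ℕ} [NeZero N] {L : Type*} [LinearOrder L] {key : ℤ → L}
    {a b : ZMod N} (h : rankOf key a = rankOf key b) : key (rep a) = key (rep b) := by
  rcases lt_trichotomy (key (rep a)) (key (rep b)) with h' | h' | h'
  · exact absurd h (rankOf_lt.2 h').ne
  · exact h'
  · exact absurd h (rankOf_lt.2 h').ne'

lemma triSys_mk {N : ℕ} [NeZero N] {L : Type*} [LinearOrder L] {s : ℤ → ZMod 3} {key : ℤ → L}
    {d : ℤ → Prop} {m : ℤ → ℤ}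
    (hs : ∀ i j, (N : ℤ) ∣ i - j → s i = s j)
    (hd : ∀ i j, (N : ℤ) ∣ i - j → (d i ↔ d j))
    (hm : ∀ i j, (N : ℤ) ∣ i - j → (N : ℤ) ∣ m i - m j)
    (inj : ∀ i j, s i = s j → key i = key j → (N : ℤ) ∣ i - j)
    (mono : ∀ i j, s i = s j → d i → ¬ d j → key i < key j)
    (invol : ∀ i, m (m i) = i)
    (up : ∀ i, d i → s (m i) = s i + 1 ∧ ¬ d (m i))
    (down : ∀ i, ¬ d i → s (m i) = s i - 1 ∧ d (m i)) :
    TriSys (fun a : ZMod N => s (rep a)) (rankOf key) (fun a => d (rep a))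
      (fun a => ((m (rep a) : ℤ) : ZMod N)) where
  inj a b h1 h2 := eq_of_dvd_rep (inj _ _ h1 (key_eq_of_rankOf_eq h2))
  mono a b h1 h2 h3 := rankOf_lt.2 (mono _ _ h1 h2 h3)
  invol a := by
    have h1 := hm _ _ (dvd_rep_cast (N := N) (m (rep a)))
    rw [invol, ← ZMod.intCast_eq_intCast_iff_dvd_sub, rep_cast] at h1
    exact h1.symm
  up a ha := by
    have h1 := dvd_rep_cast (N := N) (m (rep a))
    simp only [hs _ _ h1, hd _ _ h1]
    exact up _ ha
  down a ha := by
    have h1 := dvd_rep_cast (N := N) (m (rep a))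
    simp only [hs _ _ h1, hd _ _ h1]
    exact down _ ha

variable {s : ℤ → ZMod 3} {N : ℕ}

lemma sub_one_of_turn {a b : ZMod 3} (hab : a ≠ b) (h : turn a b ≠ 1) : b = a - 1 := by
  revert hab h; revert a b; decide

lemma add_one_of_turn {a b : ZMod 3} (h : turn a b = 1) : b = a + 1 := by
  revert h; revert a b; decide

namespace PerSeq

lemma per_mul (h : PerSeq s N) (i t : ℤ) : s (i + N * t) = s i := by
  induction t with
  | zero => simp
  | succ t ih =>
    rw [show i + N * ((t : ℤ) + 1) = i + N * t + N by ring, h.per, ih]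
  | pred t ih =>
    rw [← ih, ← h.per (i + N * (-(t : ℤ) - 1))]
    congr 1; ring

lemma s_congr (h : PerSeq s N) {i j : ℤ} (hd : (N : ℤ) ∣ i - j) : s i = s j := by
  obtain ⟨t, ht⟩ := hd
  rw [show i = j + N * t by linarith, h.per_mul]

lemma even_congr (h : PerSeq s N) {i j : ℤ} (hd : (N : ℤ) ∣ i - j) : Even i ↔ Even j := by
  have : (2 : ℤ) ∣ i - j := dvd_trans (by exact_mod_cast h.even.two_dvd) hd
  rw [← Int.even_sub]
  exact even_iff_two_dvd.2 this

lemma W_congr (h : PerSeq s N) {i j : ℤ} (hd : (N : ℤ) ∣ i - j) : W s i = W s j := by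
  funext k
  unfold W
  have he := h.even_congr hd
  by_cases hi : Even i
  · rw [if_pos hi, if_pos (he.1 hi)]
    exact h.s_congr (by rwa [sub_sub_sub_cancel_right])
  · rw [if_neg hi, if_neg (mt he.2 hi)]
    exact h.s_congr (by rwa [add_sub_add_right_eq_sub])

lemma mp_congr (h : PerSeq s N) {i j : ℤ} (hd : (N : ℤ) ∣ i - j) : (N : ℤ) ∣ mp i - mp j := by
  unfold mp
  have he := h.even_congr hd
  by_cases hi : Even i
  · rwa [if_pos hi, if_pos (he.1 hi), sub_sub_sub_cancel_right]
  · rwa [if_neg hi, if_neg (mt he.2 hi), add_sub_add_right_eq_sub]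

lemma mm_congr (h : PerSeq s N) {i j : ℤ} (hd : (N : ℤ) ∣ i - j) : (N : ℤ) ∣ mm i - mm j := by
  unfold mm
  have he := h.even_congr hd
  by_cases hi : Even i
  · rwa [if_pos hi, if_pos (he.1 hi), add_sub_add_right_eq_sub]
  · rwa [if_neg hi, if_neg (mt he.2 hi), sub_sub_sub_cancel_right]

lemma Fp_congr {i j : ℤ} (hw : W s i = W s j) : Fp s i = Fp s j := by
  unfold Fp; rw [hw]

lemma Fm_congr {i j : ℤ} (hw : W s i = W s j) : Fm s i = Fm s j := by
  unfold Fm; rw [hw]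

lemma key₁_congr {i j : ℤ} (hw : W s i = W s j) : key₁ s i = key₁ s j := by
  unfold key₁; rw [Fp_congr hw, Fm_congr hw]

lemma key₂_congr {i j : ℤ} (hw : W s i = W s j) : key₂ s i = key₂ s j := by
  unfold key₂; rw [Fp_congr hw, Fm_congr hw]

lemma dvd_of_digits (h : PerSeq s N) {i j : ℤ} (h0 : s i = s j)
    (hF : ∀ k, Fp s i k = Fp s j k ∧ Fm s i k = Fm s j k) : (N : ℤ) ∣ i - j :=
  h.eq_mod_of_W_eq (fun k => h.agree h0 (b := k.natAbs) (f := k.natAbs) (fun k _ => (hF k).1)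
    (fun k _ => (hF k).2) (by omega) (by omega))

/-- The slot on the positive side. -/
def M₁ (a : ZMod N) : ZMod N := ((mp (rep a) : ℤ) : ZMod N)

/-- The slot on the negative side. -/
def M₂ (a : ZMod N) : ZMod N := ((mm (rep a) : ℤ) : ZMod N)

lemma lex_of_first {a b : Lex (ℕ → ℤ)} (h : ofLex a 0 < ofLex b 0) : a < b :=
  ⟨0, fun j hj => absurd hj (Nat.not_lt_zero j), h⟩

lemma triSys₁ (h : PerSeq s N) [NeZero N] :
    TriSys (fun a : ZMod N => s (rep a)) (rankOf (key₁ s)) (fun a => Fp s (rep a) 0 = -1) M₁ := by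
  refine triSys_mk (d := fun i => Fp s i 0 = -1) (m := mp) (fun i j hd => h.s_congr hd)
    (fun i j hd => ?_) (fun i j hd => h.mp_congr hd) ?_ ?_ mp_mp ?_ ?_
  · simp only [Fp_congr (h.W_congr hd)]
  · intro i j h0 hk
    refine h.dvd_of_digits h0 (fun k => ?_)
    have e : 3 * Fp s i k + Fm s i k = 3 * Fp s j k + Fm s j k := congrFun (congrArg ofLex hk) k
    have := Fp_cases (s := s) i k
    have := Fp_cases (s := s) j k
    have := Fm_cases (s := s) i k
    have := Fm_cases (s := s) j k
    omega
  · intro i j _ hi hj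
    apply lex_of_first
    simp only [key₁, ofLex_toLex]
    have := Fp_cases (s := s) j 0
    have := Fm_cases (s := s) i 0
    have := Fm_cases (s := s) j 0
    omega
  · intro i hi
    refine ⟨?_, by rw [h.Fp_mp_zero, hi]; decide⟩
    rw [← W_zero (s := s) (mp i), W_mp, sub_zero]
    apply add_one_of_turn
    simpa [Fp, dig] using hi
  · intro i hi
    have hi' : Fp s i 0 = 1 := (Fp_cases i 0).resolve_right hi
    refine ⟨?_, by rw [h.Fp_mp_zero, hi']⟩
    rw [← W_zero (s := s) (mp i), W_mp, sub_zero]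
    have := h.W_red i 0
    rw [W_zero, zero_add] at this
    apply sub_one_of_turn this
    simpa [Fp, dig] using hi

lemma triSys₂ (h : PerSeq s N) [NeZero N] :
    TriSys (fun a : ZMod N => s (rep a)) (rankOf (key₂ s)) (fun a => Fm s (rep a) 0 = -1) M₂ := by
  refine triSys_mk (d := fun i => Fm s i 0 = -1) (m := mm) (fun i j hd => h.s_congr hd)
    (fun i j hd => ?_) (fun i j hd => h.mm_congr hd) ?_ ?_ mm_mm ?_ ?_
  · simp only [Fm_congr (h.W_congr hd)]
  · intro i j h0 hk
    refine h.dvd_of_digits h0 (fun k => ?_)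
    have e : 3 * Fm s i k + Fp s i k = 3 * Fm s j k + Fp s j k := congrFun (congrArg ofLex hk) k
    have := Fp_cases (s := s) i k
    have := Fp_cases (s := s) j k
    have := Fm_cases (s := s) i k
    have := Fm_cases (s := s) j k
    omega
  · intro i j _ hi hj
    apply lex_of_first
    simp only [key₂, ofLex_toLex]
    have := Fm_cases (s := s) j 0
    have := Fp_cases (s := s) i 0
    have := Fp_cases (s := s) j 0
    omega
  · intro i hi
    refine ⟨?_, by rw [h.Fm_mm_zero, hi]; decide⟩
    rw [← W_zero (s := s) (mm i), W_mm, sub_zero]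
    apply add_one_of_turn
    simpa [Fm, dig] using hi
  · intro i hi
    have hi' : Fm s i 0 = 1 := (Fm_cases i 0).resolve_right hi
    refine ⟨?_, by rw [h.Fm_mm_zero, hi']⟩
    rw [← W_zero (s := s) (mm i), W_mm, sub_zero]
    have := h.W_red' i 0
    rw [neg_zero, W_zero, zero_add] at this
    apply sub_one_of_turn this
    simpa [Fm, dig] using hi

lemma dblSys (h : PerSeq s N) [NeZero N] :
    DblSys (fun a : ZMod N => s (rep a)) (rankOf (key₁ s)) (rankOf (key₂ s))
      (fun a => Fp s (rep a) 0 = -1) (fun a => Fm s (rep a) 0 = -1) M₁ M₂ where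
  t₁ := h.triSys₁
  t₂ := h.triSys₂
  surj c := by
    obtain ⟨i, hi⟩ := h.surj c
    exact ⟨(i : ZMod N), (h.s_congr (dvd_rep_cast i)).trans hi⟩
  trans Y hY h1 h2 := by
    have hstep : ∀ a ∈ Y, a + 1 ∈ Y := by
      intro a ha
      by_cases he : Even (rep a)
      · have := h2 a ha
        rw [M₂, mm, if_pos he] at this
        push_cast at this
        rwa [rep_cast] at this
      · have := h1 a ha
        rw [M₁, mp, if_neg he] at this
        push_cast at this
        rwa [rep_cast] at this
    obtain ⟨a, ha⟩ := hY
    have hall : ∀ n : ℕ, a + n ∈ Y := by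
      intro n
      induction n with
      | zero => simpa using ha
      | succ n ih =>
        push_cast
        rw [← add_assoc]
        exact hstep _ ih
    ext b
    simp only [Set.mem_univ, iff_true]
    have := hall (b - a).val
    rwa [ZMod.natCast_zmod_val, add_sub_cancel] at this

end PerSeq

/-- Conflicts counted by the crossing estimate. -/
def Adm (s : ℤ → ZMod 3) (i j : ℤ) (b f : ℕ) : Prop :=
  Conf s i j b f ∧ (f = b ∨ (f = b + 1 ∧ Fp s i 0 = -1) ∨ (b = f + 1 ∧ Fm s i 0 = -1))

/-- The ordered pairs of slots in conflict. -/
noncomputable def confSet (s : ℤ → ZMod 3) (N : ℕ) [NeZero N] : Finset (ZMod N × ZMod N) :=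
  Finset.univ.filter (fun p => ∃ b f, Adm s (rep p.1) (rep p.2) b f)

lemma two_mul_card_le_of_antisymm {α : Type*} {A U : Finset (α × α)} (hA : A ⊆ U)
    (hU : ∀ p ∈ U, p.swap ∈ U) (hanti : ∀ p ∈ A, p.swap ∉ A) : 2 * A.card ≤ U.card := by
  have h1 : Disjoint A (A.image Prod.swap) := by
    rw [Finset.disjoint_left]
    intro p hp hp'
    obtain ⟨q, hq, rfl⟩ := Finset.mem_image.1 hp'
    exact hanti q hq hp
  rw [two_mul]
  nth_rw 2 [← Finset.card_image_of_injective A Prod.swap_injective]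
  rw [← Finset.card_union_of_disjoint h1]
  refine Finset.card_le_card (Finset.union_subset hA (fun p hp => ?_))
  obtain ⟨q, hq, rfl⟩ := Finset.mem_image.1 hp
  exact hU q (hA hq)

namespace PerSeq

lemma adm_symm (h : PerSeq s N) {i j : ℤ} {b f : ℕ} (ha : Adm s i j b f) : Adm s j i b f := by
  refine ⟨h.conf_symm ha.1, ?_⟩
  rcases ha.2 with h1 | ⟨h1, h2⟩ | ⟨h1, h2⟩
  · exact Or.inl h1
  · refine Or.inr (Or.inl ⟨h1, ?_⟩)
    have e0 := ha.1.agree 0 (by omega) (by omega)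
    have e1 := ha.1.agree 1 (by omega) (by omega)
    rw [← h2]
    simp [Fp, dig, e0, e1, -W_zero]
  · refine Or.inr (Or.inr ⟨h1, ?_⟩)
    have e0 := ha.1.agree 0 (by omega) (by omega)
    have e1 := ha.1.agree (-1) (by omega) (by omega)
    rw [← h2]
    simp [Fm, dig, e0, e1, -W_zero]

theorem crossings_le_confSet (h : PerSeq s N) [NeZero N] :
    2 * ((sideCross (fun a : ZMod N => s (rep a)) (rankOf (key₁ s)) (rankOf (key₂ s))).card +
      (cornerCross (fun a : ZMod N => s (rep a)) (rankOf (key₁ s))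
        (fun a => Fp s (rep a) 0 = -1) M₁).card +
      (cornerCross (fun a : ZMod N => s (rep a)) (rankOf (key₂ s))
        (fun a => Fm s (rep a) 0 = -1) M₂).card) ≤ (confSet s N).card := by
  set U₀ : Finset (ZMod N × ZMod N) := Finset.univ.filter (fun p => ∃ b f,
    Adm s (rep p.1) (rep p.2) b f ∧ f = b) with hU₀
  set U₁ : Finset (ZMod N × ZMod N) := Finset.univ.filter (fun p => ∃ b f,
    Adm s (rep p.1) (rep p.2) b f ∧ f = b + 1) with hU₁
  set U₂ : Finset (ZMod N × ZMod N) := Finset.univ.filter (fun p => ∃ b f,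
    Adm s (rep p.1) (rep p.2) b f ∧ b = f + 1) with hU₂
  have e0 : 2 * (sideCross (fun a : ZMod N => s (rep a)) (rankOf (key₁ s))
      (rankOf (key₂ s))).card ≤ U₀.card := by
    apply two_mul_card_le_of_antisymm
    · intro p hp
      simp only [sideCross, Finset.mem_filter, Finset.mem_univ, true_and, rankOf_lt] at hp
      obtain ⟨k, hk⟩ := h.conf_of_side hp.1 hp.2.1 hp.2.2
      simp only [hU₀, Finset.mem_filter, Finset.mem_univ, true_and]
      exact ⟨k, k, ⟨hk, Or.inl rfl⟩, rfl⟩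
    · intro p hp
      simp only [hU₀, Finset.mem_filter, Finset.mem_univ, true_and] at hp ⊢
      obtain ⟨b, f, hc, hbf⟩ := hp
      exact ⟨b, f, h.adm_symm hc, hbf⟩
    · intro p hp hp'
      simp only [sideCross, Finset.mem_filter, Finset.mem_univ, true_and] at hp hp'
      exact lt_asymm hp.2.1 hp'.2.1
  have e1 : 2 * (cornerCross (fun a : ZMod N => s (rep a)) (rankOf (key₁ s))
        (fun a => Fp s (rep a) 0 = -1) M₁).card ≤ U₁.card := by
    apply two_mul_card_le_of_antisymm
    · intro p hp
      simp only [cornerCross, Finset.mem_filter, Finset.mem_univ, true_and, rankOf_lt] at hp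
      obtain ⟨h0, h1, h2, h3, h4⟩ := hp
      have h4' : key₁ s (mp (rep p.1)) < key₁ s (mp (rep p.2)) := by
        rw [← key₁_congr (h.W_congr (dvd_rep_cast (N := N) (mp (rep p.1)))),
          ← key₁_congr (h.W_congr (dvd_rep_cast (N := N) (mp (rep p.2))))]
        exact h4
      obtain ⟨k, hk⟩ := h.conf_of_corner₁ h0 (h1.trans h2.symm) h3 h4'
      simp only [hU₁, Finset.mem_filter, Finset.mem_univ, true_and]
      exact ⟨k, k + 1, ⟨hk, Or.inr (Or.inl ⟨rfl, h1⟩)⟩, rfl⟩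
    · intro p hp
      simp only [hU₁, Finset.mem_filter, Finset.mem_univ, true_and] at hp ⊢
      obtain ⟨b, f, hc, hbf⟩ := hp
      exact ⟨b, f, h.adm_symm hc, hbf⟩
    · intro p hp hp'
      simp only [cornerCross, Finset.mem_filter, Finset.mem_univ, true_and] at hp hp'
      exact lt_asymm hp.2.2.2.1 hp'.2.2.2.1
  have e2 : 2 * (cornerCross (fun a : ZMod N => s (rep a)) (rankOf (key₂ s))
        (fun a => Fm s (rep a) 0 = -1) M₂).card ≤ U₂.card := by
    apply two_mul_card_le_of_antisymm
    · intro p hp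
      simp only [cornerCross, Finset.mem_filter, Finset.mem_univ, true_and, rankOf_lt] at hp
      obtain ⟨h0, h1, h2, h3, h4⟩ := hp
      have h4' : key₂ s (mm (rep p.1)) < key₂ s (mm (rep p.2)) := by
        rw [← key₂_congr (h.W_congr (dvd_rep_cast (N := N) (mm (rep p.1)))),
          ← key₂_congr (h.W_congr (dvd_rep_cast (N := N) (mm (rep p.2))))]
        exact h4
      obtain ⟨k, hk⟩ := h.conf_of_corner₂ h0 (h1.trans h2.symm) h3 h4'
      simp only [hU₂, Finset.mem_filter, Finset.mem_univ, true_and]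
      exact ⟨k + 1, k, ⟨hk, Or.inr (Or.inr ⟨rfl, h1⟩)⟩, rfl⟩
    · intro p hp
      simp only [hU₂, Finset.mem_filter, Finset.mem_univ, true_and] at hp ⊢
      obtain ⟨b, f, hc, hbf⟩ := hp
      exact ⟨b, f, h.adm_symm hc, hbf⟩
    · intro p hp hp'
      simp only [cornerCross, Finset.mem_filter, Finset.mem_univ, true_and] at hp hp'
      exact lt_asymm hp.2.2.2.1 hp'.2.2.2.1
  have d01 : Disjoint U₀ U₁ := by
    rw [Finset.disjoint_left]
    intro p hp hp'
    simp only [hU₀, hU₁, Finset.mem_filter, Finset.mem_univ, true_and] at hp hp'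
    obtain ⟨b, f, hc, hbf⟩ := hp
    obtain ⟨b', f', hc', hbf'⟩ := hp'
    have := conf_unique hc.1 hc'.1
    omega
  have d012 : Disjoint (U₀ ∪ U₁) U₂ := by
    rw [Finset.disjoint_left]
    intro p hp hp'
    simp only [hU₀, hU₁, hU₂, Finset.mem_union, Finset.mem_filter, Finset.mem_univ,
      true_and] at hp hp'
    obtain ⟨b', f', hc', hbf'⟩ := hp'
    rcases hp with ⟨b, f, hc, hbf⟩ | ⟨b, f, hc, hbf⟩ <;>
    · have := conf_unique hc.1 hc'.1
      omega
  have hsub : (U₀ ∪ U₁ ∪ U₂).card ≤ (confSet s N).card := by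
    apply Finset.card_le_card
    intro p hp
    simp only [hU₀, hU₁, hU₂, Finset.mem_union, Finset.mem_filter, Finset.mem_univ,
      true_and] at hp
    simp only [confSet, Finset.mem_filter, Finset.mem_univ, true_and]
    rcases hp with (⟨b, f, hc, _⟩ | ⟨b, f, hc, _⟩) | ⟨b, f, hc, _⟩ <;> exact ⟨b, f, hc⟩
  rw [Finset.card_union_of_disjoint d012, Finset.card_union_of_disjoint d01] at hsub
  omega

theorem confSet_card_ge (h : PerSeq s N) [NeZero N] {l : ℕ} (hl : N = 2 * l) :
    2 * l ≤ (confSet s N).card + 2 := by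
  have h1 := h.dblSys.crossings_ge (l := l) (by rw [ZMod.card, hl])
  have h2 := h.crossings_le_confSet
  omega

lemma W_add_half {l : ℕ} (hodd : Odd l) (hper : ∀ i, s (i + l) = s i)
    (i k : ℤ) : W s (i + l) k = W s i (-k) := by
  have hpar : Even (i + l) ↔ ¬ Even i := by
    have : ¬ Even (l : ℤ) := by
      rw [Int.even_coe_nat]
      exact Nat.not_even_iff_odd.2 hodd
    simp [Int.even_add, this]
  unfold W
  by_cases hi : Even i
  · rw [if_neg (by simp [hpar, hi]), if_pos hi, ← hper (i - -k)]
    congr 1; ring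
  · rw [if_pos (hpar.2 hi), if_neg hi, ← hper (i + -k)]
    congr 1; ring

theorem confSet_card_ge_of_half_period (h : PerSeq s N) [NeZero N] {l : ℕ} (hl : N = 2 * l)
    (hodd : Odd l) (hper : ∀ i, s (i + l) = s i) :
    4 * l ≤ (confSet s N).card + 6 := by
  have hF : ∀ i : ℤ, Fm s (i + l) = Fp s i := by
    intro i
    funext k
    simp only [Fm, Fp, dig, W_add_half hodd hper, neg_neg]
  have hF' : ∀ i : ℤ, Fp s (i + l) = Fm s i := by
    intro i
    funext k
    simp only [Fm, Fp, dig, W_add_half hodd hper]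
  have hkey : ∀ i : ℤ, key₂ s (i + l) = key₁ s i := by
    intro i
    simp only [key₁, key₂, hF, hF']
  have hrep : ∀ a : ZMod N, (N : ℤ) ∣ rep (a + (l : ZMod N)) - (rep a + l) := by
    intro a
    have := dvd_rep_cast (N := N) (rep a + l)
    push_cast at this
    rwa [rep_cast] at this
  have hkey' : ∀ a : ZMod N, key₂ s (rep (a + (l : ZMod N))) = key₁ s (rep a) := by
    intro a
    rw [key₂_congr (h.W_congr (hrep a)), hkey]
  have hll : (l : ZMod N) + l = 0 := by
    rw [← Nat.cast_add, show l + l = N by omega, ZMod.natCast_self]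
  have ht : Flip (fun a : ZMod N => s (rep a)) (rankOf (key₁ s)) (rankOf (key₂ s))
      (fun a => Fp s (rep a) 0 = -1) (fun a => Fm s (rep a) 0 = -1) M₁ M₂
      (fun a => a + (l : ZMod N)) := by
    constructor
    · intro a
      simp only [add_assoc, hll, add_zero]
    · intro a ha
      rw [add_eq_left, ZMod.natCast_eq_zero_iff] at ha
      have := hodd.pos
      have := Nat.le_of_dvd this ha
      omega
    · intro a
      rw [h.s_congr (hrep a), hper]
    · intro a
      unfold rankOf
      have hb' : ∀ b : ZMod N, b + (l : ZMod N) + l = b := by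
        intro b
        rw [add_assoc, hll, add_zero]
      rw [Nat.cast_inj]
      refine Finset.card_nbij' (fun b : ZMod N => b + (l : ZMod N)) (fun b => b + (l : ZMod N))
        ?_ ?_ (fun b _ => hb' b) (fun b _ => hb' b)
      · intro b hb
        rw [Finset.mem_coe, Finset.mem_filter] at hb ⊢
        refine ⟨Finset.mem_univ _, ?_⟩
        dsimp only
        rw [← hkey', ← hkey', hb']
        exact hb.2
      · intro b hb
        rw [Finset.mem_coe, Finset.mem_filter] at hb ⊢
        refine ⟨Finset.mem_univ _, ?_⟩
        dsimp only
        rw [hkey', hkey']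
        exact hb.2
    · intro a
      simp only [Fm_congr (h.W_congr (hrep a)), hF]
    · intro a
      have h1 := h.mm_congr (hrep a)
      rw [← ZMod.intCast_eq_intCast_iff_dvd_sub] at h1
      rw [M₂, ← h1, M₁]
      have hpar : Even (rep a + l) ↔ ¬ Even (rep a) := by
        have : ¬ Even (l : ℤ) := by
          rw [Int.even_coe_nat]
          exact Nat.not_even_iff_odd.2 hodd
        simp [Int.even_add, this]
      by_cases hi : Even (rep a)
      · rw [mm, if_neg (by simp [hpar, hi]), mp, if_pos hi]
        push_cast; ring
      · rw [mm, if_pos (hpar.2 hi), mp, if_neg hi]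
        push_cast; ring
  have h1 := h.dblSys.crossings_ge_of_flip (l := l) (by rw [ZMod.card, hl]) hodd ht
  have h2 := h.crossings_le_confSet
  omega

end PerSeq

end Strip

namespace Strip

open Matrix

/-- The reflections in the three sides of an ideal triangle, as integer matrices. -/
def reflMat : ZMod 3 → Matrix (Fin 2) (Fin 2) ℤ :=
  ![!![-1, 2; 0, 1], !![-1, 0; 0, 1], !![-1, 0; -2, 1]]

lemma reflMat_zero : reflMat 0 = !![-1, 2; 0, 1] := rfl
lemma reflMat_one : reflMat 1 = !![-1, 0; 0, 1] := rfl
lemma reflMat_two : reflMat 2 = !![-1, 0; -2, 1] := rfl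

lemma letter_cases : ∀ c : ZMod 3, c = 0 ∨ c = 1 ∨ c = 2 := by decide

lemma reflMat_sq (c : ZMod 3) : reflMat c * reflMat c = 1 := by
  rcases letter_cases c with rfl | rfl | rfl <;> decide

lemma det_reflMat (c : ZMod 3) : (reflMat c).det = -1 := by
  rcases letter_cases c with rfl | rfl | rfl <;> decide

/-- The reflection `reflMat c` as an invertible matrix. -/
def R (c : ZMod 3) : GL (Fin 2) ℤ := ⟨reflMat c, reflMat c, reflMat_sq c, reflMat_sq c⟩

lemma R_mul_self (c : ZMod 3) : R c * R c = 1 := Units.ext (reflMat_sq c)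

lemma R_inv (c : ZMod 3) : (R c)⁻¹ = R c := rfl

lemma R_mul_cancel (c : ZMod 3) (g : GL (Fin 2) ℤ) : R c * (R c * g) = g := by
  rw [← mul_assoc, R_mul_self, one_mul]

/-- The linear action of integer matrices on the plane. -/
def act (g : GL (Fin 2) ℤ) (u : ℝ × ℝ) : ℝ × ℝ :=
  ((g.1 0 0 : ℝ) * u.1 + (g.1 0 1 : ℝ) * u.2, (g.1 1 0 : ℝ) * u.1 + (g.1 1 1 : ℝ) * u.2)

lemma act_one (u : ℝ × ℝ) : act 1 u = u := by
  simp [act]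

lemma act_mul (g h : GL (Fin 2) ℤ) (u : ℝ × ℝ) : act (g * h) u = act g (act h u) := by
  simp only [act, Units.val_mul, Matrix.mul_apply, Fin.sum_univ_two]
  push_cast
  ext <;> ring

lemma act_inv_act (g : GL (Fin 2) ℤ) (u : ℝ × ℝ) : act g⁻¹ (act g u) = u := by
  rw [← act_mul, inv_mul_cancel, act_one]

lemma act_act_inv (g : GL (Fin 2) ℤ) (u : ℝ × ℝ) : act g (act g⁻¹ u) = u := by
  rw [← act_mul, mul_inv_cancel, act_one]

lemma act_smul (g : GL (Fin 2) ℤ) (r : ℝ) (u : ℝ × ℝ) : act g (r • u) = r • act g u := by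
  simp only [act, Prod.smul_fst, Prod.smul_snd, smul_eq_mul]
  ext <;> simp <;> ring

/-- Quadratic forms positive on the three arcs of the circle cut out by the ideal triangle. -/
def q : ZMod 3 → ℝ × ℝ → ℝ :=
  ![fun u => u.2 * (u.1 - u.2), fun u => -(u.1 * u.2), fun u => u.1 * (u.2 - u.1)]

lemma q_zero (u : ℝ × ℝ) : q 0 u = u.2 * (u.1 - u.2) := rfl
lemma q_one (u : ℝ × ℝ) : q 1 u = -(u.1 * u.2) := rfl
lemma q_two (u : ℝ × ℝ) : q 2 u = u.1 * (u.2 - u.1) := rfl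

/-- A positive definite form invariant under the symmetries of the ideal triangle. -/
def nrm (u : ℝ × ℝ) : ℝ := u.1 ^ 2 - u.1 * u.2 + u.2 ^ 2

lemma act_R_zero (u : ℝ × ℝ) : act (R 0) u = (-u.1 + 2 * u.2, u.2) := by
  simp [act, R, reflMat_zero]
lemma act_R_one (u : ℝ × ℝ) : act (R 1) u = (-u.1, u.2) := by
  simp [act, R, reflMat_one]
lemma act_R_two (u : ℝ × ℝ) : act (R 2) u = (-u.1, -2 * u.1 + u.2) := by
  simp [act, R, reflMat_two]

lemma q_act_R (c : ZMod 3) (u : ℝ × ℝ) : q c (act (R c) u) = - q c u := by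
  rcases letter_cases c with rfl | rfl | rfl
  · rw [act_R_zero, q_zero, q_zero]; ring
  · rw [act_R_one, q_one, q_one]; ring
  · rw [act_R_two, q_two, q_two]; ring

lemma nrm_act_R (c : ZMod 3) (u : ℝ × ℝ) : nrm (act (R c) u) = nrm u - 2 * q c u := by
  rcases letter_cases c with rfl | rfl | rfl
  · rw [act_R_zero, q_zero, nrm, nrm]; ring
  · rw [act_R_one, q_one, nrm, nrm]; ring
  · rw [act_R_two, q_two, nrm, nrm]; ring

lemma q_add_nonpos {a b : ZMod 3} (hab : a ≠ b) (u : ℝ × ℝ) : q a u + q b u ≤ 0 := by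
  rcases letter_cases a with rfl | rfl | rfl <;> rcases letter_cases b with rfl | rfl | rfl <;>
    first
      | exact absurd rfl hab
      | (simp only [q_zero, q_one, q_two]
         nlinarith [sq_nonneg u.1, sq_nonneg u.2, sq_nonneg (u.1 - u.2)])

lemma nrm_nonneg (u : ℝ × ℝ) : 0 ≤ nrm u := by
  unfold nrm
  nlinarith [sq_nonneg (u.1 - u.2), sq_nonneg u.1, sq_nonneg u.2]

lemma nrm_smul (r : ℝ) (u : ℝ × ℝ) : nrm (r • u) = r ^ 2 * nrm u := by
  simp only [nrm, Prod.smul_fst, Prod.smul_snd, smul_eq_mul]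
  ring

lemma eq_zero_of_nrm {u : ℝ × ℝ} (h : nrm u = 0) : u = 0 := by
  unfold nrm at h
  have h1 : u.1 = 0 := by nlinarith [sq_nonneg (u.1 - 2 * u.2), sq_nonneg u.1]
  have h2 : u.2 = 0 := by nlinarith [sq_nonneg (2 * u.1 - u.2), sq_nonneg u.2]
  exact Prod.ext h1 h2

lemma nrm_pos {u : ℝ × ℝ} (h : u ≠ 0) : 0 < nrm u :=
  lt_of_le_of_ne (nrm_nonneg u) fun h0 => h (eq_zero_of_nrm h0.symm)

lemma exists_q_pos (c : ZMod 3) : ∃ u, 0 < q c u := by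
  rcases letter_cases c with rfl | rfl | rfl
  · exact ⟨(2, 1), by norm_num [q_zero]⟩
  · exact ⟨(-1, 1), by norm_num [q_one]⟩
  · exact ⟨(1, 2), by norm_num [q_two]⟩

lemma q_neg_of_pos {a b : ZMod 3} (hab : a ≠ b) {u : ℝ × ℝ} (h : 0 < q a u) : q b u < 0 := by
  have := q_add_nonpos hab u
  linarith

lemma q_R_pos_of_pos {a b : ZMod 3} (hab : a ≠ b) {u : ℝ × ℝ} (h : 0 < q a u) :
    0 < q b (act (R b) u) := by
  rw [q_act_R]
  linarith [q_neg_of_pos hab h]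

lemma q_R_eq_zero {a b : ZMod 3} (hab : a ≠ b) {u : ℝ × ℝ} (ha : q a u = 0) (hb : q b u = 0) :
    q a (act (R b) u) = 0 := by
  have key : ∀ x : ℝ, -x ^ 2 = 0 → x = 0 := fun x hx => by simpa using hx
  rcases letter_cases a with rfl | rfl | rfl <;> rcases letter_cases b with rfl | rfl | rfl <;>
    first
      | exact absurd rfl hab
      | skip
  all_goals
    simp only [q_zero, q_one, q_two, act_R_zero, act_R_one, act_R_two] at *
  · have h2 : u.2 = 0 := key _ (by linarith)
    simp [h2]
  · have h2 : u.1 - u.2 = 0 := key _ (by linarith)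
    linear_combination (u.2 - 2 * u.1) * h2
  · have h2 : u.2 = 0 := key _ (by linarith)
    simp [h2]
  · have h2 : u.1 = 0 := key _ (by linarith)
    simp [h2]
  · have h2 : u.1 - u.2 = 0 := key _ (by linarith)
    linear_combination (-u.1 + 2 * u.2) * h2
  · have h2 : u.1 = 0 := key _ (by linarith)
    simp [h2]

lemma eq_zero_of_q {u : ℝ × ℝ} (h : ∀ c, q c u = 0) : u = 0 := by
  have h0 := h 0
  have h1 := h 1
  have h2 := h 2
  rw [q_zero] at h0
  rw [q_one] at h1
  rw [q_two] at h2
  apply eq_zero_of_nrm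
  unfold nrm
  linarith

section orbit

variable {s : ℤ → ZMod 3} {u : ℤ → ℝ × ℝ}

lemma q_nonpos_succ (hs : ∀ i, s i ≠ s (i + 1)) (hu : ∀ n, u (n + 1) = act (R (s n)) (u n)) {n : ℤ}
    (h : q (s n) (u n) ≤ 0) : q (s (n + 1)) (u (n + 1)) ≤ 0 := by
  have h1 := q_add_nonpos (hs n) (u (n + 1))
  rw [hu n, q_act_R, ← hu n] at h1
  linarith

lemma q_nonpos_add (hs : ∀ i, s i ≠ s (i + 1)) (hu : ∀ n, u (n + 1) = act (R (s n)) (u n)) {n : ℤ}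
    (h : q (s n) (u n) ≤ 0) (k : ℕ) : q (s (n + k)) (u (n + k)) ≤ 0 := by
  induction k with
  | zero => simpa using h
  | succ k ih =>
    have := q_nonpos_succ hs hu ih
    push_cast
    rwa [← add_assoc]

lemma nrm_succ (hu : ∀ n, u (n + 1) = act (R (s n)) (u n)) (n : ℤ) :
    nrm (u (n + 1)) = nrm (u n) - 2 * q (s n) (u n) := by
  rw [hu, nrm_act_R]

lemma nrm_le_add (hs : ∀ i, s i ≠ s (i + 1)) (hu : ∀ n, u (n + 1) = act (R (s n)) (u n)) {n : ℤ}
    (h : q (s n) (u n) ≤ 0) (k : ℕ) : nrm (u n) ≤ nrm (u (n + k)) := by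
  induction k with
  | zero => simp
  | succ k ih =>
    have h1 := q_nonpos_add hs hu h k
    have h2 := nrm_succ hu (n + k)
    push_cast
    rw [← add_assoc]
    linarith

lemma q_pos_of_nrm_lt (hs : ∀ i, s i ≠ s (i + 1)) (hu : ∀ n, u (n + 1) = act (R (s n)) (u n))
    {N : ℕ} (h : ∀ n, nrm (u (n + N)) < nrm (u n)) (n : ℤ) : 0 < q (s n) (u n) := by
  by_contra! hn
  exact absurd (nrm_le_add hs hu hn N) (not_le.2 (h n))

lemma q_neg_of_nrm_lt (hs : ∀ i, s i ≠ s (i + 1)) (hu : ∀ n, u (n + 1) = act (R (s n)) (u n))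
    {N : ℕ} (h : ∀ n, nrm (u n) < nrm (u (n + N))) (n : ℤ) : q (s n) (u n) < 0 := by
  have := q_pos_of_nrm_lt (s := fun m => s (-m - 1)) (u := fun m => u (-m)) (N := N)
    (fun i => by
      have := hs (-(i + 1) - 1)
      rw [show -(i + 1) - 1 + 1 = -i - 1 by ring] at this
      exact this.symm)
    (fun m => by
      have := hu (-m - 1)
      rw [show -m - 1 + 1 = -m by ring] at this
      rw [this, ← act_mul, R_mul_self, act_one]
      congr 1; ring)
    (fun m => by
      have := h (-(m + N))
      rwa [show -(m + (N : ℤ)) + N = -m by ring] at this) (-n - 1)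
  simp only [show -(-n - 1) = n + 1 by ring, add_sub_cancel_right] at this
  rw [hu, q_act_R] at this
  linarith

lemma q_eq_zero_of_nrm_eq (hs : ∀ i, s i ≠ s (i + 1))
    (hu : ∀ n, u (n + 1) = act (R (s n)) (u n)) {N : ℕ} (hN : 0 < N)
    (h : ∀ n, nrm (u (n + N)) = nrm (u n)) (n : ℤ) : q (s n) (u n) = 0 := by
  have hle : ∀ n, q (s n) (u n) ≤ 0 := by
    intro n
    by_contra! hn
    have hpos : ∀ k : ℕ, 0 < q (s (n - k)) (u (n - k)) := by
      intro k
      by_contra! hk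
      have := q_nonpos_add hs hu hk k
      rw [sub_add_cancel] at this
      linarith
    have hlt : ∀ k : ℕ, nrm (u n) ≤ nrm (u (n - k)) ∧ (0 < k → nrm (u n) < nrm (u (n - k))) := by
      intro k
      induction k with
      | zero => simp
      | succ k ih =>
        have h1 := hpos (k + 1)
        have h2 := nrm_succ hu (n - (k + 1 : ℕ))
        rw [show n - ((k + 1 : ℕ) : ℤ) + 1 = n - k by push_cast; ring] at h2
        exact ⟨by linarith [ih.1], fun _ => by linarith [ih.1]⟩
    have h1 := (hlt N).2 hN
    have h2 := h (n - N)
    rw [sub_add_cancel] at h2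
    linarith
  refine le_antisymm (hle n) ?_
  by_contra! hn
  have h1 := nrm_succ hu n
  have h2 := nrm_le_add hs hu (hle (n + 1)) (N - 1)
  rw [show n + 1 + ((N - 1 : ℕ) : ℤ) = n + N by push_cast [Nat.cast_sub hN]; ring, h n] at h2
  linarith

/-- In a reduced sequence using three letters, three consecutive letters are distinct. -/
lemma exists_three_distinct (hsurj : ∀ c, ∃ i, s i = c) :
    ∃ n, s (n + 2) ≠ s n := by
  by_contra! hn
  have h2 : ∀ (k : ℕ) (n : ℤ), s (n + 2 * k) = s n := by
    intro k
    induction k with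
    | zero => simp
    | succ k ih =>
      intro n
      rw [show n + 2 * ((k + 1 : ℕ) : ℤ) = (n + 2 * k) + 2 by push_cast; ring, hn, ih]
  have h3 : ∀ i, s i = s 0 ∨ s i = s 1 := by
    intro i
    rcases Int.even_or_odd' i with ⟨k, rfl | rfl⟩
    · left
      rcases Int.eq_nat_or_neg k with ⟨m, rfl | rfl⟩
      · simpa using h2 m 0
      · simpa using (h2 m (2 * (-m))).symm
    · right
      rcases Int.eq_nat_or_neg k with ⟨m, rfl | rfl⟩
      · simpa [add_comm] using h2 m 1
      · simpa [add_comm] using (h2 m (2 * (-m) + 1)).symm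
  have h4 : ∀ a b : ZMod 3, ∃ c, c ≠ a ∧ c ≠ b := by decide
  obtain ⟨c, h5, h6⟩ := h4 (s 0) (s 1)
  obtain ⟨i, rfl⟩ := hsurj c
  rcases h3 i with h | h
  · exact h5 h
  · exact h6 h

lemma eq_zero_of_nrm_periodic (hs : ∀ i, s i ≠ s (i + 1)) (hsurj : ∀ c, ∃ i, s i = c)
    (hu : ∀ n, u (n + 1) = act (R (s n)) (u n)) {N : ℕ} (hN : 0 < N)
    (h : ∀ n, nrm (u (n + N)) = nrm (u n)) : ∃ n, u n = 0 := by
  have h0 := q_eq_zero_of_nrm_eq hs hu hN h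
  obtain ⟨n, hn⟩ := exists_three_distinct hsurj
  refine ⟨n + 2, eq_zero_of_q ?_⟩
  have e2 : u (n + 2) = act (R (s (n + 1))) (u (n + 1)) := by
    rw [← hu]; congr 1; ring
  have ha : q (s n) (u (n + 1)) = 0 := by rw [hu, q_act_R, h0, neg_zero]
  have ha' : q (s n) (u (n + 2)) = 0 := by
    rw [e2]
    exact q_R_eq_zero (hs n) ha (h0 _)
  have hb : q (s (n + 1)) (u (n + 2)) = 0 := by rw [e2, q_act_R, h0, neg_zero]
  have hc := h0 (n + 2)
  have h4 : ∀ a b c : ZMod 3, a ≠ b → b ≠ c → c ≠ a → ∀ d, d = a ∨ d = b ∨ d = c := by decide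
  have h5 : s (n + 1) ≠ s (n + 2) := by
    have := hs (n + 1)
    rwa [show n + 1 + 1 = n + 2 by ring] at this
  intro d
  rcases h4 _ _ _ (hs n) h5 hn d with rfl | rfl | rfl
  · exact ha'
  · exact hb
  · exact hc

end orbit

end Strip

namespace Strip

/-- The product frames attached to a sequence of reflections. -/
structure Frames (s : ℤ → ZMod 3) (P : ℤ → GL (Fin 2) ℤ) : Prop where
  zero : P 0 = 1
  succ : ∀ i, P (i + 1) = P i * R (s i)

lemma exists_frames (s : ℤ → ZMod 3) : ∃ P, Frames s P := by
  let up : ℕ → GL (Fin 2) ℤ := fun n => Nat.rec 1 (fun k g => g * R (s k)) n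
  let dn : ℕ → GL (Fin 2) ℤ := fun n => Nat.rec 1 (fun k g => g * R (s (-(k + 1)))) n
  refine ⟨fun i => if 0 ≤ i then up i.toNat else dn (-i).toNat, by simp [up], fun i => ?_⟩
  rcases le_or_gt 0 i with hi | hi
  · obtain ⟨k, rfl⟩ := Int.eq_ofNat_of_zero_le hi
    rw [if_pos hi, if_pos (by omega), show ((k : ℤ) + 1).toNat = k + 1 by omega,
      show (k : ℤ).toNat = k by omega]
  · obtain ⟨k, hk⟩ : ∃ k : ℕ, i = -(k + 1) := ⟨(-i - 1).toNat, by omega⟩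
    subst hk
    have e : dn (k + 1) = dn k * R (s (-(k + 1))) := rfl
    have e' : ¬ (0 : ℤ) ≤ -(k + 1) := not_le.2 hi
    simp only [if_neg e', show (-(-((k : ℤ) + 1))).toNat = k + 1 by omega]
    rw [e, mul_assoc, R_mul_self, mul_one]
    rcases Nat.eq_zero_or_pos k with rfl | hk
    · simp [up, dn]
    · rw [if_neg (by omega), show (-(-((k : ℤ) + 1) + 1)).toNat = k by omega]

variable {s : ℤ → ZMod 3} {P : ℤ → GL (Fin 2) ℤ} {N : ℕ}

lemma Frames.pred (hP : Frames s P) (i : ℤ) : P i = P (i + 1) * R (s i) := by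
  rw [hP.succ, mul_assoc, R_mul_self, mul_one]

lemma Frames.add_period (hP : Frames s P) (hs : ∀ i, s (i + N) = s i) (i : ℤ) :
    P (i + N) = P N * P i := by
  induction i using Int.induction_on with
  | zero => rw [hP.zero, zero_add, mul_one]
  | succ i ih =>
    rw [show (i : ℤ) + 1 + N = i + N + 1 by ring, hP.succ, ih, hs, mul_assoc, ← hP.succ]
  | pred i ih =>
    have h1 := hP.pred (-(i : ℤ) - 1 + N)
    rw [show -(i : ℤ) - 1 + N + 1 = -i + N by ring, ih, hs, mul_assoc] at h1
    have h2 := hP.pred (-(i : ℤ) - 1)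
    rw [sub_add_cancel] at h2
    rw [h1, ← h2]

lemma Frames.add_mul_period (hP : Frames s P) (hs : ∀ i, s (i + N) = s i) (i m : ℤ) :
    P (i + m * N) = P N ^ m * P i := by
  induction m using Int.induction_on with
  | zero => simp
  | succ m ih =>
    rw [show i + ((m : ℤ) + 1) * N = i + m * N + N by ring, hP.add_period hs, ih, add_comm,
      zpow_add, zpow_one, mul_assoc]
  | pred m ih =>
    have h1 := hP.add_period hs (i + (-(m : ℤ) - 1) * N)
    rw [show i + (-(m : ℤ) - 1) * N + N = i + -m * N by ring, ih] at h1
    rw [← inv_mul_eq_iff_eq_mul] at h1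
    rw [← h1, show -(m : ℤ) - 1 = -1 + -m by ring, zpow_add, zpow_neg_one, mul_assoc]

lemma Frames.orbit (hP : Frames s P) (e : ℝ × ℝ) (n : ℤ) :
    act (P (n + 1))⁻¹ e = act (R (s n)) (act (P n)⁻¹ e) := by
  rw [hP.succ, mul_inv_rev, R_inv, act_mul]

lemma Frames.orbit_add (hP : Frames s P) (hs : ∀ i, s (i + N) = s i) {e : ℝ × ℝ} {l : ℝ}
    (hl : l ≠ 0) (he : act (P N) e = l • e) (n : ℤ) :
    act (P (n + N))⁻¹ e = l⁻¹ • act (P n)⁻¹ e := by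
  rw [hP.add_period hs, mul_inv_rev, act_mul, ← act_smul]
  congr 1
  have h1 : e = l • act (P N)⁻¹ e := by
    rw [← act_smul, ← he, act_inv_act]
  conv_rhs => rw [h1]
  rw [smul_smul, inv_mul_cancel₀ hl, one_smul]

lemma Frames.orbit_ne_zero {e : ℝ × ℝ} (he : e ≠ 0) (n : ℤ) : act (P n)⁻¹ e ≠ 0 := by
  intro h
  apply he
  rw [← act_act_inv (P n) e, h]
  simp [act]

/-- The attracting eigenvector of the holonomy lies, in every frame, on the side ahead. -/
lemma Frames.q_expanding (hP : Frames s P) (h : PerSeq s N) {e : ℝ × ℝ} (he0 : e ≠ 0) {l : ℝ}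
    (hl : 1 < |l|) (he : act (P N) e = l • e) (n : ℤ) : 0 < q (s n) (act (P n)⁻¹ e) := by
  have hl0 : l ≠ 0 := by
    rintro rfl
    norm_num at hl
  refine q_pos_of_nrm_lt (u := fun n => act (P n)⁻¹ e) h.red (hP.orbit e) (N := N) (fun n => ?_) n
  rw [hP.orbit_add h.per hl0 he, nrm_smul]
  have h1 := nrm_pos (Frames.orbit_ne_zero (P := P) he0 n)
  have h2 : l⁻¹ ^ 2 < 1 := by
    rw [sq_lt_one_iff_abs_lt_one, abs_inv]
    exact inv_lt_one_of_one_lt₀ hl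
  nlinarith

/-- The repelling eigenvector of the holonomy lies, in every frame, on the side behind. -/
lemma Frames.q_contracting (hP : Frames s P) (h : PerSeq s N) {e : ℝ × ℝ} (he0 : e ≠ 0) {l : ℝ}
    (hl : 1 < |l|) (he : act (P N) e = l⁻¹ • e) (n : ℤ) :
    0 < q (s (n - 1)) (act (P n)⁻¹ e) := by
  have hl0 : l ≠ 0 := by
    rintro rfl
    norm_num at hl
  have h3 := q_neg_of_nrm_lt (u := fun n => act (P n)⁻¹ e) h.red (hP.orbit e) (N := N)
    (fun n => by
      rw [hP.orbit_add h.per (inv_ne_zero hl0) he, nrm_smul, inv_inv]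
      have h1 := nrm_pos (Frames.orbit_ne_zero (P := P) he0 n)
      have h2 : 1 < l ^ 2 := by
        rwa [one_lt_sq_iff_one_lt_abs]
      nlinarith) (n - 1)
  have h4 := hP.orbit e (n - 1)
  rw [sub_add_cancel] at h4
  rw [h4, q_act_R]
  linarith

lemma mul_self_of_det_one {M : Matrix (Fin 2) (Fin 2) ℤ} (hM : M.det = 1) :
    M * M = M.trace • M - 1 := by
  rw [Matrix.det_fin_two] at hM
  ext i j
  fin_cases i <;> fin_cases j <;>
    simp only [Matrix.mul_apply, Matrix.trace_fin_two, Fin.sum_univ_two, Matrix.sub_apply,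
      Matrix.smul_apply, smul_eq_mul, Fin.zero_eta, Fin.mk_one, Matrix.one_apply_eq, ne_eq,
      zero_ne_one, one_ne_zero, not_false_eq_true, Matrix.one_apply_ne] <;>
    first | linear_combination -hM | ring1

lemma pow_twelve_eq_one {M : Matrix (Fin 2) (Fin 2) ℤ} (hM : M.det = 1)
    (ht : |M.trace| ≤ 1) : M ^ 12 = 1 := by
  have h := mul_self_of_det_one hM
  have ht' : M.trace = -1 ∨ M.trace = 0 ∨ M.trace = 1 := by
    rw [abs_le] at ht
    omega
  have h12 : M ^ 12 = (M * M * M) * (M * M * M) * ((M * M * M) * (M * M * M)) := by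
    simp only [pow_succ, pow_zero, one_mul, mul_assoc]
  have h12' : M ^ 12 = (M * M) * (M * M) * ((M * M) * (M * M)) * ((M * M) * (M * M)) := by
    simp only [pow_succ, pow_zero, one_mul, mul_assoc]
  rcases ht' with ht | ht | ht <;> rw [ht] at h
  · have h3 : M * M * M = 1 := by
      rw [h, sub_mul, smul_mul_assoc, h]
      simp
    rw [h12, h3]; simp
  · rw [h12', h]
    simp
  · have h3 : M * M * M = -1 := by
      rw [h, sub_mul, smul_mul_assoc, h]
      simp
    rw [h12, h3]; simp

lemma exists_eigenvector_of_trace {g : GL (Fin 2) ℤ} (hdet : g.1.det = 1) {t : ℤ}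
    (ht : t ^ 2 = 1) (htr : g.1.trace = 2 * t) : ∃ e : ℝ × ℝ, e ≠ 0 ∧ act g e = (t : ℝ) • e := by
  rw [Matrix.det_fin_two] at hdet
  rw [Matrix.trace_fin_two] at htr
  have hdet' : (g.1 0 0 : ℝ) * g.1 1 1 - g.1 0 1 * g.1 1 0 = 1 := by exact_mod_cast hdet
  have htr' : (g.1 0 0 : ℝ) + g.1 1 1 = 2 * t := by exact_mod_cast htr
  have ht' : (t : ℝ) ^ 2 = 1 := by exact_mod_cast ht
  by_cases hc : (g.1 1 0 : ℝ) = 0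
  · have ha : (g.1 0 0 : ℝ) = t := by
      have : ((g.1 0 0 : ℝ) - t) ^ 2 = 0 := by
        rw [hc] at hdet'
        linear_combination (g.1 0 0 : ℝ) * htr' - hdet' + ht'
      have := pow_eq_zero_iff (two_ne_zero) |>.1 this
      linarith
    exact ⟨(1, 0), by simp, by simp [act, hc, ha]⟩
  · refine ⟨((t : ℝ) - g.1 1 1, g.1 1 0), fun h => hc (congrArg Prod.snd h), ?_⟩
    simp only [act, Prod.smul_mk, smul_eq_mul]
    ext
    · simp only
      linear_combination (t : ℝ) * htr' - hdet' + ht'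
    · simp only
      ring

lemma Frames.two_lt_abs_trace (hP : Frames s P) (h : PerSeq s N) (hdet : (P N).1.det = 1) :
    2 < |(P N).1.trace| := by
  by_contra! hle
  rcases le_or_gt |(P N).1.trace| 1 with h1 | h1
  · have h12 : P N ^ 12 = 1 := Units.ext (pow_twelve_eq_one hdet h1)
    have hne : ∀ a : ZMod 3, ∃ b, b ≠ a := by decide
    obtain ⟨b, hb⟩ := hne (s 0)
    obtain ⟨e, he⟩ := exists_q_pos b
    have h2 : q (s 0) (act (P 0)⁻¹ e) < 0 := by
      rw [hP.zero, inv_one, act_one]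
      exact q_neg_of_pos hb he
    have h3 := nrm_succ (u := fun n => act (P n)⁻¹ e) (hP.orbit e) 0
    have h4 := q_nonpos_succ (u := fun n => act (P n)⁻¹ e) h.red (hP.orbit e) h2.le
    have h5 := nrm_le_add (u := fun n => act (P n)⁻¹ e) h.red (hP.orbit e) h4 (12 * N - 1)
    have h6 : (0 : ℤ) + 1 + ((12 * N - 1 : ℕ) : ℤ) = 0 + 12 * N := by
      have := h.pos
      omega
    rw [zero_add] at h3
    rw [h6, hP.add_mul_period h.per 0 12, show (12 : ℤ) = ((12 : ℕ) : ℤ) by rfl, zpow_natCast,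
      h12, one_mul] at h5
    linarith
  · have h2 : |(P N).1.trace| = 2 := by omega
    obtain ⟨t, ht, htr⟩ : ∃ t : ℤ, t ^ 2 = 1 ∧ (P N).1.trace = 2 * t := by
      rcases (abs_eq (by norm_num)).1 h2 with h3 | h3
      · exact ⟨1, by norm_num, by rw [h3]; norm_num⟩
      · exact ⟨-1, by norm_num, by rw [h3]; norm_num⟩
    obtain ⟨e, he0, he⟩ := exists_eigenvector_of_trace hdet ht htr
    have ht' : (t : ℝ) ^ 2 = 1 := by exact_mod_cast ht
    have ht0 : (t : ℝ) ≠ 0 := by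
      intro h0
      rw [h0] at ht'
      norm_num at ht'
    obtain ⟨n, hn⟩ := eq_zero_of_nrm_periodic (u := fun n => act (P n)⁻¹ e) h.red h.surj
      (hP.orbit e) h.pos (fun n => by
        rw [hP.orbit_add h.per ht0 he, nrm_smul, inv_pow, ht', inv_one, one_mul])
    exact Frames.orbit_ne_zero he0 n hn

end Strip

namespace Strip

/-- The area form on the plane. -/
def br (u v : ℝ × ℝ) : ℝ := u.1 * v.2 - u.2 * v.1

/-- The product of brackets whose sign decides whether two pairs of directions are linked. -/
def chi (e₁ e₂ f₁ f₂ : ℝ × ℝ) : ℝ := br e₁ f₁ * br e₂ f₂ * (br e₁ f₂ * br e₂ f₁)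

lemma br_swap (u v : ℝ × ℝ) : br v u = - br u v := by
  simp only [br]; ring

lemma br_act (g : GL (Fin 2) ℤ) (u v : ℝ × ℝ) : br (act g u) (act g v) = g.1.det * br u v := by
  rw [Matrix.det_fin_two]
  simp only [br, act]
  push_cast
  ring

lemma det_sq (g : GL (Fin 2) ℤ) : ((g.1.det : ℤ) : ℝ) ^ 2 = 1 := by
  have h : IsUnit g.1.det := (Matrix.isUnit_iff_isUnit_det _).1 g.isUnit
  have := Int.isUnit_iff.1 h
  rcases this with h | h <;> rw [h] <;> norm_num

lemma chi_act (g : GL (Fin 2) ℤ) (e₁ e₂ f₁ f₂ : ℝ × ℝ) :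
    chi (act g e₁) (act g e₂) (act g f₁) (act g f₂) = chi e₁ e₂ f₁ f₂ := by
  simp only [chi, br_act]
  have := det_sq g
  generalize ((g.1.det : ℤ) : ℝ) = d at this
  linear_combination (d ^ 2 + 1) * br e₁ f₁ * br e₂ f₂ * (br e₁ f₂ * br e₂ f₁) * this

lemma chi_swap_left (e₁ e₂ f₁ f₂ : ℝ × ℝ) : chi e₂ e₁ f₁ f₂ = chi e₁ e₂ f₁ f₂ := by
  simp only [chi]; ring

lemma chi_swap_right (e₁ e₂ f₁ f₂ : ℝ × ℝ) : chi e₁ e₂ f₂ f₁ = chi e₁ e₂ f₁ f₂ := by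
  simp only [chi]; ring

/-- The inclusion of `SL₂(ℤ)` in `GL₂(ℤ)`. -/
abbrev toG : SL2Z →* GL (Fin 2) ℤ := Matrix.SpecialLinearGroup.toGL

lemma act_toG (g : SL2Z) (u : ℝ × ℝ) :
    act (toG g) u = (entry g 0 0 * u.1 + entry g 0 1 * u.2, entry g 1 0 * u.1 + entry g 1 1 * u.2) :=
  rfl

lemma toG_injective : Function.Injective toG := by
  intro g h hgh
  exact Subtype.ext (congrArg Units.val hgh)

lemma entry_det (g : SL2Z) : entry g 0 0 * entry g 1 1 - entry g 0 1 * entry g 1 0 = 1 := by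
  have := g.2
  rw [Matrix.det_fin_two] at this
  simp only [entry]
  exact_mod_cast this

lemma hyperbolic_iff (g : SL2Z) : Hyperbolic g ↔ 2 < |entry g 0 0 + entry g 1 1| := by
  unfold Hyperbolic entry
  rw [Matrix.trace_fin_two]
  exact_mod_cast Iff.rfl

lemma _root_.Hyperbolic.entry_ne_zero {g : SL2Z} (hg : Hyperbolic g) : entry g 1 0 ≠ 0 := by
  intro h0
  have h1 := entry_det g
  have h3 : g.1 0 0 * g.1 1 1 = 1 := by
    rw [h0, mul_zero, sub_zero] at h1
    simp only [entry] at h1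
    exact_mod_cast h1
  unfold Hyperbolic at hg
  rw [Matrix.trace_fin_two] at hg
  rcases Int.mul_eq_one_iff_eq_one_or_neg_one.1 h3 with ⟨h4, h5⟩ | ⟨h4, h5⟩ <;>
    · rw [h4, h5] at hg
      norm_num at hg

lemma _root_.Hyperbolic.conj {g : SL2Z} (hg : Hyperbolic g) (h : SL2Z) : Hyperbolic (h * g * h⁻¹) := by
  unfold Hyperbolic at *
  have : (h * g * h⁻¹).1.trace = g.1.trace := by
    have h1 : (h * g * h⁻¹).1 = (h * g).1 * (h⁻¹).1 := rfl
    have h2 : (h⁻¹).1 * (h * g).1 = (h⁻¹ * (h * g)).1 := rfl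
    rw [h1, Matrix.trace_mul_comm, h2, inv_mul_cancel_left]
  rwa [this]

/-- A pair of independent eigenvectors of a hyperbolic element, expanding and contracting. -/
structure Axis (g : GL (Fin 2) ℤ) (e₁ e₂ : ℝ × ℝ) (l : ℝ) : Prop where
  one_lt : 1 < |l|
  eigen₁ : act g e₁ = l • e₁
  eigen₂ : act g e₂ = l⁻¹ • e₂
  indep : br e₁ e₂ ≠ 0

lemma Axis.ne_zero {g : GL (Fin 2) ℤ} {e₁ e₂ : ℝ × ℝ} {l : ℝ} (h : Axis g e₁ e₂ l) : l ≠ 0 := by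
  have := h.one_lt
  rintro rfl
  norm_num at this

lemma Axis.left_ne {g : GL (Fin 2) ℤ} {e₁ e₂ : ℝ × ℝ} {l : ℝ} (h : Axis g e₁ e₂ l) : e₁ ≠ 0 := by
  rintro rfl
  exact h.indep (by simp [br])

lemma Axis.right_ne {g : GL (Fin 2) ℤ} {e₁ e₂ : ℝ × ℝ} {l : ℝ} (h : Axis g e₁ e₂ l) : e₂ ≠ 0 := by
  rintro rfl
  exact h.indep (by simp [br])

lemma Axis.conj {g : GL (Fin 2) ℤ} {e₁ e₂ : ℝ × ℝ} {l : ℝ} (h : Axis g e₁ e₂ l)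
    (k : GL (Fin 2) ℤ) : Axis (k * g * k⁻¹) (act k e₁) (act k e₂) l := by
  refine ⟨h.one_lt, ?_, ?_, ?_⟩
  · rw [mul_assoc, act_mul, act_mul, act_inv_act, h.eigen₁, act_smul]
  · rw [mul_assoc, act_mul, act_mul, act_inv_act, h.eigen₂, act_smul]
  · rw [br_act]
    have := det_sq k
    refine mul_ne_zero (fun h0 => ?_) h.indep
    rw [h0] at this
    norm_num at this

lemma _root_.Hyperbolic.exists_axis {g : SL2Z} (hg : Hyperbolic g) :
    ∃ e₁ e₂ l, Axis (toG g) e₁ e₂ l := by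
  have hc := hg.entry_ne_zero
  have hdet := entry_det g
  rw [hyperbolic_iff] at hg
  set a := entry g 0 0
  set b := entry g 0 1
  set c := entry g 1 0
  set d := entry g 1 1
  obtain ⟨l, hl, hq⟩ : ∃ l : ℝ, 1 < |l| ∧ l ^ 2 - (a + d) * l + 1 = 0 := by
    have hsq : 4 < (a + d) ^ 2 := by
      rw [← sq_abs]; nlinarith
    have hr := Real.sq_sqrt (show 0 ≤ (a + d) ^ 2 - 4 by linarith)
    have hr0 := Real.sqrt_nonneg ((a + d) ^ 2 - 4)
    rcases lt_abs.1 hg with h | h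
    · refine ⟨(a + d + Real.sqrt ((a + d) ^ 2 - 4)) / 2, lt_abs.2 (Or.inl (by linarith)), ?_⟩
      linear_combination hr / 4
    · refine ⟨(a + d - Real.sqrt ((a + d) ^ 2 - 4)) / 2, lt_abs.2 (Or.inr (by linarith)), ?_⟩
      linear_combination hr / 4
  have hl0 : l ≠ 0 := by
    rintro rfl
    norm_num at hl
  have hinv : l⁻¹ = a + d - l := by
    field_simp
    linear_combination hq
  refine ⟨(l - d, c), (l⁻¹ - d, c), l, hl, ?_, ?_, ?_⟩
  · rw [act_toG]
    ext
    · simp only [Prod.smul_mk, smul_eq_mul]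
      linear_combination -hq - hdet
    · simp only [Prod.smul_mk, smul_eq_mul]
      ring
  · rw [act_toG, hinv]
    ext
    · simp only [Prod.smul_mk, smul_eq_mul]
      linear_combination -hq - hdet
    · simp only [Prod.smul_mk, smul_eq_mul]
      ring
  · simp only [br]
    have h1 : l ≠ l⁻¹ := by
      intro h
      have h2 : |l| = |l|⁻¹ := by rw [← abs_inv, ← h]
      have := inv_lt_one_of_one_lt₀ hl
      linarith
    have h2 : (l - d) * c - c * (l⁻¹ - d) = (l - l⁻¹) * c := by ring
    rw [h2]
    exact mul_ne_zero (sub_ne_zero.2 h1) hc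

end Strip

namespace Strip

lemma mobius_infty (g : SL2Z) (hc : entry g 1 0 ≠ 0) :
    mobius g OnePoint.infty = ((entry g 0 0 / entry g 1 0 : ℝ) : OnePoint ℝ) := by
  show (if entry g 1 0 = 0 then OnePoint.infty
     else OnePoint.some (entry g 0 0 / entry g 1 0)) = _
  rw [if_neg hc]

lemma mobius_coe (g : SL2Z) (x : ℝ) :
    mobius g (x : OnePoint ℝ) = if entry g 1 0 * x + entry g 1 1 = 0 then OnePoint.infty
      else OnePoint.some ((entry g 0 0 * x + entry g 0 1) / (entry g 1 0 * x + entry g 1 1)) := rfl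

lemma mem_fixedSet_coe (g : SL2Z) (x : ℝ) : (x : OnePoint ℝ) ∈ fixedSet g ↔
    entry g 1 0 * x + entry g 1 1 ≠ 0 ∧
      entry g 0 0 * x + entry g 0 1 = x * (entry g 1 0 * x + entry g 1 1) := by
  show mobius g _ = _ ↔ _
  rw [mobius_coe]
  split_ifs with h
  · simp [h]
  · simp only [ne_eq, h, not_false_eq_true, true_and]
    rw [OnePoint.some_eq_iff, div_eq_iff h]

lemma infty_notMem_fixedSet {g : SL2Z} (hc : entry g 1 0 ≠ 0) :
    OnePoint.infty ∉ fixedSet g := by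
  intro h
  have h' : mobius g OnePoint.infty = OnePoint.infty := h
  rw [mobius_infty g hc] at h'
  exact OnePoint.coe_ne_infty _ h'

lemma snd_ne_zero_of_eigen {g : SL2Z} (hc : entry g 1 0 ≠ 0) {e : ℝ × ℝ} {l : ℝ}
    (he : act (toG g) e = l • e) (h0 : e ≠ 0) : e.2 ≠ 0 := by
  intro h2
  have h3 := congrArg Prod.snd he
  rw [act_toG] at h3
  simp only [h2, Prod.smul_snd, smul_eq_mul, mul_zero, add_zero, mul_eq_zero] at h3
  exact h0 (Prod.ext (h3.resolve_left hc) h2)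

lemma mem_fixedSet_of_eigen {g : SL2Z} (hc : entry g 1 0 ≠ 0) {e : ℝ × ℝ} {l : ℝ} (hl : l ≠ 0)
    (he : act (toG g) e = l • e) (h0 : e ≠ 0) : ((e.1 / e.2 : ℝ) : OnePoint ℝ) ∈ fixedSet g := by
  have h2 := snd_ne_zero_of_eigen hc he h0
  have h3 := congrArg Prod.fst he
  have h4 := congrArg Prod.snd he
  rw [act_toG] at h3 h4
  simp only [Prod.smul_snd, Prod.smul_fst, smul_eq_mul] at h3 h4
  have h5 : entry g 1 0 * (e.1 / e.2) + entry g 1 1 = l := by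
    field_simp
    linear_combination h4
  rw [mem_fixedSet_coe, h5]
  refine ⟨hl, ?_⟩
  field_simp
  linear_combination h3

lemma div_ne_div_of_br {e f : ℝ × ℝ} (he : e.2 ≠ 0) (hf : f.2 ≠ 0) (h : br e f ≠ 0) :
    e.1 / e.2 ≠ f.1 / f.2 := by
  intro h1
  rw [div_eq_div_iff he hf] at h1
  exact h (by rw [br]; linear_combination h1)

lemma Axis.fixedSet_eq {g : SL2Z} (hg : Hyperbolic g) {e₁ e₂ : ℝ × ℝ} {l : ℝ}
    (h : Axis (toG g) e₁ e₂ l) : e₁.2 ≠ 0 ∧ e₂.2 ≠ 0 ∧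
      fixedSet g = {((e₁.1 / e₁.2 : ℝ) : OnePoint ℝ), ((e₂.1 / e₂.2 : ℝ) : OnePoint ℝ)} := by
  have hc := hg.entry_ne_zero
  have h1 := snd_ne_zero_of_eigen hc h.eigen₁ h.left_ne
  have h2 := snd_ne_zero_of_eigen hc h.eigen₂ h.right_ne
  have m1 := mem_fixedSet_of_eigen hc h.ne_zero h.eigen₁ h.left_ne
  have m2 := mem_fixedSet_of_eigen hc (inv_ne_zero h.ne_zero) h.eigen₂ h.right_ne
  refine ⟨h1, h2, Set.Subset.antisymm (fun p hp => ?_) ?_⟩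
  · induction p using OnePoint.rec with
    | infty => exact absurd hp (infty_notMem_fixedSet hc)
    | coe x =>
      have hne := div_ne_div_of_br h1 h2 h.indep
      rw [mem_fixedSet_coe] at hp m1 m2
      generalize e₁.1 / e₁.2 = p at *
      generalize e₂.1 / e₂.2 = r at *
      have h3 : (entry g 1 0 * (p + r) + (entry g 1 1 - entry g 0 0)) = 0 := by
        apply mul_left_cancel₀ (sub_ne_zero.2 hne)
        linear_combination m2.2 - m1.2
      have h4 : entry g 1 0 * ((x - p) * (x - r)) = 0 := by
        linear_combination m1.2 - hp.2 - (x - p) * h3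
      rcases mul_eq_zero.1 ((mul_eq_zero.1 h4).resolve_left hc) with h5 | h5
      · left; rw [sub_eq_zero.1 h5]
      · right; rw [Set.mem_singleton_iff, sub_eq_zero.1 h5]
  · rintro p (rfl | rfl)
    · exact m1
    · exact m2

/-! ### Linking of pairs of real points on the circle -/

lemma isPreconnected_coe_image {S : Set ℝ} (hS : IsPreconnected S) :
    IsPreconnected ((fun x : ℝ => (x : OnePoint ℝ)) '' S) :=
  hS.image _ OnePoint.continuous_coe.continuousOn

lemma infty_mem_closure_Iio (p : ℝ) :
    OnePoint.infty ∈ closure ((fun x : ℝ => (x : OnePoint ℝ)) '' Set.Iio p) := by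
  rw [mem_closure_iff]
  intro o ho hinf
  have h1 := (OnePoint.isOpen_iff_of_mem hinf).1 ho
  have h2 : ¬ Set.Iio p ⊆ ((fun x : ℝ => (x : OnePoint ℝ)) ⁻¹' o)ᶜ := by
    intro hsub
    obtain ⟨m, hm⟩ := h1.2.bddBelow
    have h3 := hm (hsub (show min m p - 1 ∈ Set.Iio p by
      have := min_le_right m p
      simp only [Set.mem_Iio]; linarith))
    have := min_le_left m p
    linarith
  obtain ⟨x, hx, hxo⟩ := Set.not_subset.1 h2
  rw [Set.mem_compl_iff, not_not] at hxo
  exact ⟨x, hxo, x, hx, rfl⟩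

lemma infty_mem_closure_Ioi (p : ℝ) :
    OnePoint.infty ∈ closure ((fun x : ℝ => (x : OnePoint ℝ)) '' Set.Ioi p) := by
  rw [mem_closure_iff]
  intro o ho hinf
  have h1 := (OnePoint.isOpen_iff_of_mem hinf).1 ho
  have h2 : ¬ Set.Ioi p ⊆ ((fun x : ℝ => (x : OnePoint ℝ)) ⁻¹' o)ᶜ := by
    intro hsub
    obtain ⟨m, hm⟩ := h1.2.bddAbove
    have h3 := hm (hsub (show max m p + 1 ∈ Set.Ioi p by
      have := le_max_right m p
      simp only [Set.mem_Ioi]; linarith))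
    have := le_max_left m p
    linarith
  obtain ⟨x, hx, hxo⟩ := Set.not_subset.1 h2
  rw [Set.mem_compl_iff, not_not] at hxo
  exact ⟨x, hxo, x, hx, rfl⟩

/-- The complement of a closed interval in the circle is connected. -/
lemma isPreconnected_outside (p r : ℝ) :
    IsPreconnected (insert OnePoint.infty ((fun x : ℝ => (x : OnePoint ℝ)) '' Set.Iio p) ∪
      insert OnePoint.infty ((fun x : ℝ => (x : OnePoint ℝ)) '' Set.Ioi r)) := by
  refine IsPreconnected.union OnePoint.infty (Set.mem_insert _ _) (Set.mem_insert _ _) ?_ ?_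
  · exact (isPreconnected_coe_image isPreconnected_Iio).subset_closure (Set.subset_insert _ _)
      (Set.insert_subset (infty_mem_closure_Iio p) subset_closure)
  · exact (isPreconnected_coe_image isPreconnected_Ioi).subset_closure (Set.subset_insert _ _)
      (Set.insert_subset (infty_mem_closure_Ioi r) subset_closure)

lemma connectedComponentIn_eq_of_isPreconnected {F S : Set (OnePoint ℝ)} (hS : IsPreconnected S)
    (hF : S ⊆ F) {a b : OnePoint ℝ} (ha : a ∈ S) (hb : b ∈ S) :
    connectedComponentIn F a = connectedComponentIn F b :=
  connectedComponentIn_eq (hS.subset_connectedComponentIn ha hF hb)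

lemma connectedComponentIn_ne {p r x y : ℝ} (hx : x ∈ Set.Ioo p r) (hy : y ∉ Set.Icc p r) :
    connectedComponentIn ({(p : OnePoint ℝ), (r : OnePoint ℝ)} : Set (OnePoint ℝ))ᶜ x ≠
      connectedComponentIn ({(p : OnePoint ℝ), (r : OnePoint ℝ)} : Set (OnePoint ℝ))ᶜ y := by
  intro h
  set F := ({(p : OnePoint ℝ), (r : OnePoint ℝ)} : Set (OnePoint ℝ))ᶜ with hF
  let U : Set (OnePoint ℝ) := (fun x : ℝ => (x : OnePoint ℝ)) '' Set.Ioo p r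
  let V : Set (OnePoint ℝ) := ((fun x : ℝ => (x : OnePoint ℝ)) '' Set.Icc p r)ᶜ
  have hU : IsOpen U := OnePoint.isOpen_image_coe.2 isOpen_Ioo
  have hV : IsOpen V :=
    OnePoint.isOpen_compl_image_coe.2 ⟨isClosed_Icc, isCompact_Icc⟩
  have hUV : U ∩ V = ∅ := by
    ext z
    simp only [Set.mem_inter_iff, Set.mem_empty_iff_false, iff_false, not_and]
    rintro ⟨t, ht, rfl⟩ hz
    exact hz ⟨t, Set.Ioo_subset_Icc_self ht, rfl⟩
  have hcov : F ⊆ U ∪ V := by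
    intro z hz
    by_contra hn
    rw [Set.mem_union, not_or] at hn
    obtain ⟨t, ht, rfl⟩ := not_not.1 hn.2
    rcases eq_or_lt_of_le ht.1 with rfl | h1
    · exact hz (Or.inl rfl)
    rcases eq_or_lt_of_le ht.2 with rfl | h2
    · exact hz (Or.inr rfl)
    exact hn.1 ⟨t, ⟨h1, h2⟩, rfl⟩
  have hxF : (x : OnePoint ℝ) ∈ F := by
    rintro (h1 | h1)
    · rw [OnePoint.coe_eq_coe] at h1; exact absurd hx.1 (by rw [h1]; exact lt_irrefl _)
    · rw [Set.mem_singleton_iff, OnePoint.coe_eq_coe] at h1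
      exact absurd hx.2 (by rw [h1]; exact lt_irrefl _)
  have hyF : (y : OnePoint ℝ) ∈ F := by
    have hpr := hx.1.trans hx.2
    rintro (h1 | h1)
    · rw [OnePoint.coe_eq_coe] at h1
      exact hy (by rw [h1]; exact ⟨le_rfl, hpr.le⟩)
    · rw [Set.mem_singleton_iff, OnePoint.coe_eq_coe] at h1
      exact hy (by rw [h1]; exact ⟨hpr.le, le_rfl⟩)
  have hsub : connectedComponentIn F x ⊆ U :=
    IsPreconnected.subset_left_of_subset_union hU hV (Set.disjoint_iff_inter_eq_empty.2 hUV)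
      ((connectedComponentIn_subset F _).trans hcov)
      ⟨x, mem_connectedComponentIn hxF, x, hx, rfl⟩ isPreconnected_connectedComponentIn
  have hyU : (y : OnePoint ℝ) ∈ U := hsub (h ▸ mem_connectedComponentIn hyF)
  obtain ⟨t, ht, h2⟩ := hyU
  rw [OnePoint.coe_eq_coe] at h2
  exact hy (h2 ▸ Set.Ioo_subset_Icc_self ht)

lemma linked_of_chi_neg {p r x y : ℝ} (h : (p - x) * (r - y) * ((p - y) * (r - x)) < 0) :
    Linked {(p : OnePoint ℝ), (r : OnePoint ℝ)} {(x : OnePoint ℝ), (y : OnePoint ℝ)} := by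
  wlog hpr : p ≤ r generalizing p r
  · rw [Set.pair_comm]
    exact this (by linarith) (le_of_not_ge hpr)
  have hxy : ((p - x) * (r - x)) * ((p - y) * (r - y)) < 0 := by linarith
  have key : ∀ t : ℝ, (p - t) * (r - t) < 0 → t ∈ Set.Ioo p r := by
    intro t ht
    rcases mul_neg_iff.1 ht with ⟨h1, h2⟩ | ⟨h1, h2⟩
    · linarith
    · exact ⟨by linarith, by linarith⟩
  have key' : ∀ t : ℝ, 0 < (p - t) * (r - t) → t ∉ Set.Icc p r := by
    intro t ht ⟨h1, h2⟩
    nlinarith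
  have hne : (x : OnePoint ℝ) ≠ (y : OnePoint ℝ) := by
    intro h1
    rw [OnePoint.coe_eq_coe] at h1
    rw [h1] at hxy
    nlinarith [mul_self_nonneg ((p - y) * (r - y))]
  refine ⟨x, y, hne, rfl, ?_⟩
  rcases mul_neg_iff.1 hxy with ⟨h1, h2⟩ | ⟨h1, h2⟩
  · exact (connectedComponentIn_ne (key y h2) (key' x h1)).symm
  · exact connectedComponentIn_ne (key x h1) (key' y h2)

lemma not_linked_of_chi_pos {p r x y : ℝ} (h : 0 < (p - x) * (r - y) * ((p - y) * (r - x))) :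
    ¬ Linked {(p : OnePoint ℝ), (r : OnePoint ℝ)} {(x : OnePoint ℝ), (y : OnePoint ℝ)} := by
  wlog hpr : p ≤ r generalizing p r
  · rw [Set.pair_comm]
    exact this (by linarith) (le_of_not_ge hpr)
  have hxy : 0 < ((p - x) * (r - x)) * ((p - y) * (r - y)) := by linarith
  have main : connectedComponentIn ({(p : OnePoint ℝ), (r : OnePoint ℝ)} : Set (OnePoint ℝ))ᶜ x =
      connectedComponentIn ({(p : OnePoint ℝ), (r : OnePoint ℝ)} : Set (OnePoint ℝ))ᶜ y := by
    rcases mul_pos_iff.1 hxy with ⟨h1, h2⟩ | ⟨h1, h2⟩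
    · have key : ∀ t : ℝ, 0 < (p - t) * (r - t) → t < p ∨ r < t := by
        intro t ht
        rcases mul_pos_iff.1 ht with ⟨h3, h4⟩ | ⟨h3, h4⟩
        · left; linarith
        · right; linarith
      have mem : ∀ t : ℝ, 0 < (p - t) * (r - t) → (t : OnePoint ℝ) ∈
          (insert OnePoint.infty ((fun x : ℝ => (x : OnePoint ℝ)) '' Set.Iio p) ∪
            insert OnePoint.infty ((fun x : ℝ => (x : OnePoint ℝ)) '' Set.Ioi r)) := by
        intro t ht
        rcases key t ht with h3 | h3
        · exact Or.inl (Or.inr ⟨t, h3, rfl⟩)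
        · exact Or.inr (Or.inr ⟨t, h3, rfl⟩)
      refine connectedComponentIn_eq_of_isPreconnected (isPreconnected_outside p r) ?_
        (mem x h1) (mem y h2)
      rintro z ((rfl | ⟨t, ht, rfl⟩) | (rfl | ⟨t, ht, rfl⟩)) <;> rintro (h3 | h3)
      · exact OnePoint.infty_ne_coe _ h3
      · exact OnePoint.infty_ne_coe _ h3
      · rw [OnePoint.coe_eq_coe] at h3; exact absurd ht (by simp [h3])
      · rw [Set.mem_singleton_iff, OnePoint.coe_eq_coe] at h3
        exact absurd ht (by simp [h3, hpr])
      · exact OnePoint.infty_ne_coe _ h3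
      · exact OnePoint.infty_ne_coe _ h3
      · rw [OnePoint.coe_eq_coe] at h3; exact absurd ht (by simp [h3, hpr])
      · rw [Set.mem_singleton_iff, OnePoint.coe_eq_coe] at h3
        exact absurd ht (by simp [h3])
    · have key : ∀ t : ℝ, (p - t) * (r - t) < 0 → t ∈ Set.Ioo p r := by
        intro t ht
        rcases mul_neg_iff.1 ht with ⟨h1, h2⟩ | ⟨h1, h2⟩
        · linarith
        · exact ⟨by linarith, by linarith⟩
      refine connectedComponentIn_eq_of_isPreconnected
        (isPreconnected_coe_image (isPreconnected_Ioo (a := p) (b := r))) ?_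
        ⟨x, key x h1, rfl⟩ ⟨y, key y h2, rfl⟩
      rintro z ⟨t, ht, rfl⟩ (h3 | h3)
      · rw [OnePoint.coe_eq_coe] at h3; exact absurd ht.1 (by simp [h3])
      · rw [Set.mem_singleton_iff, OnePoint.coe_eq_coe] at h3
        exact absurd ht.2 (by simp [h3])
  rintro ⟨a, b, hab, hset, hne⟩
  have hmem : ∀ z ∈ ({a, b} : Set (OnePoint ℝ)), z = x ∨ z = y := by
    intro z hz
    rw [← hset] at hz
    exact hz
  rcases hmem a (by simp) with rfl | rfl <;> rcases hmem b (by simp) with rfl | rfl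
  · exact hab rfl
  · exact hne main
  · exact hne main.symm
  · exact hab rfl

end Strip

namespace Strip

/-- The quadratic polynomial whose real roots are the fixed points of `g`. -/
lemma mem_fixedSet_coe_iff (g : SL2Z) (x : ℝ) : (x : OnePoint ℝ) ∈ fixedSet g ↔
    entry g 1 0 * x ^ 2 + (entry g 1 1 - entry g 0 0) * x - entry g 0 1 = 0 := by
  rw [mem_fixedSet_coe]
  have hdet := entry_det g
  constructor
  · rintro ⟨-, h⟩
    linear_combination -h
  · intro h
    refine ⟨fun h0 => ?_, by linear_combination -h⟩
    have h1 : entry g 0 0 * x + entry g 0 1 = 0 := by linear_combination -h + x * h0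
    have : (0 : ℝ) = 1 := by linear_combination hdet - entry g 0 0 * h0 + entry g 1 0 * h1
    norm_num at this

lemma irrational_of_mem_fixedSet {g : SL2Z} (hg : Hyperbolic g) {x : ℝ}
    (hx : (x : OnePoint ℝ) ∈ fixedSet g) : Irrational x := by
  rw [mem_fixedSet_coe_iff] at hx
  rintro ⟨y, rfl⟩
  have hdet := entry_det g
  have h1 : (2 * entry g 1 0 * y + (entry g 1 1 - entry g 0 0)) ^ 2 =
      (entry g 0 0 + entry g 1 1) ^ 2 - 4 := by
    linear_combination 4 * entry g 1 0 * hx - 4 * hdet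
  simp only [entry] at h1
  have h2 : (2 * (g.1 1 0 : ℚ) * y + (g.1 1 1 - g.1 0 0)) ^ 2 =
      (((g.1 0 0 + g.1 1 1) ^ 2 - 4 : ℤ) : ℚ) := by
    exact_mod_cast h1
  have h3 : IsSquare (((g.1 0 0 + g.1 1 1) ^ 2 - 4 : ℤ) : ℚ) := ⟨_, by rw [← h2, sq]⟩
  rw [Rat.isSquare_intCast_iff] at h3
  obtain ⟨m, hm⟩ := h3
  unfold Hyperbolic at hg
  rw [Matrix.trace_fin_two] at hg
  generalize g.1 0 0 + g.1 1 1 = t at *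
  have h4 : t ^ 2 = |t| ^ 2 := (sq_abs t).symm
  have h5 : m * m = |m| * |m| := (abs_mul_abs_self m).symm
  rw [h4, h5] at hm
  have h6 := abs_nonneg m
  generalize |m| = k at *
  generalize |t| = T at *
  have h7 : k < T := by nlinarith
  have h8 : T - 1 < k := by nlinarith
  omega

lemma fixedSet_eq_of_shared {g g' : SL2Z} (hg : Hyperbolic g) (hg' : Hyperbolic g') {x : ℝ}
    (hx : (x : OnePoint ℝ) ∈ fixedSet g) (hx' : (x : OnePoint ℝ) ∈ fixedSet g') :
    fixedSet g = fixedSet g' := by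
  have hirr := irrational_of_mem_fixedSet hg hx
  rw [mem_fixedSet_coe_iff] at hx hx'
  have hc := hg.entry_ne_zero
  have hc' := hg'.entry_ne_zero
  have key : (entry g' 1 0 * (entry g 1 1 - entry g 0 0) -
      entry g 1 0 * (entry g' 1 1 - entry g' 0 0)) * x =
      entry g' 1 0 * entry g 0 1 - entry g 1 0 * entry g' 0 1 := by
    linear_combination entry g' 1 0 * hx - entry g 1 0 * hx'
  have h1 : entry g' 1 0 * (entry g 1 1 - entry g 0 0) -
      entry g 1 0 * (entry g' 1 1 - entry g' 0 0) = 0 := by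
    by_contra hne
    have h2 : x = (entry g' 1 0 * entry g 0 1 - entry g 1 0 * entry g' 0 1) /
        (entry g' 1 0 * (entry g 1 1 - entry g 0 0) -
          entry g 1 0 * (entry g' 1 1 - entry g' 0 0)) := by
      rw [eq_div_iff hne, mul_comm, key]
    refine hirr ⟨(((g'.1 1 0 * g.1 0 1 - g.1 1 0 * g'.1 0 1 : ℤ) : ℚ) /
      ((g'.1 1 0 * (g.1 1 1 - g.1 0 0) - g.1 1 0 * (g'.1 1 1 - g'.1 0 0) : ℤ) : ℚ)), ?_⟩
    rw [h2]
    simp only [entry]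
    push_cast
    rfl
  rw [h1, zero_mul] at key
  ext z
  induction z using OnePoint.rec with
  | infty => exact iff_of_false (infty_notMem_fixedSet hc) (infty_notMem_fixedSet hc')
  | coe y =>
    rw [mem_fixedSet_coe_iff, mem_fixedSet_coe_iff]
    constructor
    · intro h
      apply mul_left_cancel₀ hc
      linear_combination entry g' 1 0 * h - y * h1 - key
    · intro h
      apply mul_left_cancel₀ hc'
      linear_combination entry g 1 0 * h + y * h1 + key

lemma not_linked_self (S : Set (OnePoint ℝ)) : ¬ Linked S S := by
  rintro ⟨a, b, -, hS, hne⟩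
  apply hne
  rw [connectedComponentIn_eq_empty (by simp [hS]), connectedComponentIn_eq_empty (by simp [hS])]

lemma br_eq {e f : ℝ × ℝ} (he : e.2 ≠ 0) (hf : f.2 ≠ 0) :
    br e f = e.2 * f.2 * (e.1 / e.2 - f.1 / f.2) := by
  rw [br]
  field_simp

lemma chi_eq {e₁ e₂ f₁ f₂ : ℝ × ℝ} (h₁ : e₁.2 ≠ 0) (h₂ : e₂.2 ≠ 0) (k₁ : f₁.2 ≠ 0)
    (k₂ : f₂.2 ≠ 0) : chi e₁ e₂ f₁ f₂ = (e₁.2 * e₂.2 * f₁.2 * f₂.2) ^ 2 *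
      ((e₁.1 / e₁.2 - f₁.1 / f₁.2) * (e₂.1 / e₂.2 - f₂.1 / f₂.2) *
        ((e₁.1 / e₁.2 - f₂.1 / f₂.2) * (e₂.1 / e₂.2 - f₁.1 / f₁.2))) := by
  rw [chi, br_eq h₁ k₁, br_eq h₂ k₂, br_eq h₁ k₂, br_eq h₂ k₁]
  ring

/-- A double coset is counted exactly when the two axes strictly cross. -/
lemma goodConj_iff {v : Gamma} (hv : Hyperbolic (v : SL2Z)) {e₁ e₂ : ℝ × ℝ} {l : ℝ}
    (ax : Axis (toG v) e₁ e₂ l) (h : Gamma) :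
    GoodConj v h ↔ chi e₁ e₂ (act (toG h) e₁) (act (toG h) e₂) < 0 := by
  have hv' : Hyperbolic ((h * v * h⁻¹ : Gamma) : SL2Z) := hv.conj h
  have ax' : Axis (toG ((h * v * h⁻¹ : Gamma) : SL2Z)) (act (toG h) e₁) (act (toG h) e₂) l := by
    have := ax.conj (toG h)
    rwa [← map_inv, ← map_mul, ← map_mul] at this
  obtain ⟨n1, n2, hs⟩ := ax.fixedSet_eq hv
  obtain ⟨n1', n2', hs'⟩ := ax'.fixedSet_eq hv'
  have hpos : 0 < (e₁.2 * e₂.2 * (act (toG h) e₁).2 * (act (toG h) e₂).2) ^ 2 := by positivity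
  rw [chi_eq n1 n2 n1' n2', GoodConj, and_iff_right hv, and_iff_right hv']
  constructor
  · intro hl
    by_contra hneg
    rw [not_lt] at hneg
    rcases hneg.eq_or_lt with h0 | h0
    · obtain ⟨x, hx, hx'⟩ : ∃ x : ℝ, (x : OnePoint ℝ) ∈ fixedSet (v : SL2Z) ∧
          (x : OnePoint ℝ) ∈ fixedSet ((h * v * h⁻¹ : Gamma) : SL2Z) := by
        rw [hs, hs']
        have h1 := (mul_eq_zero.1 h0.symm).resolve_left hpos.ne'
        rcases mul_eq_zero.1 h1 with h2 | h2 <;> rcases mul_eq_zero.1 h2 with h3 | h3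
        · exact ⟨e₁.1 / e₁.2, by simp, by rw [sub_eq_zero.1 h3]; simp⟩
        · exact ⟨e₂.1 / e₂.2, by simp, by rw [sub_eq_zero.1 h3]; simp⟩
        · exact ⟨e₁.1 / e₁.2, by simp, by rw [sub_eq_zero.1 h3]; simp⟩
        · exact ⟨e₂.1 / e₂.2, by simp, by rw [sub_eq_zero.1 h3]; simp⟩
      rw [fixedSet_eq_of_shared hv hv' hx hx'] at hl
      exact not_linked_self _ hl
    · rw [hs, hs'] at hl
      exact not_linked_of_chi_pos (pos_of_mul_pos_right h0 hpos.le) hl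
  · intro hneg
    rw [hs, hs']
    exact linked_of_chi_neg (by
      by_contra hge
      rw [not_lt] at hge
      exact absurd (mul_nonneg hpos.le hge) (not_le.2 hneg))

end Strip

namespace Strip

/-- Being in the same double coset of `⟨v⟩`. -/
def sameCoset (v : Gamma) (h h' : {h : Gamma // GoodConj v h}) : Prop :=
  ∃ m k : ℤ, (h' : Gamma) = v ^ m * (h : Gamma) * v ^ k

lemma sameCoset_equivalence (v : Gamma) : Equivalence (sameCoset v) := by
  refine ⟨fun h => ⟨0, 0, by simp⟩, ?_, ?_⟩
  · rintro h h' ⟨m, k, e⟩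
    exact ⟨-m, -k, by rw [e]; group⟩
  · rintro h h' h'' ⟨m, k, e⟩ ⟨m', k', e'⟩
    exact ⟨m' + m, k + k', by rw [e', e]; group⟩

lemma sTwo_eq (v : Gamma) : sTwo v = Nat.card (Quot (sameCoset v)) := rfl

lemma Axis.eigen₁_zpow {g : GL (Fin 2) ℤ} {e₁ e₂ : ℝ × ℝ} {l : ℝ} (h : Axis g e₁ e₂ l) (m : ℤ) :
    act (g ^ m) e₁ = l ^ m • e₁ := by
  have h0 := h.ne_zero
  induction m using Int.induction_on with
  | zero => simp [act_one]
  | succ m ih =>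
    rw [zpow_add_one, act_mul, h.eigen₁, act_smul, ih, smul_smul, zpow_add_one₀ h0, mul_comm]
  | pred m ih =>
    have h1 : act g⁻¹ e₁ = l⁻¹ • e₁ := by
      have : e₁ = l⁻¹ • act g e₁ := by
        rw [h.eigen₁, smul_smul, inv_mul_cancel₀ h0, one_smul]
      conv_lhs => rw [this]
      rw [act_smul, act_inv_act]
    rw [zpow_sub_one, act_mul, h1, act_smul, ih, smul_smul, zpow_sub_one₀ h0, mul_comm]

lemma Axis.inv {g : GL (Fin 2) ℤ} {e₁ e₂ : ℝ × ℝ} {l : ℝ} (h : Axis g e₁ e₂ l) :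
    Axis g⁻¹ e₂ e₁ l := by
  have h0 := h.ne_zero
  refine ⟨h.one_lt, ?_, ?_, ?_⟩
  · have : e₂ = l • act g e₂ := by
      rw [h.eigen₂, smul_smul, mul_inv_cancel₀ h0, one_smul]
    conv_lhs => rw [this]
    rw [act_smul, act_inv_act]
  · have : e₁ = l⁻¹ • act g e₁ := by
      rw [h.eigen₁, smul_smul, inv_mul_cancel₀ h0, one_smul]
    conv_lhs => rw [this]
    rw [act_smul, act_inv_act]
  · rw [br_swap]
    exact neg_ne_zero.2 h.indep

lemma Axis.eigen₂_zpow {g : GL (Fin 2) ℤ} {e₁ e₂ : ℝ × ℝ} {l : ℝ} (h : Axis g e₁ e₂ l) (m : ℤ) :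
    act (g ^ m) e₂ = (l ^ m)⁻¹ • e₂ := by
  have := h.inv.eigen₁_zpow (-m)
  rwa [inv_zpow', neg_neg, zpow_neg] at this

lemma br_smul_right (r : ℝ) (u v : ℝ × ℝ) : br u (r • v) = r * br u v := by
  simp only [br, Prod.smul_fst, Prod.smul_snd, smul_eq_mul]; ring

lemma br_smul_left (r : ℝ) (u v : ℝ × ℝ) : br (r • u) v = r * br u v := by
  simp only [br, Prod.smul_fst, Prod.smul_snd, smul_eq_mul]; ring

lemma br_act_left {g : GL (Fin 2) ℤ} (hg : g.1.det = 1) (u v : ℝ × ℝ) :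
    br u (act g v) = br (act g⁻¹ u) v := by
  conv_lhs => rw [← act_act_inv g u]
  rw [br_act, hg, Int.cast_one, one_mul]

lemma exists_zpow_mul_mem {b : ℝ} (hb : 1 < b) {x : ℝ} (hx : 0 < x) :
    ∃ m : ℤ, 1 ≤ b ^ m * x ∧ b ^ m * x ≤ b := by
  obtain ⟨m, h1, h2⟩ := exists_mem_Ico_zpow hx hb
  have hb0 : 0 < b := by linarith
  have hm : 0 < b ^ m := zpow_pos hb0 m
  refine ⟨-m, ?_, ?_⟩
  · rw [zpow_neg, inv_mul_eq_div, one_le_div hm]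
    exact h1
  · rw [zpow_neg, inv_mul_eq_div, div_le_iff₀ hm, ← zpow_one_add₀ hb0.ne', add_comm]
    exact h2.le

/-- Boundedness of the entries of a matrix in terms of its brackets on a basis. -/
lemma exists_entry_bound (e₁ e₂ : ℝ × ℝ) (he : br e₁ e₂ ≠ 0) (K : ℝ) :
    ∃ B : ℕ, ∀ g : SL2Z, |br e₁ (act (toG g) e₁)| ≤ K → |br e₁ (act (toG g) e₂)| ≤ K →
      |br e₂ (act (toG g) e₁)| ≤ K → |br e₂ (act (toG g) e₂)| ≤ K →
      ∀ i j, |g.1 i j| ≤ B := by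
  set M : ℝ := |e₁.1| + |e₁.2| + |e₂.1| + |e₂.2| with hM
  have a1 := abs_nonneg e₁.1
  have a2 := abs_nonneg e₁.2
  have a3 := abs_nonneg e₂.1
  have a4 := abs_nonneg e₂.2
  obtain ⟨B, hB⟩ := exists_nat_ge (4 * (M * M * K) / (br e₁ e₂) ^ 2)
  refine ⟨B, fun g h11 h12 h21 h22 i j => ?_⟩
  have hpos : 0 < (br e₁ e₂) ^ 2 := by positivity
  have hK : 0 ≤ K := (abs_nonneg _).trans h11
  have hM0 : 0 ≤ M := by linarith
  have main : ∀ x y z w : ℝ, |x| ≤ M → |y| ≤ M → |z| ≤ M → |w| ≤ M →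
      ∀ E : ℝ, E * (br e₁ e₂) ^ 2 = x * y * br e₁ (act (toG g) e₁) +
        x * w * br e₁ (act (toG g) e₂) + z * y * br e₂ (act (toG g) e₁) +
        z * w * br e₂ (act (toG g) e₂) → |E| ≤ B := by
    intro x y z w hx hy hz hw E hE
    refine le_trans ?_ hB
    rw [le_div_iff₀ hpos, ← abs_of_pos hpos, ← abs_mul, hE]
    have t : ∀ a b c : ℝ, |a| ≤ M → |b| ≤ M → |c| ≤ K → |a * b * c| ≤ M * M * K := by
      intro a b c ha hb hc
      rw [abs_mul, abs_mul]
      exact mul_le_mul (mul_le_mul ha hb (abs_nonneg _) hM0) hc (abs_nonneg _)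
        (mul_nonneg hM0 hM0)
    have t1 := t x y _ hx hy h11
    have t2 := t x w _ hx hw h12
    have t3 := t z y _ hz hy h21
    have t4 := t z w _ hz hw h22
    refine (abs_add_le _ _).trans ?_
    refine (add_le_add_left (abs_add_le _ _) _).trans ?_
    refine (add_le_add_left (add_le_add_left (abs_add_le _ _) _) _).trans ?_
    linarith
  have b1 : |e₁.1| ≤ M := by linarith
  have b2 : |e₁.2| ≤ M := by linarith
  have b3 : |e₂.1| ≤ M := by linarith
  have b4 : |e₂.2| ≤ M := by linarith
  have n1 : |-e₁.1| ≤ M := by rwa [abs_neg]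
  have n2 : |-e₁.2| ≤ M := by rwa [abs_neg]
  have n3 : |-e₂.1| ≤ M := by rwa [abs_neg]
  have n4 : |-e₂.2| ≤ M := by rwa [abs_neg]
  have fin : |entry g i j| ≤ B := by
    fin_cases i <;> fin_cases j
    · refine main e₂.1 e₂.2 (-e₁.1) (-e₁.2) b3 b4 n1 n2 _ ?_
      simp only [br, act_toG, Fin.zero_eta]; ring
    · refine main e₂.1 (-e₂.1) (-e₁.1) e₁.1 b3 n3 n1 b1 _ ?_
      simp only [br, act_toG, Fin.zero_eta, Fin.mk_one]; ring
    · refine main e₂.2 e₂.2 (-e₁.2) (-e₁.2) b4 b4 n2 n2 _ ?_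
      simp only [br, act_toG, Fin.zero_eta, Fin.mk_one]; ring
    · refine main e₂.2 (-e₂.1) (-e₁.2) e₁.1 b4 n3 n2 b1 _ ?_
      simp only [br, act_toG, Fin.mk_one]; ring
  unfold entry at fin
  exact_mod_cast fin

lemma finite_bounded (B : ℕ) : {g : Gamma | ∀ i j, |(g : SL2Z).1 i j| ≤ B}.Finite := by
  have h1 : (Set.univ.pi fun _ : Fin 2 => Set.univ.pi fun _ : Fin 2 =>
      Set.Icc (-(B : ℤ)) B).Finite :=
    Set.Finite.pi fun _ => Set.Finite.pi fun _ => Set.finite_Icc _ _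
  refine Set.Finite.of_injOn (f := fun g : Gamma => ((g : SL2Z).1 : Fin 2 → Fin 2 → ℤ))
    (t := _) ?_ ?_ h1
  · intro g hg i _ j _
    exact abs_le.1 (hg i j)
  · intro g _ g' _ h
    exact Subtype.ext (Subtype.ext h)

/-- A hyperbolic element has finitely many double cosets of crossings. -/
lemma finite_crossings {v : Gamma} (hv : Hyperbolic (v : SL2Z)) :
    Finite (Quot (sameCoset v)) := by
  obtain ⟨e₁, e₂, l, ax⟩ := hv.exists_axis
  have hl0 := ax.ne_zero
  have hl2 : 1 < l ^ 2 := by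
    rw [one_lt_sq_iff_one_lt_abs]
    exact ax.one_lt
  set K : ℝ := max (l ^ 2) ((br e₁ e₂) ^ 2) with hK
  obtain ⟨B, hB⟩ := exists_entry_bound e₁ e₂ ax.indep K
  have hfin := finite_bounded B
  have hsurj : ∀ h : {h : Gamma // GoodConj v h}, ∃ h' : {h : Gamma // GoodConj v h},
      (h' : Gamma) ∈ {g : Gamma | ∀ i j, |(g : SL2Z).1 i j| ≤ B} ∧ sameCoset v h h' := by
    rintro ⟨h, hh⟩
    rw [goodConj_iff hv ax] at hh
    set f₁ := act (toG h) e₁ with hf₁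
    set f₂ := act (toG h) e₂ with hf₂
    have hne : chi e₁ e₂ f₁ f₂ ≠ 0 := hh.ne
    rw [chi] at hne
    have n1 : br e₁ f₁ ≠ 0 := by
      intro h0; simp [h0] at hne
    have n2 : br e₂ f₂ ≠ 0 := by
      intro h0; simp [h0] at hne
    have n3 : br e₁ f₂ ≠ 0 := by
      intro h0; simp [h0] at hne
    have n4 : br e₂ f₁ ≠ 0 := by
      intro h0; simp [h0] at hne
    obtain ⟨a, ha1, ha2⟩ := exists_zpow_mul_mem hl2 (abs_pos.2 n4)
    obtain ⟨b, hb1, hb2⟩ := exists_zpow_mul_mem hl2 (abs_pos.2 n2)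
    have hdet : ∀ g : SL2Z, (toG g).1.det = 1 := fun g => g.2
    let g : Gamma := v ^ (a + b) * h * v ^ (a - b)
    have hg : toG (g : SL2Z) = toG v ^ (a + b) * toG h * toG v ^ (a - b) := by
      show toG ((v ^ (a + b) * h * v ^ (a - b) : Gamma) : SL2Z) = _
      push_cast
      rw [map_mul, map_mul, map_zpow, map_zpow]
    have hdv : (toG (v : SL2Z) ^ (a + b)).1.det = 1 := by
      rw [← map_zpow]
      exact hdet _
    have g₁ : act (toG g) e₁ = l ^ (a - b) • act (toG v ^ (a + b)) f₁ := by
      rw [hg, act_mul, act_mul, ax.eigen₁_zpow, act_smul, act_smul]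
    have g₂ : act (toG g) e₂ = (l ^ (a - b))⁻¹ • act (toG v ^ (a + b)) f₂ := by
      rw [hg, act_mul, act_mul, ax.eigen₂_zpow, act_smul, act_smul]
    have i₁ : act (toG (v : SL2Z) ^ (a + b))⁻¹ e₁ = (l ^ (a + b))⁻¹ • e₁ := by
      rw [← zpow_neg, ax.eigen₁_zpow, zpow_neg]
    have i₂ : act (toG (v : SL2Z) ^ (a + b))⁻¹ e₂ = l ^ (a + b) • e₂ := by
      rw [← zpow_neg, ax.eigen₂_zpow, zpow_neg, inv_inv]
    have c11 : br e₁ (act (toG g) e₁) = (l ^ 2) ^ (-b) * br e₁ f₁ := by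
      rw [g₁, br_smul_right, br_act_left hdv, i₁, br_smul_left, ← mul_assoc, ← zpow_neg,
        ← zpow_add₀ hl0, ← zpow_natCast l 2, ← zpow_mul]
      congr 2; push_cast; ring
    have c22 : br e₂ (act (toG g) e₂) = (l ^ 2) ^ b * br e₂ f₂ := by
      rw [g₂, br_smul_right, br_act_left hdv, i₂, br_smul_left, ← mul_assoc, ← zpow_neg,
        ← zpow_add₀ hl0, ← zpow_natCast l 2, ← zpow_mul]
      congr 2; push_cast; ring
    have c12 : br e₁ (act (toG g) e₂) = (l ^ 2) ^ (-a) * br e₁ f₂ := by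
      rw [g₂, br_smul_right, br_act_left hdv, i₁, br_smul_left, ← mul_assoc, ← zpow_neg,
        ← zpow_neg, ← zpow_add₀ hl0, ← zpow_natCast l 2, ← zpow_mul]
      congr 2; push_cast; ring
    have c21 : br e₂ (act (toG g) e₁) = (l ^ 2) ^ a * br e₂ f₁ := by
      rw [g₁, br_smul_right, br_act_left hdv, i₂, br_smul_left, ← mul_assoc,
        ← zpow_add₀ hl0, ← zpow_natCast l 2, ← zpow_mul]
      congr 2; push_cast; ring
    have hpa : 0 < (l ^ 2) ^ a := zpow_pos (by linarith) a
    have hpb : 0 < (l ^ 2) ^ b := zpow_pos (by linarith) b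
    have hchi : br e₁ (act (toG g) e₁) * br e₂ (act (toG g) e₂) *
        (br e₁ (act (toG g) e₂) * br e₂ (act (toG g) e₁)) < 0 := by
      rw [c11, c22, c12, c21, zpow_neg, zpow_neg]
      have : ((l ^ 2) ^ b)⁻¹ * br e₁ f₁ * ((l ^ 2) ^ b * br e₂ f₂) *
          (((l ^ 2) ^ a)⁻¹ * br e₁ f₂ * ((l ^ 2) ^ a * br e₂ f₁)) = chi e₁ e₂ f₁ f₂ := by
        rw [chi]
        field_simp
      rwa [this]
    have hgood : GoodConj v g := (goodConj_iff hv ax g).2 hchi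
    have hplu : br e₁ (act (toG g) e₁) * br e₂ (act (toG g) e₂) -
        br e₁ (act (toG g) e₂) * br e₂ (act (toG g) e₁) = (br e₁ e₂) ^ 2 := by
      have h1 := br_act (toG g) e₁ e₂
      rw [hdet, Int.cast_one, one_mul] at h1
      have h2 : br e₁ (act (toG g) e₁) * br e₂ (act (toG g) e₂) -
        br e₁ (act (toG g) e₂) * br e₂ (act (toG g) e₁) =
          br e₁ e₂ * br (act (toG g) e₁) (act (toG g) e₂) := by
        simp only [br]; ring
      rw [h2, h1, sq]
    have d22 : 1 ≤ |br e₂ (act (toG g) e₂)| := by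
      rw [c22, abs_mul, abs_of_pos hpb]; exact hb1
    have d21 : 1 ≤ |br e₂ (act (toG g) e₁)| := by
      rw [c21, abs_mul, abs_of_pos hpa]; exact ha1
    have d22' : |br e₂ (act (toG g) e₂)| ≤ l ^ 2 := by
      rw [c22, abs_mul, abs_of_pos hpb]; exact hb2
    have d21' : |br e₂ (act (toG g) e₁)| ≤ l ^ 2 := by
      rw [c21, abs_mul, abs_of_pos hpa]; exact ha2
    have prod : ∀ X Y k : ℝ, 0 ≤ k → X * Y < 0 → X - Y = k → |X| ≤ k ∧ |Y| ≤ k := by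
      intro X Y k h0 h1 h2
      rcases mul_neg_iff.1 h1 with ⟨h3, h4⟩ | ⟨h3, h4⟩
      · exact ⟨abs_le.2 ⟨by linarith, by linarith⟩, abs_le.2 ⟨by linarith, by linarith⟩⟩
      · exfalso; linarith
    obtain ⟨p1, p2⟩ := prod _ _ _ (sq_nonneg _) hchi hplu
    rw [abs_mul] at p1 p2
    refine ⟨⟨g, hgood⟩, ?_, a + b, a - b, rfl⟩
    refine hB g ?_ ?_ (d21'.trans (le_max_left _ _)) (d22'.trans (le_max_left _ _))
    · refine le_trans ?_ (le_max_right _ _)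
      nlinarith [abs_nonneg (br e₁ (act (toG g) e₁))]
    · refine le_trans ?_ (le_max_right _ _)
      nlinarith [abs_nonneg (br e₁ (act (toG g) e₂))]
  have : Finite {h : {h : Gamma // GoodConj v h} //
      (h : Gamma) ∈ {g : Gamma | ∀ i j, |(g : SL2Z).1 i j| ≤ B}} := by
    have := hfin.to_subtype
    refine Finite.of_injective (β := {g : Gamma | ∀ i j, |(g : SL2Z).1 i j| ≤ B})
      (fun h => ⟨h.1.1, h.2⟩) (fun a b hab => ?_)
    exact Subtype.ext (Subtype.ext (by simpa using hab))
  refine Finite.of_surjective (fun h : {h : {h : Gamma // GoodConj v h} //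
      (h : Gamma) ∈ {g : Gamma | ∀ i j, |(g : SL2Z).1 i j| ≤ B}} => Quot.mk (sameCoset v) h.1) ?_
  intro c
  obtain ⟨h, rfl⟩ := Quot.exists_rep c
  obtain ⟨h', h1, h2⟩ := hsurj h
  exact ⟨⟨h', h1⟩, (Quot.sound h2).symm⟩

end Strip

namespace Strip

/-- The orientation of a triple of directions. -/
def ori (u v w : ℝ × ℝ) : ℝ := br u v * br v w * br w u

lemma ori_rotate (u v w : ℝ × ℝ) : ori v w u = ori u v w := by
  simp only [ori]; ring

lemma ori_swap (u v w : ℝ × ℝ) : ori v u w = -ori u v w := by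
  simp only [ori, br]; ring

lemma ori_neg_left (u v w : ℝ × ℝ) : ori (-u) v w = ori u v w := by
  simp only [ori, br, Prod.fst_neg, Prod.snd_neg]; ring

lemma ori_act (g : GL (Fin 2) ℤ) (u v w : ℝ × ℝ) :
    ori (act g u) (act g v) (act g w) = g.1.det * ori u v w := by
  simp only [ori, br_act]
  linear_combination (g.1.det * (br u v * br v w * br w u) : ℝ) * det_sq g

lemma exists_sign_normal (u : ℝ × ℝ) : ∃ u' : ℝ × ℝ, 0 ≤ u'.2 ∧ (∀ c, q c u' = q c u) ∧
    ∀ v w, ori u v w = ori u' v w := by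
  rcases le_or_gt 0 u.2 with h | h
  · exact ⟨u, h, fun _ => rfl, fun _ _ => rfl⟩
  · refine ⟨-u, by simpa using h.le, fun c => ?_, fun v w => (ori_neg_left u v w).symm⟩
    rcases letter_cases c with rfl | rfl | rfl <;>
      simp only [q_zero, q_one, q_two, Prod.fst_neg, Prod.snd_neg] <;> ring

lemma ori_pos {u v w : ℝ × ℝ} (hu : 0 < q 0 u) (hv : 0 < q 1 v) (hw : 0 < q 2 w) :
    0 < ori u v w := by
  obtain ⟨u, hu2, hq, e⟩ := exists_sign_normal u
  rw [← hq] at hu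
  rw [e]
  clear e hq
  obtain ⟨v, hv2, hq, e⟩ := exists_sign_normal v
  rw [← hq] at hv
  rw [← ori_rotate, e]
  clear e hq
  obtain ⟨w, hw2, hq, e⟩ := exists_sign_normal w
  rw [← hq] at hw
  rw [← ori_rotate, e, ← ori_rotate]
  clear e hq
  rw [q_zero] at hu
  rw [q_one] at hv
  rw [q_two] at hw
  have u1 : u.2 < u.1 := by nlinarith
  have u2 : 0 < u.2 := lt_of_le_of_ne hu2 fun h => by simp [← h] at hu
  have v1 : v.1 < 0 := by nlinarith
  have v2 : 0 < v.2 := lt_of_le_of_ne hv2 fun h => by simp [← h] at hv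
  have w1 : 0 < w.1 := by
    by_contra h
    nlinarith
  have w2 : w.1 < w.2 := by nlinarith
  have b1 : 0 < br u v := by
    simp only [br]
    nlinarith [mul_pos (u2.trans u1) v2, mul_pos u2 (neg_pos.2 v1)]
  have b2 : br v w < 0 := by
    simp only [br]
    nlinarith [mul_pos v2 w1, mul_pos (w1.trans w2) (neg_pos.2 v1)]
  have b3 : br w u < 0 := by
    simp only [br]
    nlinarith [mul_pos w1 (sub_pos.2 u1), mul_pos (sub_pos.2 w2) (u2.trans u1)]
  exact mul_pos_of_neg_of_neg (mul_neg_of_pos_of_neg b1 b2) b3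

lemma turn_mul_ori_pos {a a' c : ZMod 3} (h1 : a ≠ a') (h2 : a ≠ c) (h3 : a' ≠ c) {u u' w : ℝ × ℝ}
    (hu : 0 < q a u) (hu' : 0 < q a' u') (hw : 0 < q c w) : 0 < turn c a * ori u u' w := by
  rcases letter_cases a with rfl | rfl | rfl <;> rcases letter_cases a' with rfl | rfl | rfl <;>
    rcases letter_cases c with rfl | rfl | rfl <;>
    first
      | exact absurd rfl h1
      | exact absurd rfl h2
      | exact absurd rfl h3
      | skip
  · have := ori_pos hu hu' hw
    rw [show turn 2 0 = 1 by decide]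
    simpa using this
  · have := ori_pos hu hw hu'
    rw [← ori_rotate, ori_swap, ori_rotate] at this
    rw [show turn 1 0 = -1 by decide]
    push_cast; linarith
  · have := ori_pos hu' hu hw
    rw [ori_swap] at this
    rw [show turn 2 1 = -1 by decide]
    push_cast; linarith
  · have := ori_pos hw hu hu'
    rw [← ori_rotate] at this
    rw [show turn 0 1 = 1 by decide]
    push_cast; linarith
  · have := ori_pos hu' hw hu
    rw [← ori_rotate, ← ori_rotate] at this
    rw [show turn 1 2 = 1 by decide]
    push_cast; linarith
  · have := ori_pos hw hu' hu
    rw [← ori_rotate, ori_swap] at this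
    rw [show turn 0 2 = -1 by decide]
    push_cast; linarith

lemma chi_neg_of_ori {f f' b b' : ℝ × ℝ} (h : 0 < ori f f' b * ori b b' f) :
    chi f b f' b' < 0 := by
  have e : ori f f' b * ori b b' f = -(br b f) ^ 2 * chi f b f' b' := by
    simp only [ori, chi, br]; ring
  rw [e] at h
  nlinarith [sq_nonneg (br b f)]

variable {s : ℤ → ZMod 3} {P : ℤ → GL (Fin 2) ℤ} {N : ℕ}

/-- The frames met from slot `i`, read towards the positive side. -/
def T (P : ℤ → GL (Fin 2) ℤ) (i k : ℤ) : GL (Fin 2) ℤ :=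
  if Even i then P (i - k) else P (i + 1 + k)

lemma Frames.T_succ (hP : Frames s P) (i k : ℤ) : T P i (k + 1) = T P i k * R (W s i (k + 1)) := by
  unfold T W
  split_ifs with hi
  · rw [hP.pred, show i - (k + 1) + 1 = i - k by ring]
  · rw [show i + 1 + (k + 1) = i + 1 + k + 1 by ring, hP.succ,
      show i + (k + 1) = i + 1 + k by ring]

lemma Frames.T_pred (hP : Frames s P) (i k : ℤ) : T P i (k - 1) = T P i k * R (W s i k) := by
  have := hP.T_succ i (k - 1)
  rw [sub_add_cancel] at this
  rw [this, mul_assoc, R_mul_self, mul_one]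

lemma det_R (c : ZMod 3) : (R c).1.det = -1 := det_reflMat c

/-- The end of the axis ahead of slot `i`. -/
def ahead (e₁ e₂ : ℝ × ℝ) (i : ℤ) : ℝ × ℝ := if Even i then e₂ else e₁

/-- The end of the axis behind slot `i`. -/
def behind (e₁ e₂ : ℝ × ℝ) (i : ℤ) : ℝ × ℝ := if Even i then e₁ else e₂

lemma Frames.q_ahead (hP : Frames s P) (h : PerSeq s N) {e₁ e₂ : ℝ × ℝ} {l : ℝ}
    (ax : Axis (P N) e₁ e₂ l) (i k : ℤ) :
    0 < q (W s i (k + 1)) (act (T P i k)⁻¹ (ahead e₁ e₂ i)) := by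
  unfold T W ahead
  split_ifs with hi
  · have := hP.q_contracting h ax.right_ne ax.one_lt ax.eigen₂ (i - k)
    rwa [show i - (k + 1) = i - k - 1 by ring]
  · have := hP.q_expanding h ax.left_ne ax.one_lt ax.eigen₁ (i + 1 + k)
    rwa [show i + (k + 1) = i + 1 + k by ring]

lemma Frames.q_behind (hP : Frames s P) (h : PerSeq s N) {e₁ e₂ : ℝ × ℝ} {l : ℝ}
    (ax : Axis (P N) e₁ e₂ l) (i k : ℤ) :
    0 < q (W s i k) (act (T P i k)⁻¹ (behind e₁ e₂ i)) := by
  unfold T W behind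
  split_ifs with hi
  · exact hP.q_expanding h ax.left_ne ax.one_lt ax.eigen₁ (i - k)
  · have := hP.q_contracting h ax.right_ne ax.one_lt ax.eigen₂ (i + 1 + k)
    rwa [show i + k = i + 1 + k - 1 by ring]

lemma Frames.T_fwd (hP : Frames s P) {i j : ℤ} {f : ℕ}
    (ha : ∀ k : ℤ, 0 ≤ k → k ≤ f → W s i k = W s j k) (n : ℕ) (hn : n ≤ f) :
    ∃ H : GL (Fin 2) ℤ, T P i n = T P i 0 * H ∧ T P j n = T P j 0 * H ∧ H.1.det = (-1) ^ n := by
  induction n with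
  | zero => exact ⟨1, by simp, by simp, by simp⟩
  | succ n ih =>
    obtain ⟨H, h1, h2, h3⟩ := ih (by omega)
    refine ⟨H * R (W s i (n + 1)), ?_, ?_, ?_⟩
    · rw [← mul_assoc, ← h1]; exact_mod_cast hP.T_succ i n
    · rw [← mul_assoc, ← h2, ha _ (by omega) (by exact_mod_cast hn)]; exact_mod_cast hP.T_succ j n
    · rw [Units.val_mul, Matrix.det_mul, h3, det_R, pow_succ]

lemma Frames.T_bwd (hP : Frames s P) {i j : ℤ} {b : ℕ}
    (ha : ∀ k : ℤ, -(b : ℤ) ≤ k → k ≤ 0 → W s i k = W s j k) (n : ℕ) (hn : n ≤ b + 1) :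
    ∃ H : GL (Fin 2) ℤ, T P i (-n) = T P i 0 * H ∧ T P j (-n) = T P j 0 * H ∧
      H.1.det = (-1) ^ n := by
  induction n with
  | zero => exact ⟨1, by simp, by simp, by simp⟩
  | succ n ih =>
    obtain ⟨H, h1, h2, h3⟩ := ih (by omega)
    have e : (-((n + 1 : ℕ) : ℤ)) = -(n : ℤ) - 1 := by push_cast; ring
    refine ⟨H * R (W s i (-n)), ?_, ?_, ?_⟩
    · rw [← mul_assoc, ← h1, e, hP.T_pred]
    · rw [← mul_assoc, ← h2, ha _ (by omega) (by omega), e, hP.T_pred]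
    · rw [Units.val_mul, Matrix.det_mul, h3, det_R, pow_succ]

/-- Crossing strips give crossing axes. -/
lemma Frames.chi_neg (hP : Frames s P) (h : PerSeq s N) {e₁ e₂ : ℝ × ℝ} {l : ℝ}
    (ax : Axis (P N) e₁ e₂ l) {i j : ℤ} {b f : ℕ} (hc : Conf s i j b f) :
    chi e₁ e₂ (act (T P i 0 * (T P j 0)⁻¹) e₁) (act (T P i 0 * (T P j 0)⁻¹) e₂) < 0 := by
  have key : chi (act (T P i 0)⁻¹ (ahead e₁ e₂ i)) (act (T P i 0)⁻¹ (behind e₁ e₂ i))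
      (act (T P j 0)⁻¹ (ahead e₁ e₂ j)) (act (T P j 0)⁻¹ (behind e₁ e₂ j)) < 0 := by
    obtain ⟨H, h1, h2, h3⟩ := hP.T_fwd (f := f)
      (fun k hk hk' => hc.agree k (by omega) hk') f le_rfl
    obtain ⟨H', h1', h2', h3'⟩ := hP.T_bwd (b := b)
      (fun k hk hk' => hc.agree k hk (by omega)) (b + 1) le_rfl
    have p1 := hP.q_ahead h ax i f
    have p2 := hP.q_ahead h ax j f
    have p3 := hP.q_behind h ax i f
    have m1 := hP.q_behind h ax i (-(b + 1))
    have m2 := hP.q_behind h ax j (-(b + 1))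
    have m3 := hP.q_ahead h ax i (-(b + 1))
    push_cast at h1' h2'
    rw [h1, mul_inv_rev, act_mul] at p1 p3
    rw [h2, mul_inv_rev, act_mul] at p2
    rw [h1', mul_inv_rev, act_mul] at m1 m3
    rw [h2', mul_inv_rev, act_mul] at m2
    rw [show (-((b : ℤ) + 1) + 1) = -b by ring] at m3
    have ef := hc.agree f (by omega) le_rfl
    have eb := hc.agree (-b) le_rfl (by omega)
    have o1 := turn_mul_ori_pos hc.ne_f (h.W_red i f).symm
      (by rw [ef]; exact (h.W_red j f).symm) p1 p2 p3
    have o2 := turn_mul_ori_pos hc.ne_b (h.W_red' i b).symm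
      (by rw [eb]; exact (h.W_red' j b).symm) m1 m2 m3
    have sg := hc.sign
    rw [Fp, Fm, dig, dig] at sg
    have di : ∀ g : GL (Fin 2) ℤ, ∀ n : ℕ, g.1.det = (-1) ^ n → (g⁻¹).1.det = (-1) ^ n := by
      intro g n hg
      have : (g⁻¹).1.det * g.1.det = 1 := by
        rw [← Matrix.det_mul, ← Units.val_mul, inv_mul_cancel]; simp
      rw [hg] at this
      have h4 : ((-1 : ℤ) ^ n) * (-1) ^ n = 1 := by rw [← mul_pow]; norm_num
      calc (g⁻¹).1.det = (g⁻¹).1.det * ((-1) ^ n * (-1) ^ n) := by rw [h4, mul_one]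
        _ = _ := by rw [← mul_assoc, this, one_mul]
    apply chi_neg_of_ori
    rw [ori_act, di _ _ h3] at o1
    rw [ori_act, di _ _ h3'] at o2
    have o := mul_pos o1 o2
    set X := ori (act (T P i 0)⁻¹ (ahead e₁ e₂ i)) (act (T P j 0)⁻¹ (ahead e₁ e₂ j))
      (act (T P i 0)⁻¹ (behind e₁ e₂ i))
    set Y := ori (act (T P i 0)⁻¹ (behind e₁ e₂ i)) (act (T P j 0)⁻¹ (behind e₁ e₂ j))
      (act (T P i 0)⁻¹ (ahead e₁ e₂ i))
    have sg' : ((-1) ^ f * turn (W s i f) (W s i (f + 1)) *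
        ((-1) ^ b * turn (W s i (-b)) (W s i (-(b + 1)))) : ℝ) = -1 := by
      have : (((-(-1) ^ f * turn (W s i f) (W s i (f + 1)) *
        (-(-1) ^ b * turn (W s i (-b)) (W s i (-(b + 1)))) : ℤ)) : ℝ) = ((-1 : ℤ) : ℝ) := by
        rw [sg]
      push_cast at this
      linarith
    have : (turn (W s i f) (W s i (f + 1)) : ℝ) * ((((-1) ^ f : ℤ) : ℝ) * X) *
        (turn (W s i (-b)) (W s i (-(b + 1))) * ((((-1) ^ (b + 1) : ℤ) : ℝ) * Y)) = X * Y := by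
      push_cast
      rw [pow_succ]
      linear_combination (-(X * Y)) * sg'
    rwa [this] at o
  have e : chi e₁ e₂ (act (T P i 0 * (T P j 0)⁻¹) e₁) (act (T P i 0 * (T P j 0)⁻¹) e₂) =
      chi (act (T P i 0)⁻¹ e₁) (act (T P i 0)⁻¹ e₂) (act (T P j 0)⁻¹ e₁) (act (T P j 0)⁻¹ e₂) := by
    conv_lhs => rw [← chi_act (T P i 0)⁻¹]
    rw [act_mul, act_mul, act_inv_act, act_inv_act]
  rw [e]
  unfold ahead behind at key
  split_ifs at key
  · rwa [chi_swap_left, chi_swap_right] at key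
  · rwa [chi_swap_left] at key
  · rwa [chi_swap_right] at key
  · exact key

end Strip

namespace Strip

/-- The product of the reflections named by a list. -/
def rho (l : List (ZMod 3)) : GL (Fin 2) ℤ := (l.map R).prod

lemma rho_nil : rho [] = 1 := rfl

lemma rho_cons (a : ZMod 3) (l : List (ZMod 3)) : rho (a :: l) = R a * rho l := by
  simp [rho]

lemma rho_append (l l' : List (ZMod 3)) : rho (l ++ l') = rho l * rho l' := by
  simp [rho]

/-- The ping-pong property of reduced products of reflections. -/
lemma q_rho_pos (a : ZMod 3) (l : List (ZMod 3)) {d : ZMod 3}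
    (hl : (a :: l ++ [d]).IsChain (· ≠ ·)) {u : ℝ × ℝ} (hu : 0 < q d u) :
    0 < q a (act (rho (a :: l)) u) := by
  induction l generalizing a with
  | nil =>
    have hda : a ≠ d := by simpa using hl
    rw [rho_cons, rho_nil, mul_one]
    exact q_R_pos_of_pos hda.symm hu
  | cons b l ih =>
    rw [List.cons_append, List.cons_append, List.isChain_cons_cons] at hl
    rw [rho_cons, act_mul]
    exact q_R_pos_of_pos hl.1.symm (ih b hl.2)

lemma exists_ne_ne (a b : ZMod 3) : ∃ d, d ≠ a ∧ d ≠ b := by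
  revert a b; decide

lemma isChain_append_singleton {l : List (ZMod 3)} (hl : l.IsChain (· ≠ ·)) :
    ∃ x, ∀ d, d ≠ x → (l ++ [d]).IsChain (· ≠ ·) := by
  rcases List.eq_nil_or_concat l with rfl | ⟨t, x, rfl⟩
  · exact ⟨0, fun d _ => by simp⟩
  · refine ⟨x, fun d hd => ?_⟩
    rw [List.isChain_append]
    refine ⟨hl, by simp, ?_⟩
    simpa using hd.symm

lemma rho_ne_one {a : ZMod 3} {l : List (ZMod 3)} (hl : (a :: l).IsChain (· ≠ ·)) :
    rho (a :: l) ≠ 1 := by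
  intro h
  obtain ⟨x, hx⟩ := isChain_append_singleton hl
  obtain ⟨d, h1, h2⟩ := exists_ne_ne x a
  obtain ⟨u, hu⟩ := exists_q_pos d
  have := q_rho_pos a l (hx d h1) hu
  rw [h, act_one] at this
  linarith [q_neg_of_pos h2 hu]

/-- Reduced products of reflections determine their factors. -/
lemma rho_inj {l l' : List (ZMod 3)} (hl : l.IsChain (· ≠ ·)) (hl' : l'.IsChain (· ≠ ·))
    (h : rho l = rho l') : l = l' := by
  induction l generalizing l' with
  | nil =>
    cases l' with
    | nil => rfl
    | cons b l' => exact absurd h.symm (rho_ne_one hl')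
  | cons a l ih =>
    cases l' with
    | nil => exact absurd h (rho_ne_one hl)
    | cons b l' =>
      by_cases hab : a = b
      · subst hab
        rw [rho_cons, rho_cons] at h
        exact congrArg (List.cons a) (ih hl.tail hl'.tail (mul_left_cancel h))
      · exfalso
        obtain ⟨x, hx⟩ := isChain_append_singleton hl
        obtain ⟨y, hy⟩ := isChain_append_singleton hl'
        obtain ⟨d, h1, h2⟩ := exists_ne_ne x y
        obtain ⟨u, hu⟩ := exists_q_pos d
        have p1 := q_rho_pos a l (hx d h1) hu
        have p2 := q_rho_pos b l' (hy d h2) hu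
        rw [← h] at p2
        linarith [q_neg_of_pos hab p1]

variable {s : ℤ → ZMod 3} {P : ℤ → GL (Fin 2) ℤ} {N : ℕ}

lemma isChain_map_range {U : ℕ → ZMod 3} (hU : ∀ k, U k ≠ U (k + 1)) (n : ℕ) :
    ((List.range n).map U).IsChain (· ≠ ·) := by
  rw [List.isChain_map]
  rw [List.isChain_iff_getElem]
  intro i hi
  simpa using hU i

lemma map_range_inj {U V : ℕ → ZMod 3} {m n : ℕ}
    (h : (List.range m).map U = (List.range n).map V) : m = n ∧ ∀ k < m, U k = V k := by
  have hl := congrArg List.length h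
  simp only [List.length_map, List.length_range] at hl
  subst hl
  refine ⟨rfl, fun k hk => ?_⟩
  exact List.map_inj_left.1 h k (List.mem_range.2 hk)

lemma Frames.T_nat (hP : Frames s P) (i : ℤ) (n : ℕ) :
    T P i n = T P i 0 * rho ((List.range n).map fun k : ℕ => W s i (k + 1)) := by
  induction n with
  | zero => simp [rho_nil]
  | succ n ih =>
    rw [List.range_succ, List.map_append, rho_append, ← mul_assoc, ← ih, Nat.cast_succ, hP.T_succ]
    simp [rho]

lemma Frames.T_neg_nat (hP : Frames s P) (i : ℤ) (n : ℕ) :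
    T P i (-n) = T P i 0 * rho ((List.range n).map fun k : ℕ => W s i (-k)) := by
  induction n with
  | zero => simp [rho_nil]
  | succ n ih =>
    rw [List.range_succ, List.map_append, rho_append, ← mul_assoc, ← ih, Nat.cast_succ, neg_add,
      ← sub_eq_add_neg, hP.T_pred]
    simp [rho]

/-- Equal displacements along two strips that share a side run over the same sides. -/
lemma Frames.displacement_eq (hP : Frames s P) (h : PerSeq s N) {i j : ℤ}
    (h0 : W s i 0 = W s j 0) {K K' : ℤ}
    (he : (T P i 0)⁻¹ * T P i K = (T P j 0)⁻¹ * T P j K') :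
    K = K' ∧ ∀ k, (1 ≤ k ∧ k ≤ K) ∨ (K + 1 ≤ k ∧ k ≤ 0) → W s i k = W s j k := by
  have up : ∀ i (n : ℕ), ((List.range n).map fun k : ℕ => W s i (k + 1)).IsChain (· ≠ ·) :=
    fun i n => isChain_map_range (fun k => by exact_mod_cast h.W_red i (k + 1)) n
  have dn : ∀ i (n : ℕ), ((List.range n).map fun k : ℕ => W s i (-k)).IsChain (· ≠ ·) :=
    fun i n => isChain_map_range (fun k => by exact_mod_cast h.W_red' i k) n
  have hn : ∀ n : ℕ, (List.range (n + 1)) = 0 :: (List.range n).map Nat.succ :=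
    fun n => List.range_succ_eq_map
  obtain ⟨n, rfl | rfl⟩ := Int.eq_nat_or_neg K <;> obtain ⟨m, rfl | rfl⟩ := Int.eq_nat_or_neg K'
  · rw [hP.T_nat, hP.T_nat, inv_mul_cancel_left, inv_mul_cancel_left] at he
    obtain ⟨rfl, h2⟩ := map_range_inj (rho_inj (up _ _) (up _ _) he)
    refine ⟨rfl, fun k hk => ?_⟩
    have := h2 (k - 1).toNat (by omega)
    rwa [show ((k - 1).toNat : ℤ) + 1 = k by omega] at this
  · rw [hP.T_nat, hP.T_neg_nat, inv_mul_cancel_left, inv_mul_cancel_left] at he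
    obtain ⟨rfl, h2⟩ := map_range_inj (rho_inj (up _ _) (dn _ _) he)
    rcases Nat.eq_zero_or_pos n with rfl | hpos
    · exact ⟨by simp, fun k hk => by omega⟩
    · have := h2 0 hpos
      simp only [Nat.cast_zero, neg_zero, ← h0, zero_add] at this
      exact absurd this.symm (h.W_red i 0)
  · rw [hP.T_nat, hP.T_neg_nat, inv_mul_cancel_left, inv_mul_cancel_left] at he
    obtain ⟨rfl, h2⟩ := map_range_inj (rho_inj (dn _ _) (up _ _) he)
    rcases Nat.eq_zero_or_pos n with rfl | hpos
    · exact ⟨by simp, fun k hk => by omega⟩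
    · have := h2 0 hpos
      simp only [Nat.cast_zero, neg_zero, h0, zero_add] at this
      exact absurd this (h.W_red j 0)
  · rw [hP.T_neg_nat, hP.T_neg_nat, inv_mul_cancel_left, inv_mul_cancel_left] at he
    obtain ⟨rfl, h2⟩ := map_range_inj (rho_inj (dn _ _) (dn _ _) he)
    refine ⟨rfl, fun k hk => ?_⟩
    have := h2 (-k).toNat (by omega)
    rwa [show -((-k).toNat : ℤ) = k by omega] at this

/-- The view from one slot in terms of another, at even displacement. -/
lemma exists_displacement (s : ℤ → ZMod 3) (P : ℤ → GL (Fin 2) ℤ) (I i : ℤ) :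
    ∃ K : ℤ, Even K ∧ T P i 0 = T P I K ∧
      ((∀ k, W s i k = W s I (k + K)) ∧ (K = 0 → i = I) ∨ ∀ k, W s i k = W s I (K + 1 - k)) := by
  unfold T W
  by_cases hI : Even I <;> by_cases hi : Even i
  · refine ⟨I - i, by grind, ?_, Or.inl ⟨fun k => ?_, by omega⟩⟩
    · rw [if_pos hi, if_pos hI]; congr 1; ring
    · rw [if_pos hi, if_pos hI]; congr 1; ring
  · refine ⟨I - i - 1, by grind, ?_, Or.inr fun k => ?_⟩
    · rw [if_neg hi, if_pos hI]; congr 1; ring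
    · rw [if_neg hi, if_pos hI]; congr 1; ring
  · refine ⟨i - I - 1, by grind, ?_, Or.inr fun k => ?_⟩
    · rw [if_pos hi, if_neg hI]; congr 1; ring
    · rw [if_pos hi, if_neg hI]; congr 1; ring
  · refine ⟨i - I, by grind, ?_, Or.inl ⟨fun k => ?_, by omega⟩⟩
    · rw [if_neg hi, if_neg hI]; congr 1; ring
    · rw [if_neg hi, if_neg hI]; congr 1; ring

/-- Two counted conflicts with the same relative displacement coincide. -/
lemma Frames.slots_eq (hP : Frames s P) (h : PerSeq s N) {I J i j : ℤ} {b f b' f' : ℕ}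
    (hA : Adm s I J b f) (hA' : Adm s i j b' f')
    (he : (T P I 0)⁻¹ * T P i 0 = (T P J 0)⁻¹ * T P j 0) : i = I ∧ j = J := by
  obtain ⟨hc, hw⟩ := hA
  obtain ⟨hc', hw'⟩ := hA'
  obtain ⟨K, hK, hT, hi⟩ := exists_displacement s P I i
  obtain ⟨K', -, hT', hj⟩ := exists_displacement s P J j
  rw [hT, hT'] at he
  have h0 := hc.agree 0 (by omega) (by omega)
  have h0' := hc'.agree 0 (by omega) (by omega)
  obtain ⟨rfl, hag⟩ := hP.displacement_eq h h0 he
  have hf1 : ¬ ((1 ≤ (f : ℤ) + 1 ∧ (f : ℤ) + 1 ≤ K) ∨ (K + 1 ≤ (f : ℤ) + 1 ∧ (f : ℤ) + 1 ≤ 0)) :=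
    fun hh => hc.ne_f (hag _ hh)
  have hb1 : ¬ ((1 ≤ -((b : ℤ) + 1) ∧ -((b : ℤ) + 1) ≤ K) ∨
      (K + 1 ≤ -((b : ℤ) + 1) ∧ -((b : ℤ) + 1) ≤ 0)) := fun hh => hc.ne_b (hag _ hh)
  rcases hi with ⟨hi, hi'⟩ | hi <;> rcases hj with ⟨hj, hj'⟩ | hj
  · have hf2 : ¬ (-(b' : ℤ) ≤ f + 1 - K ∧ (f : ℤ) + 1 - K ≤ f') := fun hh => hc.ne_f <| by
      have := hc'.agree _ hh.1 hh.2
      rwa [hi, hj, sub_add_cancel] at this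
    have hb2 : ¬ (-(b' : ℤ) ≤ -((b : ℤ) + 1) - K ∧ -((b : ℤ) + 1) - K ≤ f') := fun hh => hc.ne_b <| by
      have := hc'.agree _ hh.1 hh.2
      rwa [hi, hj, sub_add_cancel] at this
    have hf3 := hc'.ne_f
    have hb3 := hc'.ne_b
    rw [hi, hj] at hf3 hb3
    have hf4 : ¬ (-(b : ℤ) ≤ f' + 1 + K ∧ (f' : ℤ) + 1 + K ≤ f) := fun hh =>
      hf3 (hc.agree _ hh.1 hh.2)
    have hf5 : ¬ ((1 ≤ (f' : ℤ) + 1 + K ∧ (f' : ℤ) + 1 + K ≤ K) ∨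
      (K + 1 ≤ (f' : ℤ) + 1 + K ∧ (f' : ℤ) + 1 + K ≤ 0)) := fun hh => hf3 (hag _ hh)
    have hb4 : ¬ (-(b : ℤ) ≤ -((b' : ℤ) + 1) + K ∧ -((b' : ℤ) + 1) + K ≤ f) := fun hh =>
      hb3 (hc.agree _ hh.1 hh.2)
    have hb5 : ¬ ((1 ≤ -((b' : ℤ) + 1) + K ∧ -((b' : ℤ) + 1) + K ≤ K) ∨
      (K + 1 ≤ -((b' : ℤ) + 1) + K ∧ -((b' : ℤ) + 1) + K ≤ 0)) := fun hh => hb3 (hag _ hh)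
    have e1 : (f : ℤ) = f' + K := by omega
    have e2 : (b : ℤ) = b' - K := by omega
    obtain ⟨t, ht⟩ := hK
    have : K = 0 := by omega
    exact ⟨hi' this, hj' this⟩
  · exfalso
    rw [hi, hj, zero_add, sub_zero] at h0'
    rcases lt_trichotomy K 0 with hl | rfl | hl
    · rw [← hag (K + 1) (by omega)] at h0'
      exact h.W_red I K h0'
    · rw [h0, zero_add] at h0'
      exact h.W_red J 0 (by simpa using h0')
    · rw [hag K (by omega)] at h0'
      exact h.W_red J K h0'
  · exfalso
    rw [hi, hj, zero_add, sub_zero] at h0'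
    rcases lt_trichotomy K 0 with hl | rfl | hl
    · rw [hag (K + 1) (by omega)] at h0'
      exact h.W_red J K h0'.symm
    · rw [← h0, zero_add] at h0'
      exact h.W_red I 0 (by simpa using h0'.symm)
    · rw [← hag K (by omega)] at h0'
      exact h.W_red I K h0'.symm
  · exfalso
    have hf2 : ¬ (-(b' : ℤ) ≤ K + 1 - (f + 1) ∧ K + 1 - ((f : ℤ) + 1) ≤ f') := fun hh => hc.ne_f <| by
      have := hc'.agree _ hh.1 hh.2
      rwa [hi, hj, sub_sub_cancel] at this
    have hb2 : ¬ (-(b' : ℤ) ≤ K + 1 - -((b : ℤ) + 1) ∧ K + 1 - -((b : ℤ) + 1) ≤ f') :=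
      fun hh => hc.ne_b <| by
        have := hc'.agree _ hh.1 hh.2
        rwa [hi, hj, sub_sub_cancel] at this
    have hf3 := hc'.ne_f
    have hb3 := hc'.ne_b
    rw [hi, hj] at hf3 hb3
    have hf4 : ¬ (-(b : ℤ) ≤ K + 1 - (f' + 1) ∧ K + 1 - ((f' : ℤ) + 1) ≤ f) := fun hh =>
      hf3 (hc.agree _ hh.1 hh.2)
    have hf5 : ¬ ((1 ≤ K + 1 - ((f' : ℤ) + 1) ∧ K + 1 - ((f' : ℤ) + 1) ≤ K) ∨
      (K + 1 ≤ K + 1 - ((f' : ℤ) + 1) ∧ K + 1 - ((f' : ℤ) + 1) ≤ 0)) := fun hh => hf3 (hag _ hh)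
    have hb4 : ¬ (-(b : ℤ) ≤ K + 1 - -((b' : ℤ) + 1) ∧ K + 1 - -((b' : ℤ) + 1) ≤ f) := fun hh =>
      hb3 (hc.agree _ hh.1 hh.2)
    have hb5 : ¬ ((1 ≤ K + 1 - -((b' : ℤ) + 1) ∧ K + 1 - -((b' : ℤ) + 1) ≤ K) ∨
      (K + 1 ≤ K + 1 - -((b' : ℤ) + 1) ∧ K + 1 - -((b' : ℤ) + 1) ≤ 0)) :=
      fun hh => hb3 (hag _ hh)
    have e1 : (f : ℤ) = K + 1 + b' := by omega
    have e2 : (b : ℤ) = f' - K - 1 := by omega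
    obtain ⟨t, ht⟩ := hK
    have hK2 : K = 0 ∨ K = -2 := by omega
    rcases hK2 with rfl | rfl
    · have w1 : Fp s I 0 = -1 := by
        rcases hw with hw | ⟨-, hw⟩ | ⟨hw, -⟩
        · omega
        · exact hw
        · omega
      have w2 : Fp s i 0 = -1 := by
        rcases hw' with hw | ⟨-, hw⟩ | ⟨hw, -⟩
        · omega
        · exact hw
        · omega
      have g : Fp s i 0 = -Fp s I 0 := by
        simp only [Fp, dig, hi, Nat.cast_zero]
        norm_num
        have := turn_swap (a := s I) (b := W s I 1) (by simpa using h.W_red I 0)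
        omega
      omega
    · have w1 : Fm s I 0 = -1 := by
        rcases hw with hw | ⟨hw, -⟩ | ⟨-, hw⟩
        · omega
        · omega
        · exact hw
      have w2 : Fm s i 0 = -1 := by
        rcases hw' with hw | ⟨hw, -⟩ | ⟨-, hw⟩
        · omega
        · omega
        · exact hw
      have g : Fm s i 0 = -Fm s I 0 := by
        simp only [Fm, dig, hi, Nat.cast_zero]
        norm_num
        have := turn_swap (a := s I) (b := W s I (-1)) (by simpa using h.W_red' I 0)
        omega
      omega

end Strip

namespace Strip

/-- The letter with a given index. -/
def toLetter : ZMod 3 → Letter := ![Letter.x, Letter.y, Letter.z]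

/-- The index of a letter. -/
def code : Letter → ZMod 3
  | .x => 0
  | .y => 1
  | .z => 2

lemma code_injective : Function.Injective code := by
  intro a b h
  cases a <;> cases b <;> first | rfl | exact absurd h (by decide)

lemma code_toLetter (a : ZMod 3) : code (toLetter a) = a := by
  rcases letter_cases a with rfl | rfl | rfl <;> rfl

lemma code_surjective : Function.Surjective code := fun a => ⟨_, code_toLetter a⟩

lemma R_mul_R (a b : Letter) : R (code a) * R (code b) = toG (pairM a b) := by
  apply Units.ext
  show reflMat (code a) * reflMat (code b) = (pairM a b).1
  cases a <;> cases b <;> decide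

variable {s : ℤ → ZMod 3} {P : ℤ → GL (Fin 2) ℤ} {N : ℕ}

lemma exists_pair (a b : ZMod 3) : ∃ g : Gamma, toG (g : SL2Z) = R a * R b :=
  ⟨⟨_, pairM_mem (toLetter a) (toLetter b)⟩, by
    rw [← R_mul_R, code_toLetter, code_toLetter]⟩

lemma Frames.exists_gamma (hP : Frames s P) {n : ℤ} (hn : Even n) :
    ∃ g : Gamma, toG (g : SL2Z) = P n := by
  obtain ⟨m, rfl⟩ := hn
  induction m using Int.induction_on with
  | zero => exact ⟨1, by rw [add_zero, hP.zero]; exact map_one _⟩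
  | succ m ih =>
    obtain ⟨g, hg⟩ := ih
    obtain ⟨g', hg'⟩ := exists_pair (s (m + m)) (s (m + m + 1))
    refine ⟨g * g', ?_⟩
    rw [Subgroup.coe_mul, map_mul, hg, hg',
      show (m : ℤ) + 1 + (m + 1) = m + m + 1 + 1 by ring, hP.succ, hP.succ, mul_assoc]
  | pred m ih =>
    obtain ⟨g, hg⟩ := ih
    obtain ⟨g', hg'⟩ := exists_pair (s (-m - 1 + (-m - 1) + 1)) (s (-m - 1 + (-m - 1)))
    refine ⟨g * g', ?_⟩
    rw [Subgroup.coe_mul, map_mul, hg, hg', hP.pred (-(m : ℤ) - 1 + (-m - 1)),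
      hP.pred (-(m : ℤ) - 1 + (-m - 1) + 1),
      show -(m : ℤ) - 1 + (-m - 1) + 1 + 1 = -m + -m by ring, mul_assoc]

lemma Frames.exists_slot (hP : Frames s P) (i : ℤ) : ∃ g : Gamma, toG (g : SL2Z) = T P i 0 := by
  unfold T
  split_ifs with hi
  · exact hP.exists_gamma (by rwa [sub_zero])
  · exact hP.exists_gamma (by grind)

lemma Frames.T_add_period (hP : Frames s P) (h : PerSeq s N) (i m : ℤ) :
    T P (i + m * N) 0 = P N ^ m * T P i 0 := by
  have he : Even (i + m * N) ↔ Even i := by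
    have : Even (m * (N : ℤ)) := ((Int.even_coe_nat N).2 h.even).mul_left m
    rw [Int.even_add]
    tauto
  unfold T
  simp only [he]
  split_ifs
  · rw [← hP.add_mul_period h.per]; congr 1; ring
  · rw [← hP.add_mul_period h.per]; congr 1; ring

lemma Adm.congr {i j I J : ℤ} {b f : ℕ} (hi : W s i = W s I) (hj : W s j = W s J)
    (h : Adm s i j b f) : Adm s I J b f := by
  obtain ⟨⟨h1, h2, h3, h4⟩, h5⟩ := h
  have e1 : Fp s i = Fp s I := by unfold Fp; rw [hi]
  have e2 : Fm s i = Fm s I := by unfold Fm; rw [hi]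
  rw [e1, e2] at h4
  rw [e1, e2] at h5
  rw [hi, hj] at h2 h3
  exact ⟨⟨fun k => by rw [← hi, ← hj]; exact h1 k, h2, h3, h4⟩, h5⟩

/-- Every conflict contributes its own double coset. -/
theorem Frames.confSet_card_le (hP : Frames s P) (h : PerSeq s N) [NeZero N] {v : Gamma}
    (hv : toG (v : SL2Z) = P N) : (confSet s N).card ≤ sTwo v := by
  have hyp : Hyperbolic (v : SL2Z) := by
    have := hP.two_lt_abs_trace h (by rw [← hv]; exact (v : SL2Z).2)
    rwa [← hv] at this
  obtain ⟨e₁, e₂, l, ax⟩ := hyp.exists_axis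
  have ax' := ax
  rw [hv] at ax'
  choose g hg using hP.exists_slot
  have hmem : ∀ p : confSet s N, ∃ b f, Adm s (rep p.1.1) (rep p.1.2) b f := fun p =>
    (Finset.mem_filter.1 p.2).2
  have good : ∀ p : confSet s N, GoodConj v (g (rep p.1.1) * (g (rep p.1.2))⁻¹) := by
    intro p
    obtain ⟨b, f, hc, -⟩ := hmem p
    rw [goodConj_iff hyp ax, Subgroup.coe_mul, Subgroup.coe_inv, map_mul, map_inv, hg, hg]
    exact hP.chi_neg h ax' hc
  have hfin := finite_crossings hyp
  rw [sTwo_eq, ← Nat.card_eq_finsetCard]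
  refine Nat.card_le_card_of_injective
    (fun p : confSet s N => Quot.mk (sameCoset v) ⟨_, good p⟩) ?_
  intro p p' hpp
  obtain ⟨b, f, hA⟩ := hmem p
  obtain ⟨b', f', hA'⟩ := hmem p'
  have hrel := (sameCoset_equivalence v).eqvGen_iff.1 (Quot.eqvGen_exact hpp)
  obtain ⟨m, k, e⟩ := hrel
  have e' : T P (rep p'.1.1) 0 * (T P (rep p'.1.2) 0)⁻¹ =
      P N ^ m * (T P (rep p.1.1) 0 * (T P (rep p.1.2) 0)⁻¹) * P N ^ k := by
    have := congrArg (fun t : Gamma => toG (t : SL2Z)) e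
    simpa only [Subgroup.coe_mul, Subgroup.coe_inv, Subgroup.coe_zpow, map_mul, map_inv, map_zpow,
      hg, hv] using this
  set I := rep p.1.1 + m * N with hI
  set J := rep p.1.2 + (-k) * N with hJ
  have dI : (N : ℤ) ∣ rep p.1.1 - I := ⟨-m, by rw [hI]; ring⟩
  have dJ : (N : ℤ) ∣ rep p.1.2 - J := ⟨k, by rw [hJ]; ring⟩
  have tI : T P I 0 = P N ^ m * T P (rep p.1.1) 0 := hP.T_add_period h _ _
  have tJ : T P J 0 = P N ^ (-k) * T P (rep p.1.2) 0 := hP.T_add_period h _ _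
  have key : (T P I 0)⁻¹ * T P (rep p'.1.1) 0 = (T P J 0)⁻¹ * T P (rep p'.1.2) 0 := by
    rw [mul_inv_eq_iff_eq_mul] at e'
    rw [e', tI, tJ]
    group
  obtain ⟨h1, h2⟩ := hP.slots_eq h (hA.congr (h.W_congr dI) (h.W_congr dJ)) hA' key
  rw [← h1] at dI
  rw [← h2] at dJ
  exact Subtype.ext (Prod.ext (eq_of_dvd_rep dI) (eq_of_dvd_rep dJ))

end Strip

namespace Strip

lemma rho_reverse (l : List (ZMod 3)) : rho l.reverse = (rho l)⁻¹ := by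
  induction l with
  | nil => simp [rho_nil]
  | cons a l ih => rw [List.reverse_cons, rho_append, ih, rho_cons a l, rho_cons, rho_nil, mul_one,
      mul_inv_rev, R_inv]

lemma rho_flatten_replicate (n : ℕ) (l : List (ZMod 3)) :
    rho (List.replicate n l).flatten = rho l ^ n := by
  induction n with
  | zero => simp [rho_nil]
  | succ n ih => rw [List.replicate_succ, List.flatten_cons, rho_append, ih, pow_succ']

lemma toG_phiM : ∀ w : List Letter, Even w.length → toG (phiM w) = rho (w.map code)
  | [], _ => map_one _
  | [_], h => by simp at h
  | a :: b :: t, h => by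
    have ht : Even t.length := by
      simp only [List.length_cons] at h
      grind
    rw [phiM, map_mul, toG_phiM t ht, List.map_cons, List.map_cons, rho_cons, rho_cons,
      ← R_mul_R, mul_assoc]

lemma exists_gamma_rho {l : List (ZMod 3)} (hl : Even l.length) :
    ∃ g : Gamma, toG (g : SL2Z) = rho l := by
  obtain ⟨w, rfl⟩ : ∃ w : List Letter, w.map code = l :=
    ⟨l.map toLetter, by
      rw [List.map_map, show code ∘ toLetter = id from funext code_toLetter, List.map_id]⟩
  rw [List.length_map] at hl
  exact ⟨⟨_, phiM_mem w⟩, toG_phiM w hl⟩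

lemma exists_even_word {g : SL2Z} (hg : g ∈ Gamma) :
    ∃ l : List (ZMod 3), Even l.length ∧ toG g = rho l := by
  induction hg using Subgroup.closure_induction with
  | mem x hx =>
    rcases hx with rfl | rfl
    · exact ⟨[0, 1], by decide, by
        rw [rho_cons, rho_cons, rho_nil, mul_one]; exact (R_mul_R .x .y).symm⟩
    · exact ⟨[1, 2], by decide, by
        rw [rho_cons, rho_cons, rho_nil, mul_one]; exact (R_mul_R .y .z).symm⟩
  | one => exact ⟨[], by simp, map_one _⟩
  | mul x y _ _ hx hy =>
    obtain ⟨l, h1, h2⟩ := hx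
    obtain ⟨l', h1', h2'⟩ := hy
    exact ⟨l ++ l', by rw [List.length_append]; exact h1.add h1', by
      rw [rho_append, map_mul, h2, h2']⟩
  | inv x _ hx =>
    obtain ⟨l, h1, h2⟩ := hx
    exact ⟨l.reverse, by rwa [List.length_reverse], by rw [rho_reverse, map_inv, h2]⟩

lemma exists_reduced (l : List (ZMod 3)) : ∃ r : List (ZMod 3), r.IsChain (· ≠ ·) ∧
    (Even r.length ↔ Even l.length) ∧ rho r = rho l := by
  induction l with
  | nil => exact ⟨[], by simp, Iff.rfl, rfl⟩
  | cons a l ih =>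
    obtain ⟨r, h1, h2, h3⟩ := ih
    cases r with
    | nil =>
      refine ⟨[a], by simp, ?_, ?_⟩
      · simp only [List.length_cons, List.length_nil] at h2 ⊢
        grind
      · rw [rho_cons, rho_cons, h3]
    | cons b r =>
      by_cases hab : a = b
      · subst hab
        refine ⟨r, h1.tail, ?_, ?_⟩
        · simp only [List.length_cons] at h2 ⊢
          grind
        · rw [rho_cons a l, ← h3, rho_cons, R_mul_cancel]
      · refine ⟨a :: b :: r, List.isChain_cons_cons.2 ⟨hab, h1⟩, ?_, ?_⟩
        · simp only [List.length_cons] at h2 ⊢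
          grind
        · rw [rho_cons, h3, rho_cons a l]

lemma exists_cyclic_core (n : ℕ) : ∀ r : List (ZMod 3), r.length = 2 * n → r.IsChain (· ≠ ·) →
    ∃ c m : List (ZMod 3), r = c ++ m ++ c.reverse ∧ (m = [] ∨ (m ++ m).IsChain (· ≠ ·)) := by
  induction n with
  | zero =>
    intro r hr _
    rw [mul_zero, List.length_eq_zero_iff] at hr
    subst hr
    exact ⟨[], [], rfl, Or.inl rfl⟩
  | succ n ih =>
    intro r hr hc
    obtain ⟨a, r, rfl⟩ := List.exists_cons_of_length_pos (l := r) (by omega)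
    rw [List.length_cons] at hr
    rcases List.eq_nil_or_concat r with rfl | ⟨t, b, rfl⟩
    · simp at hr
      omega
    · rw [List.concat_eq_append] at *
      rw [List.length_append, List.length_singleton] at hr
      by_cases hab : a = b
      · subst hab
        have ht : t.IsChain (· ≠ ·) := (List.isChain_append.1 hc.tail).1
        obtain ⟨c, m, h1, h2⟩ := ih t (by omega) ht
        exact ⟨a :: c, m, by rw [h1]; simp, h2⟩
      · refine ⟨[], a :: (t ++ [b]), by simp, Or.inr ?_⟩
        rw [List.isChain_append]
        refine ⟨hc, hc, ?_⟩
        intro x hx y hy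
        rw [← List.cons_append, List.getLast?_concat] at hx
        simp only [List.head?_cons, Option.mem_some] at hx hy
        rw [← hx, ← hy]
        exact Ne.symm hab

lemma head?_flatten_replicate {n : ℕ} (hn : n ≠ 0) (m : List (ZMod 3)) :
    (List.replicate n m).flatten.head? = m.head? := by
  obtain ⟨n, rfl⟩ := Nat.exists_eq_succ_of_ne_zero hn
  cases m with
  | nil => simp
  | cons a m => rw [Nat.succ_eq_add_one, List.replicate_succ, List.flatten_cons]; simp

lemma getLast?_flatten_replicate {n : ℕ} (hn : n ≠ 0) (m : List (ZMod 3)) :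
    (List.replicate n m).flatten.getLast? = m.getLast? := by
  rw [← List.head?_reverse, List.reverse_flatten, List.map_replicate, List.reverse_replicate,
    head?_flatten_replicate hn, List.head?_reverse]

lemma isChain_flatten_replicate {m : List (ZMod 3)} (hm : (m ++ m).IsChain (· ≠ ·)) (n : ℕ) :
    (List.replicate n m).flatten.IsChain (· ≠ ·) := by
  induction n with
  | zero => simp
  | succ n ih =>
    rw [List.isChain_append] at hm
    rw [List.replicate_succ, List.flatten_cons, List.isChain_append]
    refine ⟨hm.1, ih, ?_⟩
    rcases Nat.eq_zero_or_pos n with rfl | hn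
    · simp
    · rw [head?_flatten_replicate hn.ne']
      exact hm.2.2

/-- A root of a cyclically reduced product is itself spelled by a root of the word. -/
lemma exists_root_word {u : List (ZMod 3)} (hu : u ≠ []) (hc : (u ++ u).IsChain (· ≠ ·))
    {v : Gamma} {n : ℕ} (hn : 1 ≤ n) (h : rho u = toG (v : SL2Z) ^ n) :
    ∃ m : List (ZMod 3), u = (List.replicate n m).flatten ∧ Even m.length ∧
      rho m = toG (v : SL2Z) := by
  obtain ⟨l, hl, e⟩ := exists_even_word v.2
  obtain ⟨r, hr, hrl, e'⟩ := exists_reduced l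
  rw [← e'] at e
  obtain ⟨k, hk⟩ := hrl.2 hl
  obtain ⟨c, m, h1, h2⟩ := exists_cyclic_core k r (by omega) hr
  have hce := List.isChain_append.1 hc
  have hval : rho u = rho (c ++ (List.replicate n m).flatten ++ c.reverse) := by
    rw [h, e, h1, rho_append, rho_append, rho_append, rho_append, rho_reverse,
      rho_flatten_replicate, conj_pow]
  have hm : m ≠ [] := by
    rintro rfl
    rw [List.flatten_replicate_nil, List.append_nil, rho_append, rho_reverse,
      mul_inv_cancel] at hval
    obtain ⟨a, t, rfl⟩ := List.exists_cons_of_ne_nil hu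
    exact rho_ne_one hce.1 hval
  have h2 := h2.resolve_left hm
  have hchain : (c ++ (List.replicate n m).flatten ++ c.reverse).IsChain (· ≠ ·) := by
    rw [h1, List.isChain_append, List.isChain_append] at hr
    obtain ⟨⟨a1, a2, a3⟩, a4, a5⟩ := hr
    rw [List.isChain_append, List.isChain_append, head?_flatten_replicate (by omega)]
    refine ⟨⟨a1, isChain_flatten_replicate h2 n, a3⟩, a4, ?_⟩
    rw [List.getLast?_append, getLast?_flatten_replicate (by omega), ← List.getLast?_append]
    exact a5
  have heq := rho_inj hce.1 hchain hval
  have hcn : c = [] := by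
    by_contra hcn
    obtain ⟨a, t, rfl⟩ := List.exists_cons_of_ne_nil hcn
    refine hce.2.2 a ?_ a ?_ rfl
    · rw [heq, List.reverse_cons, ← List.append_assoc, List.getLast?_concat, Option.mem_some]
    · rw [heq]; simp
  subst hcn
  simp only [List.nil_append, List.reverse_nil, List.append_nil] at heq h1
  exact ⟨m, heq, by rw [← h1]; exact hrl.2 hl, by rw [← h1, e]⟩

end Strip

namespace Strip

/-- The bi-infinite periodic sequence spelled by a word. -/
def cyc (m : List (ZMod 3)) (i : ℤ) : ZMod 3 := m.getD (i % m.length).toNat 0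

lemma cyc_add_length (m : List (ZMod 3)) (i : ℤ) : cyc m (i + m.length) = cyc m i := by
  rw [cyc, cyc, Int.add_emod_right]

lemma cyc_natCast {m : List (ZMod 3)} {k : ℕ} (hk : k < m.length) : cyc m k = m[k] := by
  rw [cyc, Int.emod_eq_of_lt (by omega) (by exact_mod_cast hk), Int.toNat_natCast,
    List.getD_eq_getElem _ _ hk]

lemma cyc_emod (m : List (ZMod 3)) (i : ℤ) : cyc m (i % m.length) = cyc m i := by
  rw [cyc, cyc, Int.emod_emod]

lemma exists_nat_cyc {m : List (ZMod 3)} (hm : m ≠ []) (i : ℤ) :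
    ∃ r : ℕ, r < m.length ∧ ∀ j : ℤ, cyc m (i + j) = cyc m (r + j) := by
  have hN : (0 : ℤ) < m.length := by exact_mod_cast List.length_pos_of_ne_nil hm
  have h0 := Int.emod_nonneg i hN.ne'
  have h1 := Int.emod_lt_of_pos i hN
  refine ⟨(i % m.length).toNat, by omega, fun j => ?_⟩
  rw [Int.toNat_of_nonneg h0, ← cyc_emod m (i + j), ← cyc_emod m (_ + j), Int.emod_add_emod]

lemma cyc_ne_succ {m : List (ZMod 3)} (hm : m ≠ []) (hc : (m ++ m).IsChain (· ≠ ·)) (i : ℤ) :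
    cyc m i ≠ cyc m (i + 1) := by
  obtain ⟨r, hr, h⟩ := exists_nat_cyc hm i
  have h0 := h 0
  rw [add_zero, add_zero] at h0
  rw [h0, h 1, cyc_natCast hr]
  rw [List.isChain_iff_getElem] at hc
  have := hc r (by rw [List.length_append]; omega)
  rw [List.getElem_append_left hr] at this
  rcases Nat.lt_or_ge (r + 1) m.length with h1 | h1
  · rw [List.getElem_append_left h1] at this
    rw [← Nat.cast_succ, cyc_natCast h1]
    exact this
  · rw [List.getElem_append_right h1] at this
    have e : ((r : ℤ) + 1) = ((r + 1 - m.length : ℕ) : ℤ) + m.length := by omega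
    rw [e, cyc_add_length, cyc_natCast (by omega)]
    exact this

lemma cyc_surjective {m : List (ZMod 3)} (h : ∀ a, a ∈ m) : Function.Surjective (cyc m) := by
  intro a
  obtain ⟨k, hk, rfl⟩ := List.getElem_of_mem (h a)
  exact ⟨k, cyc_natCast hk⟩

lemma cyc_of_rotate_eq {m : List (ZMod 3)} {d : ℕ} (hm : m ≠ []) (h : m.rotate d = m) (i : ℤ) :
    cyc m (i + d) = cyc m i := by
  obtain ⟨r, hr, e⟩ := exists_nat_cyc hm i
  have e0 := e 0
  rw [add_zero, add_zero] at e0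
  rw [e0, e, cyc_natCast hr, ← cyc_emod, ← Nat.cast_add, ← Int.natCast_mod,
    cyc_natCast (Nat.mod_lt _ (by omega)), ← List.getElem_rotate m d r (by simpa using hr)]
  congr 1

variable {s : ℤ → ZMod 3} {P : ℤ → GL (Fin 2) ℤ}

lemma Frames.natCast (hP : Frames s P) (n : ℕ) :
    P n = rho ((List.range n).map fun k : ℕ => s k) := by
  induction n with
  | zero => exact hP.zero
  | succ n ih =>
    rw [List.range_succ, List.map_append, rho_append, ← ih, Nat.cast_succ, hP.succ, List.map_singleton,
      rho_cons, rho_nil, mul_one]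

lemma Frames.length_cyc {m : List (ZMod 3)} (hP : Frames (cyc m) P) : P m.length = rho m := by
  rw [hP.natCast]
  congr 1
  apply List.ext_getElem
  · simp
  · intro k h1 h2
    rw [List.getElem_map, List.getElem_range, cyc_natCast h2]

/-- A word spelling an element that is not a proper power has no shorter even period. -/
lemma Frames.perSeq {m : List (ZMod 3)} (hP : Frames (cyc m) P) (hm : m ≠ [])
    (hc : (m ++ m).IsChain (· ≠ ·)) (he : Even m.length) (ha : ∀ a, a ∈ m) {v : Gamma}
    (hv : NotProperPower v) (hvm : rho m = toG (v : SL2Z)) : PerSeq (cyc m) m.length := by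
  have hN : 0 < m.length := List.length_pos_of_ne_nil hm
  refine ⟨hN, he, cyc_add_length m, cyc_ne_succ hm hc, fun p hp hper => ?_, cyc_surjective ha⟩
  by_contra hnd
  have hg : ∀ i, cyc m (i + (Int.gcd p m.length : ℕ)) = cyc m i := by
    have h1 : Function.Periodic (cyc m) p := hper
    have h2 : Function.Periodic (cyc m) (m.length : ℤ) := cyc_add_length m
    intro i
    rw [Int.gcd_eq_gcd_ab, mul_comm p, mul_comm (m.length : ℤ)]
    exact (h1.int_mul _).add_period (h2.int_mul _) i
  obtain ⟨k, hk⟩ : (Int.gcd p m.length : ℕ) ∣ m.length := by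
    exact_mod_cast Int.gcd_dvd_right p m.length
  have hge : Even ((Int.gcd p m.length : ℕ) : ℤ) := by
    rw [even_iff_two_dvd] at hp he ⊢
    exact Int.dvd_coe_gcd hp (by exact_mod_cast he)
  have hgp : ((Int.gcd p m.length : ℕ) : ℤ) ∣ p := Int.gcd_dvd_left p m.length
  generalize Int.gcd p m.length = g at *
  obtain ⟨x, hx⟩ := hP.exists_gamma hge
  apply hv
  refine ⟨x, k, ?_, ?_⟩
  · rcases k with _ | _ | k
    · omega
    · rw [zero_add, mul_one] at hk
      rw [← hk] at hgp
      exact absurd hgp hnd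
    · omega
  · apply Subtype.ext
    apply toG_injective
    rw [← hvm, ← hP.length_cyc, Subgroup.coe_pow, map_pow, hx]
    have := hP.add_mul_period hg 0 k
    rw [zero_add, hP.zero, mul_one, zpow_natCast] at this
    rw [← this, hk]
    push_cast
    rw [mul_comm]

end Strip

namespace Strip

lemma isChain_of_flatten_replicate {m : List (ZMod 3)} {k : ℕ} (hk : 1 ≤ k)
    (hc : ((List.replicate k m).flatten ++ (List.replicate k m).flatten).IsChain (· ≠ ·)) :
    (m ++ m).IsChain (· ≠ ·) := by
  obtain ⟨k, rfl⟩ := Nat.exists_eq_add_of_le' hk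
  rw [List.isChain_append, getLast?_flatten_replicate (by omega),
    head?_flatten_replicate (by omega)] at hc
  have hm := hc.1
  rw [List.replicate_succ, List.flatten_cons, List.isChain_append] at hm
  exact List.isChain_append.2 ⟨hm.1, hm.1, hc.2.2⟩

/-- Every cyclically reduced word of even length spells a power of a non-power. -/
lemma exists_root (N : ℕ) : ∀ u : List (ZMod 3), u.length = N → u ≠ [] →
    (u ++ u).IsChain (· ≠ ·) → Even u.length →
    ∃ (v : Gamma) (n : ℕ), 1 ≤ n ∧ NotProperPower v ∧ rho u = toG (v : SL2Z) ^ n := by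
  induction N using Nat.strong_induction_on with
  | _ N ih =>
    intro u hN hu hc he
    obtain ⟨g, hg⟩ := exists_gamma_rho he
    by_cases hp : NotProperPower g
    · exact ⟨g, 1, le_rfl, hp, by rw [pow_one, hg]⟩
    · obtain ⟨t, k, hk, rfl⟩ := not_not.1 hp
      rw [Subgroup.coe_pow, map_pow] at hg
      obtain ⟨m, rfl, hme, hmt⟩ := exists_root_word hu hc (by omega) hg.symm
      have hm : m ≠ [] := by
        rintro rfl
        simp at hu
      have hpos : 0 < m.length := List.length_pos_of_ne_nil hm
      have hN : k * m.length = N := by simpa using hN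
      obtain ⟨v, n, hn, hv, e⟩ := ih m.length (by nlinarith) m rfl hm
        (isChain_of_flatten_replicate (by omega) hc) hme
      refine ⟨v, n * k, by nlinarith, hv, ?_⟩
      rw [rho_flatten_replicate, e, pow_mul]

variable {m : List (ZMod 3)}

lemma length_le_sTwo (hm : m ≠ []) (hc : (m ++ m).IsChain (· ≠ ·)) (he : Even m.length)
    (ha : ∀ a, a ∈ m) {v : Gamma} (hv : NotProperPower v) (hvm : rho m = toG (v : SL2Z)) :
    m.length ≤ sTwo v + 2 := by
  obtain ⟨P, hP⟩ := exists_frames (cyc m)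
  have h := hP.perSeq hm hc he ha hv hvm
  have : NeZero m.length := ⟨h.pos.ne'⟩
  obtain ⟨l, hl⟩ := he
  have h1 := h.confSet_card_ge (l := l) (by omega)
  have h2 := hP.confSet_card_le h (v := v) (by rw [← hvm, hP.length_cyc])
  omega

lemma two_mul_length_le_sTwo (hm : m ≠ []) (hc : (m ++ m).IsChain (· ≠ ·)) (he : Even m.length)
    (ha : ∀ a, a ∈ m) {v : Gamma} (hv : NotProperPower v) (hvm : rho m = toG (v : SL2Z))
    {d : ℕ} (hd : 0 < d) (hdm : d < m.length) (hrot : m.rotate d = m) :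
    2 * m.length ≤ sTwo v + 6 := by
  obtain ⟨P, hP⟩ := exists_frames (cyc m)
  have h := hP.perSeq hm hc he ha hv hvm
  have : NeZero m.length := ⟨h.pos.ne'⟩
  have hper := cyc_of_rotate_eq hm hrot
  have hodd : Odd d := by
    by_contra hno
    have := h.minimal d (by exact_mod_cast Nat.not_odd_iff_even.1 hno) hper
    have := Nat.le_of_dvd hd (by exact_mod_cast this)
    omega
  have h2d : m.length ∣ 2 * d := by
    have := h.minimal (2 * d) (even_two_mul _) fun i => by
      rw [show i + 2 * (d : ℤ) = i + d + d by ring, hper, hper]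
    exact_mod_cast this
  have hN : m.length = 2 * d := by
    obtain ⟨k, hk⟩ := h2d
    have : k < 2 := by
      by_contra! h2
      nlinarith
    interval_cases k <;> omega
  have h1 := h.confSet_card_ge_of_half_period (l := d) hN hodd hper
  have h2 := hP.confSet_card_le h (v := v) (by rw [← hvm, hP.length_cyc])
  omega

lemma three_le_length (ha : ∀ a, a ∈ m) : 3 ≤ m.length := by
  have : (Finset.univ : Finset (ZMod 3)) ⊆ m.toFinset := fun a _ => List.mem_toFinset.2 (ha a)
  calc 3 = (Finset.univ : Finset (ZMod 3)).card := rfl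
    _ ≤ m.toFinset.card := Finset.card_le_card this
    _ ≤ m.length := m.toFinset_card_le

lemma isChain_of_cyclRed {w : List Letter} (h : CyclRed w) :
    (w.map code ++ w.map code).IsChain (· ≠ ·) := by
  rw [← List.map_append, List.isChain_map, List.isChain_iff_getElem]
  intro i hi
  rw [List.length_append] at hi
  have hpos : 0 < w.length := by omega
  have key : ∀ (k : ℕ) (hk : k < (w ++ w).length), (w ++ w)[k] = cget w (k % w.length) := by
    intro k hk
    rw [List.length_append] at hk
    rw [cget, Nat.mod_mod, List.getD_eq_getElem _ _ (Nat.mod_lt _ hpos)]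
    rcases Nat.lt_or_ge k w.length with h1 | h1
    · rw [List.getElem_append_left h1]
      simp only [Nat.mod_eq_of_lt h1]
    · rw [List.getElem_append_right h1]
      simp only [Nat.mod_eq_sub_mod h1, Nat.mod_eq_of_lt (show k - w.length < w.length by omega)]
  rw [key, key]
  have := h.2 (i % w.length) (Nat.mod_lt _ hpos)
  intro e
  apply this
  apply code_injective
  rw [e, cget, cget, Nat.mod_mod, Nat.mod_add_mod]

lemma rotate_flatten_replicate {α : Type*} (k : ℕ) (u : List α) :
    (List.replicate k u).flatten.rotate u.length = (List.replicate k u).flatten := by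
  cases k with
  | zero => simp
  | succ k =>
    rw [List.replicate_succ, List.flatten_cons, List.rotate_append_length_eq, ← List.flatten_cons,
      ← List.replicate_succ, List.replicate_succ', List.flatten_append, List.flatten_singleton]

lemma rotate_eq_self_of_rotate {α : Type*} {w u : List α} {j k : ℕ}
    (h : w.rotate j = (List.replicate k u).flatten) : w.rotate u.length = w := by
  have e := rotate_flatten_replicate k u
  rw [← h, List.rotate_rotate, add_comm, ← List.rotate_rotate] at e
  exact List.rotate_injective j e

end Strip

open Strip in
theorem almost_simple_geodesics_stmt10 (w : List Letter) (hcr : CyclRed w)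
    (heven : 2 ∣ w.length) (hall : ∀ l : Letter, l ∈ w)
    (himp : ∃ u : List Letter, ∃ k : ℕ, 2 ≤ k ∧ u.length < w.length ∧
      ∃ j : ℕ, w.rotate j = (List.replicate k u).flatten) :
    -3 ≤ Iw w - 2 * Lw w := by
  have hw : w.map code ≠ [] := by simpa using hcr.1
  have hchain := isChain_of_cyclRed hcr
  have he : Even w.length := even_iff_two_dvd.2 heven
  have hphi := toG_phiM w he
  have hmem : ∀ a, a ∈ w.map code := fun a => by
    obtain ⟨l, rfl⟩ := code_surjective a
    exact List.mem_map_of_mem (hall l)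
  have hex : ∃ p : Gamma × ℕ, 1 ≤ p.2 ∧ NotProperPower p.1 ∧
      (⟨phiM w, phiM_mem w⟩ : Gamma) = p.1 ^ p.2 := by
    obtain ⟨v, n, hn, hv, e⟩ := exists_root _ _ rfl hw hchain (by simpa using he)
    refine ⟨(v, n), hn, hv, Subtype.ext (toG_injective ?_)⟩
    rw [Subgroup.coe_pow, map_pow, ← e]
    exact hphi
  rw [Iw, Iγ, dif_pos hex]
  obtain ⟨hn, hv, e⟩ := hex.choose_spec
  generalize hex.choose = p at *
  obtain ⟨v, n⟩ := p
  simp only at hn hv e ⊢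
  have e' : rho (w.map code) = toG (v : SL2Z) ^ n := by
    rw [← hphi, ← map_pow, ← Subgroup.coe_pow, ← e]
  obtain ⟨m, hm, hme, hmv⟩ := exists_root_word hw hchain hn e'
  have hm0 : m ≠ [] := by
    rintro rfl
    rw [hm] at hw
    simp at hw
  have hmc : (m ++ m).IsChain (· ≠ ·) := by
    rw [hm] at hchain
    exact isChain_of_flatten_replicate hn hchain
  have hma : ∀ a, a ∈ m := fun a => by
    have := hmem a
    rw [hm, List.mem_flatten] at this
    obtain ⟨t, ht, hat⟩ := this
    rwa [List.eq_of_mem_replicate ht] at hat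
  have hlen : w.length = n * m.length := by
    rw [← List.length_map (as := w) code, hm]
    simp
  have h3 := three_le_length hma
  have hle := length_le_sTwo hm0 hmc hme hma hv hmv
  obtain ⟨l, hl⟩ := hme
  have hL : Lw w = n * l := by
    rw [Lw, hlen, hl]
    push_cast
    rw [show (n : ℤ) * (l + l) = n * l * 2 by ring]
    exact Int.mul_ediv_cancel _ two_ne_zero
  rw [hL]
  rcases Nat.lt_or_ge n 2 with h2 | h2
  · obtain rfl : n = 1 := by omega
    obtain ⟨u, k, hk, hu, j, hj⟩ := himp
    have hwm : w.map code = m := by simpa using hm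
    have hu0 : 0 < u.length := by
      rw [Nat.pos_iff_ne_zero]
      intro h0
      rw [List.length_eq_zero_iff.1 h0, List.flatten_replicate_nil, List.rotate_eq_nil_iff] at hj
      exact hcr.1 hj
    have hrot : m.rotate u.length = m := by
      rw [← hwm, ← List.map_rotate, rotate_eq_self_of_rotate hj]
    have := two_mul_length_le_sTwo hm0 hmc ⟨l, hl⟩ hma hv hmv hu0 (by omega) hrot
    push_cast
    omega
  · have hs : (l : ℤ) - 1 ≤ ((sTwo v / 2 : ℕ) : ℤ) := by omega
    have hl2 : (2 : ℤ) ≤ l := by omega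
    have hn2 : (2 : ℤ) ≤ n := by exact_mod_cast h2
    nlinarith [mul_le_mul_of_nonneg_left hs (sq_nonneg (n : ℤ)),
      mul_nonneg (sub_nonneg.2 hl2) (mul_nonneg (sub_nonneg.2 hn2) (by omega : (0 : ℤ) ≤ n)),
      sq_nonneg ((n : ℤ) - 2)]
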